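/- arXiv:1605.02451 — 7 statements merged into one kernel-verified Lean document; each statement's English description precedes it below -/
import Mathlib

section
/- Let V : ℝ² → ℝ be smooth with bounded derivatives and let x₀ ∈ ℝ² satisfy ∇V(x₀) ≠ 0. Then there exist τ₀ > 0 and a unique Lipschitz continuous map t ↦ (x(t), ξ(t)) from [−τ₀, τ₀] to ℝ² × ℝ² such that x(0) = x₀, ξ(0) = 0, for every t ∈ [−τ₀, τ₀] \ {0} one has ξ(t) ≠ 0, x′(t) = ξ(t)/|ξ(t)| and ξ′(t) = −∇V(x(t)), and the one-sided limits of the derivatives satisfy: x′(t) → −∇V(x₀)/|∇V(x₀)| as t → 0⁺, x′(t) → +∇V(x₀)/|∇V(x₀)| as t → 0⁻, and ξ′(t) → −∇V(x₀) as t → 0. -/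
open Filter Topology Set
open scoped RealInnerProductSpace

noncomputable section

/-- The predicate describing a generalized trajectory of the plus Hamiltonian flow of
`|ξ| + V(x)` through the conical point `(x₀, 0)`, on the time interval `[-τ₀, τ₀]`:
Lipschitz continuity, the initial conditions, the ODE `x' = ξ/|ξ|`, `ξ' = -∇V(x)` away
from `t = 0`, and the prescribed one-sided limits of the derivatives at `t = 0`. -/
def IsGenTraj (V : EuclideanSpace ℝ (Fin 2) → ℝ) (x₀ : EuclideanSpace ℝ (Fin 2))
    (τ₀ : ℝ) (x ξ : ℝ → EuclideanSpace ℝ (Fin 2)) : Prop :=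
  (∃ K : NNReal, LipschitzOnWith K (fun t => (x t, ξ t)) (Set.Icc (-τ₀) τ₀)) ∧
  x 0 = x₀ ∧ ξ 0 = 0 ∧
  (∀ t ∈ Set.Icc (-τ₀) τ₀, t ≠ 0 →
    ξ t ≠ 0 ∧
    HasDerivWithinAt x (‖ξ t‖⁻¹ • ξ t) (Set.Icc (-τ₀) τ₀) t ∧
    HasDerivWithinAt ξ (-(gradient V (x t))) (Set.Icc (-τ₀) τ₀) t) ∧
  -- x′(t) = ξ(t)/|ξ(t)| → −∇V(x₀)/|∇V(x₀)| as t → 0⁺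
  Tendsto (fun t => ‖ξ t‖⁻¹ • ξ t) (𝓝[>] (0:ℝ))
    (𝓝 (-(‖gradient V x₀‖⁻¹ • gradient V x₀))) ∧
  -- x′(t) = ξ(t)/|ξ(t)| → +∇V(x₀)/|∇V(x₀)| as t → 0⁻
  Tendsto (fun t => ‖ξ t‖⁻¹ • ξ t) (𝓝[<] (0:ℝ))
    (𝓝 (‖gradient V x₀‖⁻¹ • gradient V x₀)) ∧
  -- ξ′(t) = −∇V(x(t)) → −∇V(x₀) as t → 0
  Tendsto (fun t => -(gradient V (x t))) (𝓝[≠] (0:ℝ)) (𝓝 (-(gradient V x₀)))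

section SingularFlow

variable {E : Type*} [NormedAddCommGroup E]

section Clip

variable [NormedSpace ℝ E] {r : ℝ}

lemma inv_norm_smul_smul {t : ℝ} (ht : t ≠ 0) (v : E) :
    ‖t • v‖⁻¹ • t • v = (SignType.sign t : ℝ) • ‖v‖⁻¹ • v := by
  rw [norm_smul, smul_smul, smul_smul, mul_inv, Real.norm_eq_abs]
  rcases ht.lt_or_gt with h | h
  · rw [abs_of_neg h, sign_neg h, SignType.coe_neg_one]
    congr 1
    field_simp
  · rw [abs_of_pos h, sign_pos h, SignType.coe_one]
    congr 1
    field_simp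

/-- Globally Lipschitz modification of `v ↦ ‖v‖⁻¹ • v`, unchanged on `r ≤ ‖v‖`. -/
def clippedUnit (r : ℝ) (v : E) : E := (max r ‖v‖)⁻¹ • v

lemma norm_clippedUnit_le (hr : 0 < r) (v : E) : ‖clippedUnit r v‖ ≤ 1 := by
  have h : 0 < max r ‖v‖ := lt_max_of_lt_left hr
  rw [clippedUnit, norm_smul, norm_inv, Real.norm_of_nonneg h.le, inv_mul_le_one₀ h]
  exact le_max_right _ _

lemma clippedUnit_of_le {v : E} (h : r ≤ ‖v‖) : clippedUnit r v = ‖v‖⁻¹ • v := by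
  rw [clippedUnit, max_eq_right h]

lemma norm_clippedUnit_sub_le (hr : 0 < r) (v w : E) :
    ‖clippedUnit r v - clippedUnit r w‖ ≤ 2 / r * ‖v - w‖ := by
  have ha : 0 < max r ‖v‖ := lt_max_of_lt_left hr
  have hb : 0 < max r ‖w‖ := lt_max_of_lt_left hr
  have hinv : (max r ‖v‖)⁻¹ ≤ r⁻¹ := inv_anti₀ hr (le_max_left _ _)
  have hab : |max r ‖w‖ - max r ‖v‖| ≤ ‖v - w‖ := by
    rw [norm_sub_rev]
    exact (abs_max_sub_max_le_max _ _ _ _).trans (by simpa using abs_norm_sub_norm_le w v)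
  have hsplit : clippedUnit r v - clippedUnit r w =
      (max r ‖v‖)⁻¹ • ((v - w) + (max r ‖w‖ - max r ‖v‖) • clippedUnit r w) := by
    simp only [clippedUnit, smul_add, smul_sub, smul_smul, sub_smul, sub_mul]
    rw [mul_inv_cancel₀ hb.ne', inv_mul_cancel_left₀ ha.ne']
    module
  rw [hsplit, norm_smul, norm_inv, Real.norm_of_nonneg ha.le]
  calc (max r ‖v‖)⁻¹ * ‖(v - w) + (max r ‖w‖ - max r ‖v‖) • clippedUnit r w‖
      ≤ r⁻¹ * (‖v - w‖ + ‖v - w‖ * 1) := by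
        gcongr
        refine (norm_add_le _ _).trans ?_
        rw [norm_smul, Real.norm_eq_abs]
        gcongr
        exact norm_clippedUnit_le hr w
    _ = 2 / r * ‖v - w‖ := by ring

lemma continuous_clippedUnit (hr : 0 < r) : Continuous (clippedUnit r : E → E) :=
  ((continuous_const.max continuous_norm).inv₀
    fun _ => (lt_max_of_lt_left hr).ne').smul continuous_id

end Clip

variable [NormedSpace ℝ E] {F : E → E} {L : NNReal} {r τ : ℝ}

/-- The average of `F ∘ y` over the segment from `0` to `t`. -/
def segmentAverage (F : E → E) (y : ℝ → E) (t : ℝ) : E := ∫ u in (0 : ℝ)..1, F (y (t * u))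

lemma smul_segmentAverage (F : E → E) (y : ℝ → E) (t : ℝ) :
    t • segmentAverage F y t = ∫ s in (0 : ℝ)..t, F (y s) := by
  simpa [segmentAverage] using
    intervalIntegral.smul_integral_comp_mul_left (fun s => F (y s)) (a := 0) (b := 1) t

lemma mul_mem_Icc_of_mem_uIcc {t u : ℝ} (ht : t ∈ Icc 0 τ) (hu : u ∈ uIcc (0 : ℝ) 1) :
    t * u ∈ Icc 0 τ := by
  rw [uIcc_of_le zero_le_one] at hu
  exact ⟨mul_nonneg ht.1 hu.1, (mul_le_of_le_one_right ht.1 hu.2).trans ht.2⟩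

lemma segmentAverage_congr {y z : ℝ → E} (h : EqOn y z (Icc 0 τ)) {t : ℝ} (ht : t ∈ Icc 0 τ) :
    segmentAverage F y t = segmentAverage F z t :=
  intervalIntegral.integral_congr fun _ hu => by
    simp only [h (mul_mem_Icc_of_mem_uIcc ht hu)]

lemma segmentAverage_comp_abs (F : E → E) (z : ℝ → E) (t : ℝ) :
    segmentAverage F (fun s => z |s|) t = segmentAverage F z |t| :=
  intervalIntegral.integral_congr fun u hu => by
    rw [uIcc_of_le zero_le_one] at hu
    simp only [abs_mul, abs_of_nonneg hu.1]

lemma continuous_segmentAverage (hF : Continuous F) {y : ℝ → E} (hy : Continuous y) :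
    Continuous (segmentAverage F y) :=
  intervalIntegral.continuous_parametric_intervalIntegral_of_continuous'
    (f := fun t u => F (y (t * u))) (by fun_prop) 0 1

lemma norm_segmentAverage_sub_le (hF : LipschitzWith L F) {y z : ℝ → E} (hy : Continuous y)
    (hz : Continuous z) {C : ℝ} (hyz : ∀ t ∈ Icc 0 τ, ‖y t - z t‖ ≤ C) {t : ℝ}
    (ht : t ∈ Icc 0 τ) : ‖segmentAverage F y t - segmentAverage F z t‖ ≤ L * C := by
  have hFc := hF.continuous
  rw [segmentAverage, segmentAverage, ← intervalIntegral.integral_sub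
    (Continuous.intervalIntegrable (by fun_prop) _ _)
    (Continuous.intervalIntegrable (by fun_prop) _ _)]
  refine (intervalIntegral.norm_integral_le_of_norm_le_const (C := L * C) fun u hu => ?_).trans
    (by simp)
  refine (hF.norm_sub_le _ _).trans ?_
  gcongr
  exact hyz _ (mul_mem_Icc_of_mem_uIcc ht (uIoc_subset_uIcc hu))

lemma norm_sub_le_of_averaged_integral_equation (hr : 0 < r) {x₀ : E} {z : ℝ → E}
    (hz : ∀ t ∈ Icc 0 τ,
      z t = x₀ + ∫ s in (0 : ℝ)..t, clippedUnit r (segmentAverage F z s))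
    {t : ℝ} (ht : t ∈ Icc 0 τ) : ‖z t - x₀‖ ≤ τ := by
  rw [hz t ht, add_sub_cancel_left]
  refine (intervalIntegral.norm_integral_le_of_norm_le_const (C := 1)
    fun s _ => norm_clippedUnit_le hr _).trans ?_
  simpa [abs_of_nonneg ht.1] using ht.2

variable [CompleteSpace E]

lemma segmentAverage_const (F : E → E) (c : E) (t : ℝ) :
    segmentAverage F (fun _ => c) t = F c := by
  simp [segmentAverage]

lemma exists_unique_averaged_integral_equation (hF : LipschitzWith L F) (hr : 0 < r)
    (hτ : 0 ≤ τ) (hsmall : τ * (2 / r * L) < 1) (x₀ : E) :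
    ∃ z : ℝ → E, Continuous z ∧
      (∀ t ∈ Icc 0 τ, z t = x₀ + ∫ s in (0 : ℝ)..t, clippedUnit r (segmentAverage F z s)) ∧
      ∀ y : ℝ → E, ContinuousOn y (Icc 0 τ) →
        (∀ t ∈ Icc 0 τ,
          y t = x₀ + ∫ s in (0 : ℝ)..t, clippedUnit r (segmentAverage F y s)) →
        EqOn y z (Icc 0 τ) := by
  have hint : ∀ y : ℝ → E, Continuous y →
      Continuous fun s => clippedUnit r (segmentAverage F y s) := fun y hy =>
    (continuous_clippedUnit hr).comp (continuous_segmentAverage hF.continuous hy)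
  have hext : ∀ y : C(Icc 0 τ, E), Continuous (IccExtend hτ y) := fun y => y.continuous.Icc_extend'
  let Φ : C(Icc 0 τ, E) → C(Icc 0 τ, E) := fun y =>
    ⟨fun t => x₀ + ∫ s in (0 : ℝ)..t, clippedUnit r (segmentAverage F (IccExtend hτ y) s),
      continuous_const.add ((intervalIntegral.continuous_primitive
        (fun a b => (hint _ (hext y)).intervalIntegrable a b) 0).comp continuous_subtype_val)⟩
  have hK : 0 ≤ τ * (2 / r * L) := by positivity
  have hΦ : ContractingWith ⟨τ * (2 / r * L), hK⟩ Φ := by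
    refine ⟨hsmall, LipschitzWith.of_dist_le_mul fun y z => ?_⟩
    refine (ContinuousMap.dist_le (by positivity)).2 fun t => ?_
    have hdist : ∀ s ∈ Icc 0 τ, ‖IccExtend hτ y s - IccExtend hτ z s‖ ≤ dist y z := fun s _ => by
      rw [← dist_eq_norm]
      exact ContinuousMap.dist_apply_le_dist _
    simp only [Φ, ContinuousMap.coe_mk, dist_add_left, dist_eq_norm (∫ _ in _.._, _)]
    rw [← intervalIntegral.integral_sub ((hint _ (hext y)).intervalIntegrable _ _)
      ((hint _ (hext z)).intervalIntegrable _ _)]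
    refine (intervalIntegral.norm_integral_le_of_norm_le_const
      (C := 2 / r * (L * dist y z)) fun s hs => ?_).trans ?_
    · rw [uIoc_of_le t.2.1] at hs
      refine (norm_clippedUnit_sub_le hr _ _).trans ?_
      gcongr
      exact norm_segmentAverage_sub_le hF (hext y) (hext z) hdist ⟨hs.1.le, hs.2.trans t.2.2⟩
    · rw [sub_zero, abs_of_nonneg t.2.1]
      calc 2 / r * (L * dist y z) * (t : ℝ) ≤ 2 / r * (L * dist y z) * τ := by
            gcongr
            exact t.2.2
        _ = τ * (2 / r * L) * dist y z := by ring
  have : Nonempty C(Icc 0 τ, E) := ⟨ContinuousMap.const _ x₀⟩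
  refine ⟨IccExtend hτ (ContractingWith.fixedPoint Φ hΦ : C(Icc 0 τ, E)), hext _, fun t ht => ?_, fun y hy hfix t ht => ?_⟩
  · rw [IccExtend_of_mem hτ _ ht]
    exact (DFunLike.congr_fun hΦ.fixedPoint_isFixedPt.eq ⟨t, ht⟩).symm
  · let y' : C(Icc 0 τ, E) := ⟨(Icc 0 τ).domRestrict y, hy.domRestrict⟩
    have hyy' : EqOn y (IccExtend hτ y') (Icc 0 τ) := fun s hs =>
      (IccExtend_of_mem hτ y' hs).symm
    have hy' : Function.IsFixedPt Φ y' := by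
      ext s
      refine Eq.trans ?_ (hfix s s.2).symm
      refine congrArg (x₀ + ·) (intervalIntegral.integral_congr fun u hu => ?_)
      rw [uIcc_of_le s.2.1] at hu
      simp only [segmentAverage_congr hyy' ⟨hu.1, hu.2.trans s.2.2⟩]
    rw [hyy' ht, hΦ.fixedPoint_unique hy']

lemma norm_segmentAverage_sub_apply_le (hF : LipschitzWith L F) {y : ℝ → E} (hy : Continuous y)
    {x₀ : E} (hyx : ∀ t ∈ Icc 0 τ, ‖y t - x₀‖ ≤ τ) {t : ℝ} (ht : t ∈ Icc 0 τ) :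
    ‖segmentAverage F y t - F x₀‖ ≤ L * τ := by
  rw [← segmentAverage_const F x₀ t]
  exact norm_segmentAverage_sub_le hF hy continuous_const hyx ht

lemma le_norm_segmentAverage (hF : LipschitzWith L F) {y : ℝ → E} (hy : Continuous y)
    {x₀ : E} (hyx : ∀ t ∈ Icc 0 τ, ‖y t - x₀‖ ≤ τ) (hLτ : L * τ ≤ r) (hFx : 2 * r ≤ ‖F x₀‖)
    {t : ℝ} (ht : t ∈ Icc 0 τ) : r ≤ ‖segmentAverage F y t‖ := by
  have h := norm_segmentAverage_sub_apply_le hF hy hyx ht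
  have h' := norm_sub_norm_le (F x₀) (F x₀ - segmentAverage F y t)
  rw [sub_sub_cancel, norm_sub_rev] at h'
  linarith

lemma eq_smul_segmentAverage_of_hasDerivAt (hF : Continuous F) {x ξ : ℝ → E}
    (hx : ContinuousOn x (Icc 0 τ)) (hξ : ContinuousOn ξ (Icc 0 τ)) (hξ0 : ξ 0 = 0)
    (hdξ : ∀ t ∈ Ioo 0 τ, HasDerivAt ξ (F (x t)) t) {t : ℝ} (ht : t ∈ Icc 0 τ) :
    ξ t = t • segmentAverage F x t := by
  have hFx : ContinuousOn (fun s => F (x s)) (uIcc 0 t) := by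
    rw [uIcc_of_le ht.1]
    exact hF.comp_continuousOn (hx.mono (Icc_subset_Icc_right ht.2))
  rw [smul_segmentAverage, intervalIntegral.integral_eq_sub_of_hasDerivAt_of_le ht.1
    (hξ.mono (Icc_subset_Icc_right ht.2))
    (fun s hs => hdξ s ⟨hs.1, hs.2.trans_le ht.2⟩) hFx.intervalIntegrable, hξ0, sub_zero]

/-- A forward trajectory leaving the singular set solves the averaged integral equation. -/
lemma averaged_integral_equation_of_hasDerivAt (hF : LipschitzWith L F)
    (hτ : 0 ≤ τ) {x₀ : E} (hLτ : L * τ ≤ r) (hFx : 2 * r ≤ ‖F x₀‖) {x ξ : ℝ → E}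
    (hx : ContinuousOn x (Icc 0 τ)) (hξ : ContinuousOn ξ (Icc 0 τ)) (hx0 : x 0 = x₀)
    (hξ0 : ξ 0 = 0) (hne : ∀ t ∈ Ioc 0 τ, ξ t ≠ 0)
    (hdx : ∀ t ∈ Ioo 0 τ, HasDerivAt x (‖ξ t‖⁻¹ • ξ t) t)
    (hdξ : ∀ t ∈ Ioo 0 τ, HasDerivAt ξ (F (x t)) t) {t : ℝ} (ht : t ∈ Icc 0 τ) :
    x t = x₀ + ∫ s in (0 : ℝ)..t, clippedUnit r (segmentAverage F x s) := by
  have hxint : ∀ t ∈ Icc 0 τ, x t = x₀ + ∫ s in (0 : ℝ)..t, ‖ξ s‖⁻¹ • ξ s := fun t ht => by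
    have hcont : ContinuousOn (fun s => ‖ξ s‖⁻¹ • ξ s) (Ioc 0 t) := by
      have hξ' := hξ.mono (Ioc_subset_Icc_self.trans (Icc_subset_Icc_right ht.2))
      exact (hξ'.norm.inv₀ fun s hs => norm_ne_zero_iff.2 (hne s ⟨hs.1, hs.2.trans ht.2⟩)).smul hξ'
    have hi : IntervalIntegrable (fun s => ‖ξ s‖⁻¹ • ξ s) MeasureTheory.volume 0 t := by
      rw [intervalIntegrable_iff_integrableOn_Ioc_of_le ht.1]
      refine MeasureTheory.IntegrableOn.of_bound (C := 1) (by simp)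
        (hcont.aestronglyMeasurable measurableSet_Ioc) (.of_forall fun s => ?_)
      rw [norm_smul, norm_inv, norm_norm]
      exact inv_mul_le_one
    rw [intervalIntegral.integral_eq_sub_of_hasDerivAt_of_le ht.1
      (hx.mono (Icc_subset_Icc_right ht.2))
      (fun s hs => hdx s ⟨hs.1, hs.2.trans_le ht.2⟩) hi, hx0]
    abel
  have hbound : ∀ t ∈ Icc 0 τ, ‖x t - x₀‖ ≤ τ := fun t ht => by
    rw [hxint t ht, add_sub_cancel_left]
    refine (intervalIntegral.norm_integral_le_of_norm_le_const (C := 1) fun s _ => ?_).trans ?_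
    · rw [norm_smul, norm_inv, norm_norm]
      exact inv_mul_le_one
    · simpa [abs_of_nonneg ht.1] using ht.2
  let y : ℝ → E := IccExtend hτ ((Icc 0 τ).domRestrict x)
  have hy : Continuous y := hx.domRestrict.Icc_extend'
  have hxy : EqOn x y (Icc 0 τ) := fun s hs =>
    (IccExtend_of_mem hτ ((Icc 0 τ).domRestrict x) hs).symm
  rw [hxint t ht]
  refine congrArg (x₀ + ·) (intervalIntegral.integral_congr_ae (.of_forall fun s hs => ?_))
  rw [uIoc_of_le ht.1] at hs
  have hs' : s ∈ Icc 0 τ := ⟨hs.1.le, hs.2.trans ht.2⟩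
  rw [eq_smul_segmentAverage_of_hasDerivAt hF.continuous hx hξ hξ0 hdξ hs',
    inv_norm_smul_smul hs.1.ne', sign_pos hs.1, SignType.coe_one, one_smul, clippedUnit_of_le]
  rw [segmentAverage_congr hxy hs']
  exact le_norm_segmentAverage hF hy (fun u hu => hxy hu ▸ hbound u hu) hLτ hFx hs'

end SingularFlow

lemma exists_lipschitzWith_gradient {E : Type*} [NormedAddCommGroup E] [InnerProductSpace ℝ E]
    [CompleteSpace E] {V : E → ℝ} (hV : ContDiff ℝ 2 V) {C : ℝ}
    (hC : ∀ y, ‖iteratedFDeriv ℝ 2 V y‖ ≤ C) : ∃ L, LipschitzWith L (gradient V) := by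
  have hdV : Differentiable ℝ (fderiv ℝ V) :=
    (hV.fderiv_right (m := 1) (by norm_num)).differentiable (by norm_num)
  have hfd : LipschitzWith C.toNNReal (fderiv ℝ V) :=
    lipschitzWith_of_nnnorm_fderiv_le hdV fun y => by
      rw [← NNReal.coe_le_coe, coe_nnnorm, ← norm_iteratedFDeriv_one, norm_iteratedFDeriv_fderiv]
      exact (hC y).trans (Real.le_coe_toNNReal C)
  exact ⟨_, (InnerProductSpace.toDual ℝ E).symm.lipschitz.comp hfd⟩

lemma isGenTraj_of_averaged_integral_equation {V : EuclideanSpace ℝ (Fin 2) → ℝ} {L : NNReal}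
    (hF : LipschitzWith L fun y => -gradient V y) {r τ : ℝ} (hr : 0 < r) (hτ : 0 < τ)
    (hLτ : L * τ ≤ r) {x₀ : EuclideanSpace ℝ (Fin 2)} (hFx : 2 * r ≤ ‖-gradient V x₀‖)
    {z : ℝ → EuclideanSpace ℝ (Fin 2)} (hzc : Continuous z)
    (hz : ∀ t ∈ Icc 0 τ, z t = x₀ + ∫ s in (0 : ℝ)..t,
      clippedUnit r (segmentAverage (fun y => -gradient V y) z s)) :
    IsGenTraj V x₀ τ (fun t => z |t|)
      (fun t => t • segmentAverage (fun y => -gradient V y) z |t|) := by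
  set F : EuclideanSpace ℝ (Fin 2) → EuclideanSpace ℝ (Fin 2) := fun y => -gradient V y
    with hFdef
  have hFc := hF.continuous
  have hDc : Continuous (segmentAverage F z) := continuous_segmentAverage hFc hzc
  have hNc : Continuous fun s => clippedUnit r (segmentAverage F z s) :=
    (continuous_clippedUnit hr).comp hDc
  have habs : ∀ {t}, t ∈ Icc (-τ) τ → |t| ∈ Icc 0 τ := fun ht => ⟨abs_nonneg _, abs_le.2 ht⟩
  have hD : ∀ {t}, t ∈ Icc 0 τ → r ≤ ‖segmentAverage F z t‖ :=
    le_norm_segmentAverage hF hzc (fun _ => norm_sub_le_of_averaged_integral_equation hr hz)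
      hLτ hFx
  have hz0 : z 0 = x₀ := by simpa using hz 0 ⟨le_rfl, hτ.le⟩
  have hvel : ∀ t ∈ Icc (-τ) τ, t ≠ 0 →
      ‖t • segmentAverage F z |t|‖⁻¹ • t • segmentAverage F z |t| =
        (SignType.sign t : ℝ) • clippedUnit r (segmentAverage F z |t|) := fun t ht h0 => by
    rw [inv_norm_smul_smul h0, clippedUnit_of_le (hD (habs ht))]
  let Z : ℝ → EuclideanSpace ℝ (Fin 2) := fun t =>
    x₀ + ∫ s in (0 : ℝ)..t, clippedUnit r (segmentAverage F z s)
  have hZ : ∀ t, HasDerivAt Z (clippedUnit r (segmentAverage F z t)) t := fun t =>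
    (intervalIntegral.integral_hasDerivAt_right (hNc.intervalIntegrable _ _)
      (hNc.stronglyMeasurableAtFilter _ _) hNc.continuousAt).const_add x₀
  have hxZ : EqOn (fun t => z |t|) (fun t => Z |t|) (Icc (-τ) τ) := fun t ht => hz _ (habs ht)
  have hx : ∀ t, t ≠ 0 → HasDerivAt (fun t => Z |t|)
      ((SignType.sign t : ℝ) • clippedUnit r (segmentAverage F z |t|)) t := fun t h0 =>
    HasDerivAt.scomp t (hZ |t|) (hasDerivAt_abs h0)
  have hξ : ∀ t, HasDerivAt (fun t => t • segmentAverage F z |t|) (F (z |t|)) t := fun t => by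
    have hc : Continuous fun s => F (z |s|) := by fun_prop
    simp only [← segmentAverage_comp_abs, smul_segmentAverage]
    exact intervalIntegral.integral_hasDerivAt_right (hc.intervalIntegrable _ _)
      (hc.stronglyMeasurableAtFilter _ _) hc.continuousAt
  have hW : Tendsto (fun t => clippedUnit r (segmentAverage F z |t|)) (𝓝 0)
      (𝓝 (-(‖gradient V x₀‖⁻¹ • gradient V x₀))) := by
    have h := (hNc.comp continuous_abs).tendsto 0
    have h0 : clippedUnit r (segmentAverage F z |0|) =
        -(‖gradient V x₀‖⁻¹ • gradient V x₀) := by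
      have hF0 : segmentAverage F z |0| = -gradient V x₀ := by
        simp [segmentAverage, hz0, hFdef]
      rw [hF0, clippedUnit_of_le (by linarith), norm_neg, smul_neg]
    rwa [Function.comp_apply, h0] at h
  refine ⟨?_, by simpa using hz0, by simp, fun t ht h0 => ⟨?_, ?_, ?_⟩, ?_, ?_, ?_⟩
  · have hZL : LipschitzWith 1 Z :=
      lipschitzWith_of_nnnorm_deriv_le (fun t => (hZ t).differentiableAt) fun t => by
        rw [(hZ t).deriv]
        exact norm_clippedUnit_le hr _
    have hxL : LipschitzOnWith 1 (fun t => z |t|) (Icc (-τ) τ) := by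
      refine LipschitzOnWith.of_dist_le_mul fun s hs t ht => ?_
      rw [hz _ (habs hs), hz _ (habs ht)]
      refine (hZL.dist_le_mul _ _).trans ?_
      gcongr
      exact abs_abs_sub_abs_le s t
    obtain ⟨M, hM⟩ := (isCompact_Icc (a := -τ) (b := τ)).exists_bound_of_continuousOn
      (f := fun t => F (z |t|)) (by fun_prop)
    have hξL := (convex_Icc (-τ) τ).lipschitzOnWith_of_nnnorm_hasDerivWithin_le
      (C := M.toNNReal) (fun t _ => (hξ t).hasDerivWithinAt) fun t ht => by
        rw [← NNReal.coe_le_coe, coe_nnnorm]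
        exact (hM t ht).trans (Real.le_coe_toNNReal M)
    exact ⟨_, hxL.prodMk hξL⟩
  · exact smul_ne_zero h0 (norm_pos_iff.1 (hr.trans_le (hD (habs ht))))
  · rw [hvel t ht h0]
    exact (hx t h0).hasDerivWithinAt.congr hxZ (hxZ ht)
  · exact (hξ t).hasDerivWithinAt
  · refine (hW.mono_left nhdsWithin_le_nhds).congr' ?_
    filter_upwards [Ioc_mem_nhdsGT hτ] with t ht
    rw [hvel t ⟨by linarith [ht.1], ht.2⟩ ht.1.ne', sign_pos ht.1, SignType.coe_one, one_smul]
  · have h := (hW.mono_left (nhdsWithin_le_nhds (s := Iio 0))).neg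
    rw [neg_neg] at h
    refine h.congr' ?_
    filter_upwards [Ico_mem_nhdsLT (neg_lt_zero.2 hτ)] with t ht
    rw [hvel t ⟨ht.1, by linarith [ht.2]⟩ ht.2.ne, sign_neg ht.2, SignType.coe_neg_one,
      neg_one_smul]
  · have hc : Continuous fun t => F (z |t|) := by fun_prop
    have h := hc.tendsto 0
    rw [abs_zero, hz0] at h
    exact h.mono_left nhdsWithin_le_nhds

/-- Existence and uniqueness of the generalized trajectory of the plus Hamiltonian flow
through a point of the crossing set `{ξ = 0}` where `∇V(x₀) ≠ 0`. -/
theorem exists_unique_generalized_trajectory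
    (V : EuclideanSpace ℝ (Fin 2) → ℝ)
    (hV : ContDiff ℝ (⊤ : ℕ∞) V)
    (hVbdd : ∀ n : ℕ, ∃ C : ℝ, ∀ y, ‖iteratedFDeriv ℝ n V y‖ ≤ C)
    (x₀ : EuclideanSpace ℝ (Fin 2)) (hx₀ : gradient V x₀ ≠ 0) :
    ∃ τ₀ > (0:ℝ), ∃ x ξ : ℝ → EuclideanSpace ℝ (Fin 2),
      IsGenTraj V x₀ τ₀ x ξ ∧
      ∀ x' ξ' : ℝ → EuclideanSpace ℝ (Fin 2), IsGenTraj V x₀ τ₀ x' ξ' →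
        ∀ t ∈ Set.Icc (-τ₀) τ₀, x' t = x t ∧ ξ' t = ξ t := by
  obtain ⟨C, hC⟩ := hVbdd 2
  obtain ⟨L, hL⟩ := exists_lipschitzWith_gradient (hV.of_le (WithTop.coe_le_coe.2 le_top)) hC
  let F : EuclideanSpace ℝ (Fin 2) → EuclideanSpace ℝ (Fin 2) := fun y => -gradient V y
  have hF : LipschitzWith L F := hL.neg
  set r := ‖F x₀‖ / 2 with hrdef
  have hr : 0 < r := by
    have : 0 < ‖F x₀‖ := norm_pos_iff.2 (neg_ne_zero.2 hx₀)
    positivity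
  have hFx : 2 * r ≤ ‖F x₀‖ := by rw [hrdef]; linarith
  set τ := r / (2 * (L + 1)) with hτdef
  have hτ : 0 < τ := by positivity
  have hLτ' : L * τ < r / 2 := by
    rw [hτdef, ← mul_div_assoc, div_lt_iff₀ (by positivity)]
    linarith
  have hLτ : L * τ ≤ r := by linarith
  have hsmall : τ * (2 / r * L) < 1 := by
    calc τ * (2 / r * L) = L * τ * (2 / r) := by ring
      _ < r / 2 * (2 / r) := by gcongr
      _ = 1 := by field_simp
  obtain ⟨z, hzc, hz, huniq⟩ :=
    exists_unique_averaged_integral_equation hF hr hτ.le hsmall x₀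
  have hforward : ∀ x ξ : ℝ → EuclideanSpace ℝ (Fin 2), ContinuousOn x (Icc 0 τ) →
      ContinuousOn ξ (Icc 0 τ) → x 0 = x₀ → ξ 0 = 0 → (∀ t ∈ Ioc 0 τ, ξ t ≠ 0) →
      (∀ t ∈ Ioo 0 τ, HasDerivAt x (‖ξ t‖⁻¹ • ξ t) t) →
      (∀ t ∈ Ioo 0 τ, HasDerivAt ξ (F (x t)) t) →
      ∀ t ∈ Icc 0 τ, x t = z t ∧ ξ t = t • segmentAverage F z t := by
    intro x ξ hx hξ hx0 hξ0 hne hdx hdξ t ht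
    have hxz : EqOn x z (Icc 0 τ) := huniq x hx fun t ht =>
      averaged_integral_equation_of_hasDerivAt hF hτ.le hLτ hFx hx hξ hx0 hξ0 hne hdx hdξ ht
    refine ⟨hxz ht, ?_⟩
    rw [eq_smul_segmentAverage_of_hasDerivAt hF.continuous hx hξ hξ0 hdξ ht,
      segmentAverage_congr hxz ht]
  refine ⟨τ, hτ, fun t => z |t|, fun t => t • segmentAverage F z |t|,
    isGenTraj_of_averaged_integral_equation hF hr hτ hLτ hFx hzc hz, ?_⟩
  rintro x ξ ⟨⟨K, hK⟩, hx0, hξ0, hode, -⟩ t ht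
  have hx : ContinuousOn x (Icc (-τ) τ) := hK.continuousOn.fst
  have hξ : ContinuousOn ξ (Icc (-τ) τ) := hK.continuousOn.snd
  have hnhds : ∀ t ∈ Ioo (-τ) τ, Icc (-τ) τ ∈ 𝓝 t := fun t ht => Icc_mem_nhds ht.1 ht.2
  rcases le_total 0 t with h | h
  · have hsub : Icc 0 τ ⊆ Icc (-τ) τ := Icc_subset_Icc_left (by linarith)
    simp only [abs_of_nonneg h]
    refine hforward x ξ (hx.mono hsub) (hξ.mono hsub) hx0 hξ0
      (fun s hs => (hode s (hsub ⟨hs.1.le, hs.2⟩) hs.1.ne').1) (fun s hs => ?_) (fun s hs => ?_)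
      t ⟨h, ht.2⟩
    · exact (hode s (hsub ⟨hs.1.le, hs.2.le⟩) hs.1.ne').2.1.hasDerivAt
        (hnhds s ⟨by linarith [hs.1], hs.2⟩)
    · exact (hode s (hsub ⟨hs.1.le, hs.2.le⟩) hs.1.ne').2.2.hasDerivAt
        (hnhds s ⟨by linarith [hs.1], hs.2⟩)
  · have hmaps : MapsTo (fun s : ℝ => -s) (Icc 0 τ) (Icc (-τ) τ) := fun s hs =>
      ⟨neg_le_neg hs.2, by linarith [hs.1]⟩
    have hnegc : ContinuousOn (fun s : ℝ => -s) (Icc 0 τ) := continuousOn_neg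
    -- time reversal `(x (-t), -ξ (-t))` maps trajectories to trajectories
    obtain ⟨h1, h2⟩ := hforward (fun s => x (-s)) (fun s => -ξ (-s)) (hx.comp hnegc hmaps)
      (hξ.comp hnegc hmaps).neg (by simpa using hx0) (by simpa using hξ0)
      (fun s hs => neg_ne_zero.2 (hode (-s) (hmaps ⟨hs.1.le, hs.2⟩) (neg_ne_zero.2 hs.1.ne')).1)
      (fun s hs => by
        have hd := (hode (-s) (hmaps ⟨hs.1.le, hs.2.le⟩) (neg_ne_zero.2 hs.1.ne')).2.1.hasDerivAt
          (hnhds (-s) ⟨neg_lt_neg hs.2, by linarith [hs.1]⟩)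
        rw [norm_neg, smul_neg, ← neg_one_smul ℝ]
        exact hd.scomp s (hasDerivAt_neg s))
      (fun s hs => by
        have hd := (hode (-s) (hmaps ⟨hs.1.le, hs.2.le⟩) (neg_ne_zero.2 hs.1.ne')).2.2.hasDerivAt
          (hnhds (-s) ⟨neg_lt_neg hs.2, by linarith [hs.1]⟩)
        rw [← neg_neg (F (x (-s))), ← neg_one_smul ℝ (F (x (-s)))]
        exact (hd.scomp s (hasDerivAt_neg s)).neg)
      (-t) ⟨neg_nonneg.2 h, by linarith [ht.1]⟩
    rw [neg_neg] at h1 h2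
    rw [neg_smul, neg_inj] at h2
    simp only [abs_of_nonpos h]
    exact ⟨h1, h2⟩

end
end

section
/- Let Z be a topological space, I ⊆ ℝ an open interval, c₀ > 0, and let φ : I × Z → ℝ be continuous such that for every z ∈ Z the map t ↦ φ(t, z) is differentiable on I with ∂ₜφ(t, z) ≥ c₀ for all (t, z) ∈ I × Z. Suppose τ : Z → I satisfies φ(τ(z), z) = 0 for every z ∈ Z. Then τ is continuous, and moreover c₀ |τ(z₀) − τ(z)| ≤ |φ(τ(z₀), z)| for all z, z₀ ∈ Z. -/
open Filter Topology Set

/-- Mean value estimate: if `∂ₜφ ≥ c₀` on an interval `I` and `φ` vanishes at `t₀ ∈ I`, then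
`c₀ |t - t₀| ≤ |φ t|` for all `t ∈ I`. -/
theorem mul_abs_sub_le_abs_of_le_hasDerivAt {I : Set ℝ} (hI : Convex ℝ I) {c₀ : ℝ}
    {f f' : ℝ → ℝ} (hderiv : ∀ t ∈ I, HasDerivAt f (f' t) t) (hlow : ∀ t ∈ I, c₀ ≤ f' t)
    {t₀ t : ℝ} (ht₀ : t₀ ∈ I) (ht : t ∈ I) (hzero : f t₀ = 0) :
    c₀ * |t - t₀| ≤ |f t| := by
  have mvt : ∀ x ∈ I, ∀ y ∈ I, x ≤ y → c₀ * (y - x) ≤ f y - f x :=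
    hI.mul_sub_le_image_sub_of_le_deriv
      (fun s hs => (hderiv s hs).continuousAt.continuousWithinAt)
      (fun s hs => (hderiv s (interior_subset hs)).differentiableAt.differentiableWithinAt)
      (fun s hs => (hderiv s (interior_subset hs)).deriv ▸ hlow s (interior_subset hs))
  rcases le_total t₀ t with h | h
  · rw [abs_of_nonneg (sub_nonneg.2 h)]
    linarith [mvt t₀ ht₀ t ht h, le_abs_self (f t)]
  · rw [abs_of_nonpos (sub_nonpos.2 h)]
    linarith [mvt t ht t₀ ht₀ h, neg_le_abs (f t)]

/-- A function `τ` whose increments are controlled by `|φ (τ z₀) z|`, where each `φ (τ z₀)` is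
continuous at `z₀` and vanishes there, is continuous. -/
theorem continuous_of_mul_abs_sub_le {Z : Type*} [TopologicalSpace Z] {c₀ : ℝ} (hc₀ : 0 < c₀)
    {φ : ℝ → Z → ℝ} {τ : Z → ℝ} (hcont : ∀ z, ContinuousAt (φ (τ z)) z)
    (hτ : ∀ z, φ (τ z) z = 0) (hbound : ∀ z z₀, c₀ * |τ z₀ - τ z| ≤ |φ (τ z₀) z|) :
    Continuous τ := by
  refine continuous_iff_continuousAt.2 fun z₀ => ?_
  have hlim : Tendsto (fun z => |φ (τ z₀) z| / c₀) (𝓝 z₀) (𝓝 0) := by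
    simpa [hτ z₀] using ((hcont z₀).tendsto.abs.div_const c₀)
  refine tendsto_iff_dist_tendsto_zero.2 (squeeze_zero (fun _ => dist_nonneg) (fun z => ?_) hlim)
  rw [dist_comm, Real.dist_eq, le_div_iff₀ hc₀, mul_comm]
  exact hbound z z₀

/-- Continuity of implicitly defined hitting times: if `φ : I × Z → ℝ` is continuous,
differentiable in time with `∂ₜφ ≥ c₀ > 0`, and `τ : Z → I` satisfies `φ(τ(z), z) = 0`,
then `τ` is continuous, with the quantitative estimate
`c₀ |τ(z₀) − τ(z)| ≤ |φ(τ(z₀), z)|`. -/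
theorem continuity_of_hitting_time
    {Z : Type*} [TopologicalSpace Z] (a b : ℝ) (c₀ : ℝ) (hc₀ : 0 < c₀)
    (φ φ' : ℝ → Z → ℝ)
    (hcont : Continuous fun p : ℝ × Z => φ p.1 p.2)
    (hderiv : ∀ z : Z, ∀ t ∈ Set.Ioo a b, HasDerivAt (fun s => φ s z) (φ' t z) t)
    (hlow : ∀ t ∈ Set.Ioo a b, ∀ z : Z, c₀ ≤ φ' t z)
    (τ : Z → ℝ) (hτmem : ∀ z, τ z ∈ Set.Ioo a b) (hτ : ∀ z, φ (τ z) z = 0) :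
    Continuous τ ∧ ∀ z z₀ : Z, c₀ * |τ z₀ - τ z| ≤ |φ (τ z₀) z| := by
  have hbound : ∀ z z₀ : Z, c₀ * |τ z₀ - τ z| ≤ |φ (τ z₀) z| := fun z z₀ =>
    mul_abs_sub_le_abs_of_le_hasDerivAt (convex_Ioo a b) (hderiv z) (fun t ht => hlow t ht z)
      (hτmem z) (hτmem z₀) (hτ z)
  exact ⟨continuous_of_mul_abs_sub_le hc₀
    (fun z => (hcont.comp (Continuous.prodMk_right (τ z))).continuousAt) hτ hbound, hbound⟩
end

section
/- Let V : ℝ² → ℝ be twice continuously differentiable with ‖∇²V(y)‖ ≤ M for all y ∈ ℝ², and let (x, ξ) ∈ ℝ² × ℝ² with ∇V(x) ≠ 0. Define the jump J₊(x, ξ) = (x + 2|ξ| ∇V(x)/|∇V(x)|², ξ) and the energies E±(x, ξ) = ±|ξ| + V(x). Then |E₋(J₊(x, ξ)) − E₊(x, ξ)| ≤ 2M |ξ|² / |∇V(x)|². In particular the jump preserves the classical energy up to an error of order |ξ|². -/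
open scoped RealInnerProductSpace

noncomputable section

/-- The gradient of a `C²` function is differentiable. -/
theorem ContDiff.differentiable_gradient {E : Type*} [NormedAddCommGroup E]
    [InnerProductSpace ℝ E] [CompleteSpace E] {V : E → ℝ} (hV : ContDiff ℝ 2 V) :
    Differentiable ℝ (gradient V) := by
  have hd : Differentiable ℝ (fderiv ℝ V) :=
    (hV.fderiv_right (m := 1) (by norm_num)).differentiable one_ne_zero
  exact (InnerProductSpace.toDual ℝ E).symm.toContinuousLinearEquiv.differentiable.comp hd

/-- First-order Taylor expansion of a `C²` function whose Hessian is bounded by `M`. -/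
theorem abs_sub_sub_inner_gradient_le {E : Type*} [NormedAddCommGroup E]
    [InnerProductSpace ℝ E] [CompleteSpace E] {V : E → ℝ} (hV : ContDiff ℝ 2 V) {M : ℝ}
    (hM : ∀ y, ‖fderiv ℝ (gradient V) y‖ ≤ M) (x v : E) :
    |V (x + v) - V x - ⟪gradient V x, v⟫| ≤ M / 2 * ‖v‖ ^ 2 := by
  have hlip (y : E) : ‖gradient V y - gradient V x‖ ≤ M * ‖y - x‖ :=
    convex_univ.norm_image_sub_le_of_norm_fderiv_le
      (fun z _ ↦ hV.differentiable_gradient z) (fun z _ ↦ hM z) (Set.mem_univ x) (Set.mem_univ y)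
  have hline (t : ℝ) : HasDerivAt (fun t : ℝ ↦ x + t • v) v t := by
    simpa using ((hasDerivAt_id t).smul_const v).const_add x
  have hf (t : ℝ) : HasDerivAt (fun t : ℝ ↦ V (x + t • v) - V x - t * ⟪gradient V x, v⟫)
      ⟪gradient V (x + t • v) - gradient V x, v⟫ t := by
    have hg := ((hV.differentiable two_ne_zero) (x + t • v)).hasGradientAt.hasFDerivAt
    have hc := hg.comp_hasDerivAt t (hline t)
    rw [InnerProductSpace.toDual_apply_apply] at hc
    exact ((hc.sub_const (V x)).sub ((hasDerivAt_id t).mul_const ⟪gradient V x, v⟫)).congr_deriv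
      (by rw [inner_sub_left, one_mul])
  have hB (t : ℝ) : HasDerivAt (fun t : ℝ ↦ M / 2 * ‖v‖ ^ 2 * t ^ 2) (M * ‖v‖ ^ 2 * t) t :=
    ((hasDerivAt_pow 2 t).const_mul (M / 2 * ‖v‖ ^ 2)).congr_deriv (by norm_num; ring)
  have hbound : ∀ t ∈ Set.Ico (0 : ℝ) 1,
      ‖⟪gradient V (x + t • v) - gradient V x, v⟫‖ ≤ M * ‖v‖ ^ 2 * t := by
    intro t ht
    calc ‖⟪gradient V (x + t • v) - gradient V x, v⟫‖
        ≤ ‖gradient V (x + t • v) - gradient V x‖ * ‖v‖ := norm_inner_le_norm _ _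
      _ ≤ M * ‖x + t • v - x‖ * ‖v‖ := by gcongr; exact hlip _
      _ = M * ‖v‖ ^ 2 * t := by
        rw [add_sub_cancel_left, norm_smul, Real.norm_of_nonneg ht.1]
        ring
  simpa using image_norm_le_of_norm_deriv_right_le_deriv_boundary
    (fun t _ ↦ (hf t).continuousAt.continuousWithinAt) (fun t _ ↦ (hf t).hasDerivWithinAt)
    (by simp) hB hbound (Set.right_mem_Icc.2 zero_le_one)

/-- The jump `J₊(x,ξ) = (x + 2|ξ|∇V(x)/|∇V(x)|², ξ)` preserves the classical energy up to
order `|ξ|²`: if the Hessian of `V` is bounded by `M`, then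
`|E₋(J₊(x,ξ)) − E₊(x,ξ)| ≤ 2M|ξ|²/|∇V(x)|²`, where `E±(x,ξ) = ±|ξ| + V(x)`. -/
theorem jump_energy_conservation
    (V : EuclideanSpace ℝ (Fin 2) → ℝ) (hV : ContDiff ℝ 2 V) (M : ℝ)
    (hM : ∀ y, ‖fderiv ℝ (gradient V) y‖ ≤ M)
    (x ξ : EuclideanSpace ℝ (Fin 2)) (h : gradient V x ≠ 0) :
    |(-‖ξ‖ + V (x + (2 * ‖ξ‖ / ‖gradient V x‖^2) • gradient V x)) - (‖ξ‖ + V x)|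
      ≤ 2 * M * ‖ξ‖^2 / ‖gradient V x‖^2 := by
  have hg : ‖gradient V x‖ ≠ 0 := norm_ne_zero_iff.2 h
  have key := abs_sub_sub_inner_gradient_le hV hM x
    ((2 * ‖ξ‖ / ‖gradient V x‖^2) • gradient V x)
  rw [real_inner_smul_right, real_inner_self_eq_norm_sq, norm_smul, mul_pow, Real.norm_eq_abs,
    sq_abs, div_mul_cancel₀ _ (pow_ne_zero 2 hg)] at key
  convert key using 1
  · congr 1
    ring
  · field_simp

end
end

section
/- Let V : ℝ² → ℝ be twice continuously differentiable, let x ∈ ℝ² with ∇V(x) ≠ 0, let ξ ∈ ℝ² with ξ ≠ 0, and set M = ‖∇²V(x)‖. Define Λ±(x, ξ) = (−|∇V(x)|² ± ⟨∇²V(x)ξ, ξ⟩/|ξ|) / √(|∇V(x)|² + |∇²V(x)ξ|²). Then | Λ±(x, ξ) + |∇V(x)| | ≤ (M|ξ| + M²|ξ|²/2) / |∇V(x)|. In particular Λ±(x, ξ) = −|∇V(x)| + O(|ξ|) as ξ → 0. -/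
open scoped RealInnerProductSpace

noncomputable section

/-- A perturbation bound for `-a` when both the numerator `-a ^ 2` and the denominator `a` of
`-a ^ 2 / a` are perturbed by terms controlled by `s`. -/
theorem abs_neg_sq_add_div_sqrt_add_le {a s m q : ℝ} (ha : 0 < a) (hq : |q| ≤ s) (hsm : s ≤ m) :
    |(-a ^ 2 + q) / Real.sqrt (a ^ 2 + s ^ 2) + a| ≤ (m + m ^ 2 / 2) / a := by
  have hs : 0 ≤ s := (abs_nonneg q).trans hq
  set r := Real.sqrt (a ^ 2 + s ^ 2)
  have hr2 : r ^ 2 = a ^ 2 + s ^ 2 := Real.sq_sqrt (by positivity)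
  have har : a ≤ r := Real.le_sqrt_of_sq_le (by nlinarith)
  have hr : 0 < r := ha.trans_le har
  have hgap : a * (r - a) ≤ s ^ 2 / 2 := by nlinarith [sq_nonneg (r - a)]
  have hgap0 : 0 ≤ a * (r - a) := mul_nonneg ha.le (sub_nonneg.2 har)
  have hsq : s ^ 2 ≤ m ^ 2 := by gcongr
  have heq : (-a ^ 2 + q) / r + a = (q + a * (r - a)) / r := by
    field_simp
    ring
  rw [heq, abs_div, abs_of_pos hr]
  have hnum : |q + a * (r - a)| ≤ m + m ^ 2 / 2 :=
    calc |q + a * (r - a)| ≤ |q| + |a * (r - a)| := abs_add_le _ _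
      _ ≤ m + m ^ 2 / 2 := by rw [abs_of_nonneg hgap0]; linarith
  gcongr
  exact (abs_nonneg _).trans hnum

/-- The Jacobian factors
`Λ±(x,ξ) = (−|∇V(x)|² ± ⟨∇²V(x)ξ,ξ⟩/|ξ|)/√(|∇V(x)|² + |∇²V(x)ξ|²)` of the collision
kernels satisfy `|Λ±(x,ξ) + |∇V(x)|| ≤ (M|ξ| + M²|ξ|²/2)/|∇V(x)|`, where
`M = ‖∇²V(x)‖`; in particular `Λ± = −|∇V(x)| + O(|ξ|)` as `ξ → 0`. -/
theorem jacobian_factor_asymptotics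
    (V : EuclideanSpace ℝ (Fin 2) → ℝ) (hV : ContDiff ℝ 2 V)
    (x ξ : EuclideanSpace ℝ (Fin 2)) (hx : gradient V x ≠ 0) (hξ : ξ ≠ 0) :
    |(-‖gradient V x‖^2 + ⟪fderiv ℝ (gradient V) x ξ, ξ⟫ / ‖ξ‖) /
        Real.sqrt (‖gradient V x‖^2 + ‖fderiv ℝ (gradient V) x ξ‖^2)
      + ‖gradient V x‖|
      ≤ (‖fderiv ℝ (gradient V) x‖ * ‖ξ‖
          + ‖fderiv ℝ (gradient V) x‖^2 * ‖ξ‖^2 / 2) / ‖gradient V x‖ ∧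
    |(-‖gradient V x‖^2 - ⟪fderiv ℝ (gradient V) x ξ, ξ⟫ / ‖ξ‖) /
        Real.sqrt (‖gradient V x‖^2 + ‖fderiv ℝ (gradient V) x ξ‖^2)
      + ‖gradient V x‖|
      ≤ (‖fderiv ℝ (gradient V) x‖ * ‖ξ‖
          + ‖fderiv ℝ (gradient V) x‖^2 * ‖ξ‖^2 / 2) / ‖gradient V x‖ := by
  have ha : 0 < ‖gradient V x‖ := norm_pos_iff.2 hx
  have hq : |⟪fderiv ℝ (gradient V) x ξ, ξ⟫ / ‖ξ‖| ≤ ‖fderiv ℝ (gradient V) x ξ‖ := by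
    rw [abs_div, abs_norm, div_le_iff₀ (norm_pos_iff.2 hξ)]
    exact abs_real_inner_le_norm _ _
  have hm := (fderiv ℝ (gradient V) x).le_opNorm ξ
  rw [← mul_pow, sub_eq_add_neg (-‖gradient V x‖ ^ 2)]
  exact ⟨abs_neg_sq_add_div_sqrt_add_le ha hq hm,
    abs_neg_sq_add_div_sqrt_add_le ha ((abs_neg _).trans_le hq) hm⟩

end
end

section
/- For λ ∈ ℝ, λ ≠ 0, define a(μ) = e^{−πμ/2} for μ ∈ ℝ and b(μ) = (2i e^{iπ/4}/(μ√π)) 2^{−iμ/2} e^{−πμ/4} Γ(1 + iμ/2) sinh(πμ/2) for μ > 0, and let S(λ) be the 2×2 complex matrix with rows (a(λ²), −λ·conj(b(λ²))) and (λ·b(λ²), a(λ²)). Then S(λ) is unitary: S(λ)* S(λ) = I₂. -/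
noncomputable section

/-- The Landau–Zener transition coefficient `a(μ) = e^{−πμ/2}`. -/
def LZa (μ : ℝ) : ℂ := (Real.exp (-(Real.pi * μ) / 2) : ℝ)

/-- The Landau–Zener off-diagonal coefficient
`b(μ) = (2i e^{iπ/4}/(μ√π)) 2^{−iμ/2} e^{−πμ/4} Γ(1 + iμ/2) sinh(πμ/2)`. -/
def LZb (μ : ℝ) : ℂ :=
  (2 * Complex.I * Complex.exp (Complex.I * (Real.pi : ℂ) / 4) /
      ((μ : ℂ) * (Real.sqrt Real.pi : ℂ))) *
    (2 : ℂ) ^ (-(Complex.I * (μ : ℂ)) / 2) *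
    Complex.exp (-((Real.pi : ℂ) * (μ : ℂ)) / 4) *
    Complex.Gamma (1 + Complex.I * (μ : ℂ) / 2) *
    Complex.sinh ((Real.pi : ℂ) * (μ : ℂ) / 2)

open ComplexConjugate in
theorem norm_Gamma_one_add_I_mul_sq {y : ℝ} (hy : y ≠ 0) :
    ‖Complex.Gamma (1 + Complex.I * y)‖ ^ 2 = Real.pi * y / Real.sinh (Real.pi * y) := by
  have hz : Complex.I * (y : ℂ) ≠ 0 := by simp [hy]
  have hconj : conj (1 + Complex.I * (y : ℂ)) = 1 - Complex.I * y := by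
    simp [sub_eq_add_neg]
  have hsin : Complex.sin (Real.pi * (Complex.I * y)) =
      Complex.sinh (Real.pi * y) * Complex.I := by
    rw [← Complex.sin_mul_I]
    ring_nf
  have hmul : ((‖Complex.Gamma (1 + Complex.I * y)‖ ^ 2 : ℝ) : ℂ) =
      ((Real.pi * y / Real.sinh (Real.pi * y) : ℝ) : ℂ) := by
    push_cast
    rw [← Complex.mul_conj', ← Complex.Gamma_conj, hconj, add_comm 1,
      Complex.Gamma_add_one _ hz, mul_assoc, Complex.Gamma_mul_Gamma_one_sub, hsin]
    have hs : Complex.sinh (Real.pi * y) ≠ 0 := by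
      rw [← Complex.ofReal_mul, ← Complex.ofReal_sinh, Complex.ofReal_ne_zero,
        Real.sinh_ne_zero]
      exact mul_ne_zero Real.pi_ne_zero hy
    field_simp
  exact_mod_cast hmul

theorem norm_LZb {μ : ℝ} (hμ : 0 < μ) :
    ‖LZb μ‖ = 2 / (μ * Real.sqrt Real.pi) * Real.exp (-(Real.pi * μ) / 4) *
      ‖Complex.Gamma (1 + Complex.I * (μ / 2 : ℝ))‖ * Real.sinh (Real.pi * μ / 2) := by
  have hphase : ‖Complex.exp (Complex.I * (Real.pi : ℂ) / 4)‖ = 1 := by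
    simp [Complex.norm_exp]
  have hpow : ‖(2 : ℂ) ^ (-(Complex.I * (μ : ℂ)) / 2)‖ = 1 := by
    have h := Complex.norm_cpow_eq_rpow_re_of_pos (x := 2) two_pos
      (-(Complex.I * (μ : ℂ)) / 2)
    simpa using h
  have hexp : ‖Complex.exp (-((Real.pi : ℂ) * (μ : ℂ)) / 4)‖ =
      Real.exp (-(Real.pi * μ) / 4) := by
    simp [Complex.norm_exp]
  have hsinh : ‖Complex.sinh ((Real.pi : ℂ) * (μ : ℂ) / 2)‖ =
      Real.sinh (Real.pi * μ / 2) := by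
    have h : (0 : ℝ) ≤ Real.sinh (Real.pi * μ / 2) :=
      Real.sinh_nonneg_iff.2 (by positivity)
    rw [← Real.norm_of_nonneg h, ← Complex.norm_real]
    push_cast
    rfl
  have harg : Complex.I * ((μ / 2 : ℝ) : ℂ) = Complex.I * μ / 2 := by
    push_cast
    ring
  rw [LZb, norm_mul, norm_mul, norm_mul, norm_mul, hpow, hexp, hsinh, norm_div, norm_mul,
    norm_mul, norm_mul, hphase, harg, Complex.norm_real, Complex.norm_real,
    Real.norm_of_nonneg hμ.le, Real.norm_of_nonneg (Real.sqrt_nonneg _)]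
  simp

theorem mul_norm_LZb_sq {μ : ℝ} (hμ : 0 < μ) :
    μ * ‖LZb μ‖ ^ 2 = 1 - Real.exp (-(Real.pi * μ)) := by
  have hs : Real.sinh (Real.pi * μ / 2) ≠ 0 :=
    (Real.sinh_pos_iff.2 (by positivity)).ne'
  have hexp : Real.exp (-(Real.pi * μ) / 4) ^ 2 = Real.exp (-(Real.pi * μ / 2)) := by
    rw [← Real.exp_nat_mul]
    congr 1
    push_cast
    ring
  have hfactor : 2 * Real.exp (-(Real.pi * μ / 2)) * Real.sinh (Real.pi * μ / 2) =
      1 - Real.exp (-(Real.pi * μ)) := by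
    have h1 : Real.exp (-(Real.pi * μ / 2)) * Real.exp (Real.pi * μ / 2) = 1 := by
      rw [← Real.exp_add, neg_add_cancel, Real.exp_zero]
    have h2 : Real.exp (-(Real.pi * μ / 2)) * Real.exp (-(Real.pi * μ / 2)) =
        Real.exp (-(Real.pi * μ)) := by
      rw [← Real.exp_add]
      ring_nf
    rw [Real.sinh_eq]
    linear_combination h1 - h2
  rw [norm_LZb hμ, mul_pow, mul_pow, mul_pow, div_pow, mul_pow, Real.sq_sqrt Real.pi_pos.le,
    hexp, norm_Gamma_one_add_I_mul_sq (half_pos hμ).ne', ← mul_div_assoc Real.pi, ← hfactor]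
  have hpi := Real.pi_ne_zero
  field_simp

/-- The Landau–Zener scattering matrix
`S(λ) = [[a(λ²), −λ·conj(b(λ²))], [λ·b(λ²), a(λ²)]]` is unitary: `S(λ)* S(λ) = I`. -/
theorem landau_zener_scattering_matrix_unitary (lam : ℝ) (hlam : lam ≠ 0) :
    let S : Matrix (Fin 2) (Fin 2) ℂ :=
      !![LZa (lam ^ 2), -(lam : ℂ) * (starRingEnd ℂ) (LZb (lam ^ 2));
         (lam : ℂ) * LZb (lam ^ 2), LZa (lam ^ 2)]
    S.conjTranspose * S = 1 := by
  intro S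
  have hμ : 0 < lam ^ 2 := by positivity
  have hconj : (starRingEnd ℂ) (LZa (lam ^ 2)) = LZa (lam ^ 2) := Complex.conj_ofReal _
  have ha : LZa (lam ^ 2) * LZa (lam ^ 2) = (Real.exp (-(Real.pi * lam ^ 2)) : ℝ) := by
    rw [LZa, ← Complex.ofReal_mul, ← Real.exp_add]
    ring_nf
  have hb : (lam : ℂ) ^ 2 * (LZb (lam ^ 2) * (starRingEnd ℂ) (LZb (lam ^ 2))) =
      1 - (Real.exp (-(Real.pi * lam ^ 2)) : ℝ) := by
    rw [Complex.mul_conj']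
    exact_mod_cast mul_norm_LZb_sq hμ
  ext i j
  fin_cases i <;> fin_cases j <;>
    simp [S, Matrix.mul_apply, Fin.sum_univ_two, hconj, -Complex.ofReal_exp]
  · linear_combination ha + hb
  · ring
  · ring
  · linear_combination ha + hb

end
end

section
/- Let d ≥ 1. There exists a constant C > 0 depending only on d such that for every ε > 0, every a ∈ C_c^∞(ℝ^d × ℝ^d, ℂ), and every Schwartz function f on ℝ^d, the semiclassical Weyl quantization op_ε(a)f(x) := (2π)^{−d} ∫∫ e^{iξ·(x−y)} a((x+y)/2, εξ) f(y) dy dξ satisfies ‖op_ε(a)f‖_{L²(ℝ^d)} ≤ C · ( sup_{|β| ≤ d+1} sup_{ξ ∈ ℝ^d} ∫_{ℝ^d} |∂ₓ^β a(x, ξ)| dx ) · ‖f‖_{L²(ℝ^d)}. In particular op_ε(a) extends to a bounded operator on L²(ℝ^d) whose norm is bounded uniformly in ε by a constant times sup_{|β|≤d+1} sup_ξ ∫ |∂ₓ^β a(x,ξ)| dx. -/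
open MeasureTheory
open scoped RealInnerProductSpace

noncomputable section

open scoped FourierTransform ENNReal SchwartzMap

section Plancherel

variable {V : Type*} [NormedAddCommGroup V] [InnerProductSpace ℝ V] [FiniteDimensional ℝ V]
  [MeasurableSpace V] [BorelSpace V]

theorem Real.continuous_fourier_of_integrable {u : V → ℂ} (hu : Integrable u) :
    Continuous (𝓕 u) :=
  VectorFourier.fourierIntegral_continuous Real.continuous_fourierChar
    (by simpa using (continuous_inner (𝕜 := ℝ) (E := V))) hu

/-- Plancherel's theorem for the Fourier integral of a function in `L¹ ∩ L²`. -/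
theorem Real.eLpNorm_fourier_eq {u : V → ℂ} (hu : Integrable u) (hu2 : MemLp u 2) :
    eLpNorm (𝓕 u) 2 = eLpNorm u 2 := by
  have key : ∀ᵐ x, (𝓕 (hu2.toLp u) : Lp ℂ 2 (volume : Measure V)) x = 𝓕 u x := by
    refine ae_eq_of_integral_contDiff_smul_eq ?_ ?_ fun g hg hgs => ?_
    · exact (Lp.memLp _).locallyIntegrable (by norm_num)
    · exact (Real.continuous_fourier_of_integrable hu).locallyIntegrable
    · have hg' : ContDiff ℝ (⊤ : ℕ∞) (fun x => (g x : ℂ)) := Complex.ofRealCLM.contDiff.comp hg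
      have hgs' : HasCompactSupport (fun x => (g x : ℂ)) :=
        hgs.comp_left (g := fun r : ℝ => (r : ℂ)) Complex.ofReal_zero
      let φ : 𝓢(V, ℂ) := hgs'.toSchwartzMap hg'
      have h1 := congrArg (fun T : 𝓢'(V, ℂ) => T φ)
        (Lp.fourier_toTemperedDistribution_eq (hu2.toLp u))
      simp only [TemperedDistribution.fourier_apply, Lp.toTemperedDistribution_apply] at h1
      have h2 : ∀ x, g x • (𝓕 u) x = φ x • (𝓕 u) x := fun x => by
        simp [φ, Complex.real_smul]
      have h3 : ∀ x, g x • (𝓕 (hu2.toLp u) : Lp ℂ 2 (volume : Measure V)) x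
          = φ x • (𝓕 (hu2.toLp u) : Lp ℂ 2 (volume : Measure V)) x := fun x => by
        simp [φ, Complex.real_smul]
      simp_rw [h2, h3]
      rw [← h1]
      have h4 := VectorFourier.integral_fourierIntegral_smul_eq_flip (μ := (volume : Measure V))
        (ν := (volume : Measure V)) (L := innerₗ V) (f := φ) (g := u) Real.continuous_fourierChar
        (by simpa using (continuous_inner (𝕜 := ℝ) (E := V))) φ.integrable hu
      rw [flip_innerₗ] at h4
      refine Eq.trans ?_ h4
      refine integral_congr_ae ?_
      filter_upwards [hu2.coeFn_toLp] with x hx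
      rw [hx, SchwartzMap.fourier_coe]
      rfl
  rw [← eLpNorm_congr_ae key, ← eLpNorm_congr_ae hu2.coeFn_toLp]
  have := Lp.norm_fourier_eq (hu2.toLp u)
  rw [Lp.norm_def, Lp.norm_def] at this
  exact (ENNReal.toReal_eq_toReal_iff' (Lp.eLpNorm_ne_top _) (Lp.eLpNorm_ne_top _)).1 this

theorem Real.eLpNorm_fourierInv_eq {u : V → ℂ} (hu : Integrable u) (hu2 : MemLp u 2) :
    eLpNorm (𝓕⁻ u) 2 = eLpNorm u 2 := by
  rw [← Real.eLpNorm_fourier_eq hu hu2]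
  have h : 𝓕⁻ u = 𝓕 u ∘ Neg.neg := by
    ext x
    exact Real.fourierInv_eq_fourier_neg u x
  rw [h]
  exact eLpNorm_comp_measurePreserving
    (Real.continuous_fourier_of_integrable hu).aestronglyMeasurable
    (Measure.measurePreserving_neg volume)

/-- The Fourier transform of a smooth function decays as fast as its derivatives are integrable. -/
theorem Real.one_add_norm_pow_mul_norm_fourier_le {g : V → ℂ} (hg : ContDiff ℝ (⊤ : ℕ∞) g)
    (hgs : HasCompactSupport g) {N : ℕ} {S : ℝ}
    (hS : ∀ n ≤ N, ∫ x, ‖iteratedFDeriv ℝ n g x‖ ≤ S) (w : V) :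
    (1 + ‖w‖) ^ N * ‖𝓕 g w‖ ≤ 2 ^ N * (1 + 2 ^ N * (N + 1)) * S := by
  have hint : ∀ (k n : ℕ), (k : ℕ∞) ≤ (⊤ : ℕ∞) → (n : ℕ∞) ≤ (⊤ : ℕ∞) →
      Integrable (fun v ↦ ‖v‖ ^ k * ‖iteratedFDeriv ℝ n g v‖) := fun k n _ _ =>
    (Continuous.mul (by fun_prop) (hg.continuous_iteratedFDeriv
        (by exact_mod_cast le_top)).norm).integrable_of_hasCompactSupport
      ((hgs.iteratedFDeriv n).norm.mul_left)
  have hn : ∀ n ≤ N, ‖w‖ ^ n * ‖𝓕 g w‖ ≤ 2 ^ n * ((n + 1) * S) := by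
    intro n hn
    have h := Real.pow_mul_norm_iteratedFDeriv_fourier_le hg hint (k := 0) (n := n) le_top le_top w
    simp only [norm_iteratedFDeriv_zero] at h
    refine h.trans ?_
    simp only [CharP.cast_eq_zero, mul_zero, zero_add, pow_zero, one_mul, Finset.range_one]
    gcongr
    rw [Finset.sum_product]
    simp only [Finset.sum_singleton, pow_zero, one_mul]
    refine (Finset.sum_le_card_nsmul _ _ S fun i hi => hS i ?_).trans_eq ?_
    · rw [Finset.mem_range] at hi; omega
    · simp
  have h0 := hn 0 (Nat.zero_le _)
  have h1 := hn N le_rfl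
  have h2 : (1 + ‖w‖) ^ N ≤ 2 ^ N * (1 + ‖w‖ ^ N) := by
    have h3 := add_pow_le zero_le_one (norm_nonneg w) N
    refine h3.trans ?_
    rw [one_pow]
    gcongr
    · norm_num
    · omega
  simp only [pow_zero, one_mul, CharP.cast_eq_zero, zero_add] at h0
  calc (1 + ‖w‖) ^ N * ‖𝓕 g w‖ ≤ 2 ^ N * (1 + ‖w‖ ^ N) * ‖𝓕 g w‖ := by gcongr
    _ = 2 ^ N * (‖𝓕 g w‖ + ‖w‖ ^ N * ‖𝓕 g w‖) := by ring
    _ ≤ 2 ^ N * (S + 2 ^ N * ((N + 1) * S)) := by gcongr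
    _ = _ := by ring

end Plancherel

/-- A weighted form of Minkowski's integral inequality in `L²`. -/
theorem eLpNorm_integral_le_lintegral_mul {P X : Type*} [MeasurableSpace P] [MeasurableSpace X]
    {μ : Measure P} {ν : Measure X} [SFinite μ] [SFinite ν] {G : P → X → ℂ}
    (hG : StronglyMeasurable (Function.uncurry G)) {W : P → ℝ≥0∞} (hW : Measurable W)
    (hW0 : ∀ p, W p ≠ 0) (hWt : ∀ p, W p ≠ ⊤) {K : ℝ≥0∞}
    (hK : ∀ p, eLpNorm (G p) 2 ν ≤ W p * K) :
    eLpNorm (fun x => ∫ p, G p x ∂μ) 2 ν ≤ (∫⁻ p, W p ∂μ) * K := by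
  have sq (g : X → ℂ) : eLpNorm g 2 ν ^ 2 = ∫⁻ x, ‖g x‖ₑ ^ 2 ∂ν := by
    have := eLpNorm_nnreal_pow_eq_lintegral (f := g) (μ := ν) (p := 2) (by norm_num)
    simpa using this
  have hGm : Measurable fun z : P × X => ‖G z.1 z.2‖ₑ := hG.enorm
  have cs (x : X) : (∫⁻ p, ‖G p x‖ₑ ∂μ) ^ 2 ≤
      (∫⁻ p, W p ∂μ) * ∫⁻ p, (W p)⁻¹ * ‖G p x‖ₑ ^ 2 ∂μ := by
    have h := ENNReal.lintegral_mul_le_Lp_mul_Lq μ Real.HolderConjugate.two_two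
      (f := fun p => W p ^ (1 / 2 : ℝ)) (g := fun p => ((W p)⁻¹) ^ (1 / 2 : ℝ) * ‖G p x‖ₑ)
      (hW.pow_const _).aemeasurable
      ((hW.inv.pow_const _).mul (hGm.comp measurable_prodMk_right)).aemeasurable
    have e1 : ∀ p, W p ^ (1 / 2 : ℝ) * ((W p)⁻¹ ^ (1 / 2 : ℝ) * ‖G p x‖ₑ) = ‖G p x‖ₑ := by
      intro p
      rw [← mul_assoc, ← ENNReal.mul_rpow_of_nonneg _ _ (by norm_num),
        ENNReal.mul_inv_cancel (hW0 p) (hWt p), ENNReal.one_rpow, one_mul]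
    have e2 : ∀ c : ℝ≥0∞, (c ^ (1 / 2 : ℝ)) ^ (2 : ℝ) = c := by
      intro c
      rw [← ENNReal.rpow_mul]; norm_num
    simp only [Pi.mul_apply, e1, e2] at h
    calc (∫⁻ p, ‖G p x‖ₑ ∂μ) ^ 2 ≤ _ := pow_le_pow_left' h 2
      _ = _ := by
        rw [← ENNReal.rpow_ofNat, ENNReal.mul_rpow_of_nonneg _ _ (by norm_num)]
        simp only [e2, ENNReal.mul_rpow_of_nonneg _ _ (zero_le_two (α := ℝ))]
        simp
  refine (ENNReal.pow_le_pow_left_iff two_ne_zero).1 ?_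
  rw [sq, mul_pow, pow_two (∫⁻ p, W p ∂μ)]
  calc ∫⁻ x, ‖∫ p, G p x ∂μ‖ₑ ^ 2 ∂ν
      ≤ ∫⁻ x, (∫⁻ p, W p ∂μ) * ∫⁻ p, (W p)⁻¹ * ‖G p x‖ₑ ^ 2 ∂μ ∂ν :=
        lintegral_mono fun x =>
          (pow_le_pow_left' (enorm_integral_le_lintegral_enorm _) 2).trans (cs x)
    _ = (∫⁻ p, W p ∂μ) * ∫⁻ x, ∫⁻ p, (W p)⁻¹ * ‖G p x‖ₑ ^ 2 ∂μ ∂ν :=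
        lintegral_const_mul _ (Measurable.lintegral_prod_left
          ((hW.inv.comp measurable_fst).mul (hGm.pow_const 2)))
    _ = (∫⁻ p, W p ∂μ) * ∫⁻ p, (W p)⁻¹ * eLpNorm (G p) 2 ν ^ 2 ∂μ := by
        rw [lintegral_lintegral_swap]
        · congr 1
          refine lintegral_congr fun p => ?_
          rw [sq, lintegral_const_mul]
          exact (hGm.comp measurable_prodMk_left).pow_const 2
        · exact (((hW.inv.comp measurable_fst).mul (hGm.pow_const 2)).comp
            measurable_swap).aemeasurable
    _ ≤ (∫⁻ p, W p ∂μ) * ∫⁻ p, W p * K ^ 2 ∂μ := by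
        refine mul_le_mul' le_rfl (lintegral_mono fun p => ?_)
        calc (W p)⁻¹ * eLpNorm (G p) 2 ν ^ 2 ≤ (W p)⁻¹ * (W p * K) ^ 2 := by
              gcongr; exact hK p
          _ = ((W p)⁻¹ * W p) * (W p * K ^ 2) := by ring
          _ = _ := by rw [ENNReal.inv_mul_cancel (hW0 p) (hWt p), one_mul]
    _ = _ := by rw [lintegral_mul_const _ hW, mul_assoc]

section Weyl

variable {V : Type*} [NormedAddCommGroup V] [InnerProductSpace ℝ V] [FiniteDimensional ℝ V]
  [MeasurableSpace V] [BorelSpace V]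

theorem HasCompactSupport.comp_prodMk_left {X Y : Type*} [TopologicalSpace X] [TopologicalSpace Y]
    [T2Space X] {b : X × Y → ℂ} (hb : HasCompactSupport b) (y : Y) :
    HasCompactSupport fun x => b (x, y) :=
  HasCompactSupport.intro (hb.isCompact.image continuous_fst) fun x hx => by
    by_contra h
    exact hx ⟨(x, y), subset_tsupport b h, rfl⟩

/-- The partial Fourier transform of a compactly supported symbol is jointly continuous. -/
theorem continuous_partial_fourier {b : V × V → ℂ} (hb : Continuous b)
    (hbs : HasCompactSupport b) :
    Continuous fun z : V × V => 𝓕 (fun x => b (x, z.2)) z.1 := by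
  let K : Set V := Prod.fst '' tsupport b
  have hK : IsCompact K := hbs.isCompact.image continuous_fst
  have h := continuous_parametric_integral_of_continuous (μ := (volume : Measure V))
    (f := fun (z : V × V) (x : V) =>
      Complex.exp (↑(-2 * Real.pi * ⟪x, z.1⟫) * Complex.I) • b (x, z.2))
    (by unfold Function.uncurry; fun_prop) hK
  convert h using 2 with z
  rw [Real.fourier_eq', setIntegral_eq_integral_of_forall_compl_eq_zero]
  intro x hx
  have : b (x, z.2) = 0 := by
    by_contra h
    exact hx ⟨(x, z.2), subset_tsupport b h, rfl⟩
  rw [this, smul_zero]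

theorem integrable_partial_fourier {b : V × V → ℂ} (hb : Continuous b)
    (hbs : HasCompactSupport b) {w : V → ℝ} (hw : Integrable w)
    (hB : ∀ p η, ‖𝓕 (fun x => b (x, η)) p‖ ≤ w p) (η : V) :
    Integrable (𝓕 fun x => b (x, η)) :=
  hw.mono' ((continuous_partial_fourier hb hbs).comp
    (Continuous.prodMk_left η)).aestronglyMeasurable (.of_forall fun p => hB p η)

/-- Superposition formula for one frequency of the Weyl kernel. -/
theorem integral_weyl_kernel {b : V × V → ℂ} (hb : Continuous b)
    (hbs : HasCompactSupport b) {w : V → ℝ} (hw : Integrable w)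
    (hB : ∀ p η, ‖𝓕 (fun x => b (x, η)) p‖ ≤ w p) {f : V → ℂ} (hf : Integrable f)
    (hfc : Continuous f) (x η : V) :
    ∫ y, Complex.exp (Complex.I * (2 * Real.pi * ⟪η, x - y⟫ : ℝ)) *
        b ((2 : ℝ)⁻¹ • (x + y), η) * f y =
      ∫ p, Complex.exp (↑(2 * Real.pi * ⟪η, x⟫) * Complex.I) *
        (Complex.exp (↑(Real.pi * ⟪p, x⟫) * Complex.I) *
        (𝓕 (fun x => b (x, η)) p * 𝓕 f (η - (2 : ℝ)⁻¹ • p))) := by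
  have hBi := integrable_partial_fourier hb hbs hw hB η
  have hBc : Continuous (𝓕 fun x => b (x, η)) :=
    (continuous_partial_fourier hb hbs).comp (Continuous.prodMk_left η)
  have hslice : Continuous fun x => b (x, η) := hb.comp (Continuous.prodMk_left η)
  have hinv (z : V) : b (z, η) =
      ∫ p, Complex.exp (↑(2 * Real.pi * ⟪p, z⟫) * Complex.I) * 𝓕 (fun x => b (x, η)) p := by
    have h := congrFun (hslice.fourierInv_fourier_eq (hslice.integrable_of_hasCompactSupport
      (hbs.comp_prodMk_left η)) hBi) z
    rw [Real.fourierInv_eq'] at h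
    simpa only [smul_eq_mul] using h.symm
  let H : V → V → ℂ := fun y p => Complex.exp (Complex.I * (2 * Real.pi * ⟪η, x - y⟫ : ℝ)) *
    (Complex.exp (↑(2 * Real.pi * ⟪p, (2 : ℝ)⁻¹ • (x + y)⟫) * Complex.I) *
      𝓕 (fun x => b (x, η)) p) * f y
  have hH : Integrable (Function.uncurry H) (volume.prod volume) := by
    refine (hf.mul_prod hBi).mono (Continuous.aestronglyMeasurable ?_) (.of_forall fun z => ?_)
    · unfold H Function.uncurry
      fun_prop
    · simp only [H, Function.uncurry, norm_mul, Complex.norm_exp_ofReal_mul_I,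
        mul_comm Complex.I, one_mul]
      rw [mul_comm]
  calc _ = ∫ y, ∫ p, H y p := by
        refine integral_congr_ae (.of_forall fun y => ?_)
        simp only [H]
        rw [integral_mul_const, integral_const_mul, ← hinv]
    _ = ∫ p, ∫ y, H y p := integral_integral_swap hH
    _ = _ := by
        refine integral_congr_ae (.of_forall fun p => ?_)
        simp only [H]
        rw [Real.fourier_eq' f, ← integral_const_mul, ← integral_const_mul, ← integral_const_mul]
        refine integral_congr_ae (.of_forall fun y => ?_)
        have : Complex.exp (Complex.I * (2 * Real.pi * ⟪η, x - y⟫ : ℝ)) *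
            Complex.exp (↑(2 * Real.pi * ⟪p, (2 : ℝ)⁻¹ • (x + y)⟫) * Complex.I) =
            Complex.exp (↑(2 * Real.pi * ⟪η, x⟫) * Complex.I) *
            Complex.exp (↑(Real.pi * ⟪p, x⟫) * Complex.I) *
            Complex.exp (↑(-2 * Real.pi * ⟪y, η - (2 : ℝ)⁻¹ • p⟫) * Complex.I) := by
          simp only [← Complex.exp_add]
          congr 1
          simp only [inner_sub_right, inner_smul_right, inner_add_right, real_inner_comm y]
          push_cast
          ring
        simp only [smul_eq_mul]
        linear_combination (𝓕 (fun x => b (x, η)) p * f y) * this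

/-- The component of the Weyl quantization of `b` at the frequency `p` in the position variable:
a Fourier multiplier sandwiched between two modulations. -/
def weylComponent (b : V × V → ℂ) (f : V → ℂ) (p x : V) : ℂ :=
  Complex.exp (↑(Real.pi * ⟪p, x⟫) * Complex.I) *
    𝓕⁻ (fun η => 𝓕 (fun x => b (x, η)) p * 𝓕 f (η - (2 : ℝ)⁻¹ • p)) x

theorem partial_fourier_eq_zero {b : V × V → ℂ} {η : V} (hη : η ∉ Prod.snd '' tsupport b)
    (p : V) : 𝓕 (fun x => b (x, η)) p = 0 := by
  have : (fun x => b (x, η)) = 0 := by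
    ext x
    by_contra h
    exact hη ⟨(x, η), subset_tsupport b h, rfl⟩
  rw [this, Real.fourier_eq']
  simp

theorem integral_weyl_eq_integral_weylComponent {b : V × V → ℂ} (hb : Continuous b)
    (hbs : HasCompactSupport b) {w : V → ℝ} (hw : Integrable w)
    (hB : ∀ p η, ‖𝓕 (fun x => b (x, η)) p‖ ≤ w p) {f : V → ℂ} (hf : Integrable f)
    (hfc : Continuous f) (x : V) :
    ∫ η, ∫ y, Complex.exp (Complex.I * (2 * Real.pi * ⟪η, x - y⟫ : ℝ)) *
        b ((2 : ℝ)⁻¹ • (x + y), η) * f y = ∫ p, weylComponent b f p x := by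
  simp_rw [integral_weyl_kernel hb hbs hw hB hf hfc x]
  have hBc := continuous_partial_fourier hb hbs
  have hFc := Real.continuous_fourier_of_integrable hf
  rw [integral_integral_swap]
  · refine integral_congr_ae (.of_forall fun p => ?_)
    simp only [weylComponent]
    rw [Real.fourierInv_eq', ← integral_const_mul]
    refine integral_congr_ae (.of_forall fun η => ?_)
    simp only [smul_eq_mul]
    ring
  · have hK : IsCompact (Prod.snd '' tsupport b) := hbs.isCompact.image continuous_snd
    have hKi : Integrable ((Prod.snd '' tsupport b).indicator fun _ => (1 : ℝ)) :=
      (integrable_indicator_iff hK.measurableSet).2 (integrableOn_const hK.measure_ne_top)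
    refine ((hKi.mul_prod hw).mul_const (∫ y, ‖f y‖)).mono'
      (Continuous.aestronglyMeasurable ?_) (.of_forall fun z => ?_)
    · have h1 : Continuous fun z : V × V => 𝓕 (fun x => b (x, z.1)) z.2 := hBc.comp continuous_swap
      unfold Function.uncurry
      fun_prop
    · simp only [Function.uncurry, norm_mul, Complex.norm_exp_ofReal_mul_I, one_mul]
      by_cases hz : z.1 ∈ Prod.snd '' tsupport b
      · rw [Set.indicator_of_mem hz, one_mul]
        gcongr
        · exact (norm_nonneg _).trans (hB z.2 z.1)
        · exact hB _ _
        · exact VectorFourier.norm_fourierIntegral_le_integral_norm _ _ _ _ _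
      · rw [partial_fourier_eq_zero hz]
        simp [Set.indicator_of_notMem hz]

theorem stronglyMeasurable_weylComponent {b : V × V → ℂ} (hb : Continuous b)
    (hbs : HasCompactSupport b) {f : V → ℂ} (hf : Integrable f) :
    StronglyMeasurable (Function.uncurry (weylComponent b f)) := by
  have hBc := continuous_partial_fourier hb hbs
  have hFc := Real.continuous_fourier_of_integrable hf
  unfold weylComponent Function.uncurry
  refine StronglyMeasurable.mul (Continuous.stronglyMeasurable (by fun_prop)) ?_
  simp_rw [Real.fourierInv_eq']
  refine StronglyMeasurable.integral_prod_right (f := fun (z : V × V) (η : V) =>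
    Complex.exp (↑(2 * Real.pi * ⟪η, z.2⟫) * Complex.I) •
      (𝓕 (fun x => b (x, η)) z.1 * 𝓕 f (η - (2 : ℝ)⁻¹ • z.1))) (Continuous.stronglyMeasurable ?_)
  have h1 : Continuous fun q : (V × V) × V => 𝓕 (fun x => b (x, q.2)) q.1.1 :=
    hBc.comp (by fun_prop : Continuous fun q : (V × V) × V => (q.1.1, q.2))
  unfold Function.uncurry
  fun_prop

theorem eLpNorm_weylComponent_le {b : V × V → ℂ} (hb : Continuous b)
    (hbs : HasCompactSupport b) {w : V → ℝ}
    (hB : ∀ p η, ‖𝓕 (fun x => b (x, η)) p‖ ≤ w p) {f : V → ℂ} (hf : Integrable f)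
    (hf2 : MemLp f 2) (p : V) :
    eLpNorm (weylComponent b f p) 2 ≤ ENNReal.ofReal (w p) * eLpNorm f 2 := by
  have hBc := continuous_partial_fourier hb hbs
  have hFc := Real.continuous_fourier_of_integrable hf
  obtain ⟨u, hu⟩ : ∃ u : V → ℂ, u = fun η => 𝓕 (fun x => b (x, η)) p * 𝓕 f (η - (2 : ℝ)⁻¹ • p) :=
    ⟨_, rfl⟩
  have huc : Continuous u := by
    rw [hu]
    have h1 : Continuous fun η : V => 𝓕 (fun x => b (x, η)) p :=
      hBc.comp (Continuous.prodMk_right p)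
    exact h1.mul (hFc.comp (continuous_sub_right _))
  have hus : HasCompactSupport u :=
    HasCompactSupport.intro (hbs.isCompact.image continuous_snd) fun η hη => by
      rw [hu]
      simp only [partial_fourier_eq_zero hη, zero_mul]
  have hnorm (x : V) : ‖weylComponent b f p x‖ = ‖𝓕⁻ u x‖ := by
    rw [weylComponent, norm_mul, Complex.norm_exp_ofReal_mul_I, one_mul, hu]
  have hcomponent : eLpNorm (weylComponent b f p) 2 = eLpNorm (𝓕⁻ u) 2 :=
    eLpNorm_congr_norm_ae (.of_forall hnorm)
  have hplancherel : eLpNorm (𝓕⁻ u) 2 = eLpNorm u 2 :=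
    Real.eLpNorm_fourierInv_eq (huc.integrable_of_hasCompactSupport hus)
      (huc.memLp_of_hasCompactSupport hus)
  have hmul : eLpNorm u 2 ≤
      ENNReal.ofReal (w p) * eLpNorm (fun η => 𝓕 f (η - (2 : ℝ)⁻¹ • p)) 2 := by
    refine eLpNorm_le_mul_eLpNorm_of_ae_le_mul (.of_forall fun η => ?_) 2
    rw [hu, norm_mul]
    gcongr
    exact hB p η
  have htranslate : eLpNorm (fun η => 𝓕 f (η - (2 : ℝ)⁻¹ • p)) 2 = eLpNorm (𝓕 f) 2 :=
    eLpNorm_comp_measurePreserving (g := 𝓕 f) hFc.aestronglyMeasurable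
      (measurePreserving_sub_right volume ((2 : ℝ)⁻¹ • p))
  rw [hcomponent, hplancherel, ← Real.eLpNorm_fourier_eq hf hf2, ← htranslate]
  exact hmul

end Weyl

/-- A Calderón–Vaillancourt-type estimate for the semiclassical Weyl quantization
`op_ε(a)f(x) = (2π)^{−d} ∫∫ e^{iξ·(x−y)} a((x+y)/2, εξ) f(y) dy dξ`: its `L²→L²` norm is
bounded, uniformly in `ε`, by a constant (depending only on `d`) times
`sup_{|β|≤d+1} sup_ξ ∫ |∂ₓ^β a(x,ξ)| dx`, involving only `x`-derivatives of the
symbol. -/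
theorem weyl_quantization_l2_bound (d : ℕ) (hd : 1 ≤ d) :
    ∃ C > (0:ℝ), ∀ ε : ℝ, 0 < ε →
      ∀ a : EuclideanSpace ℝ (Fin d) × EuclideanSpace ℝ (Fin d) → ℂ,
      ContDiff ℝ (⊤ : ℕ∞) a → HasCompactSupport a →
      ∀ S : ℝ,
      (∀ n : ℕ, n ≤ d + 1 → ∀ ξ : EuclideanSpace ℝ (Fin d),
        (∫ x : EuclideanSpace ℝ (Fin d),
          ‖iteratedFDeriv ℝ n (fun x' => a (x', ξ)) x‖) ≤ S) →
      ∀ f : SchwartzMap (EuclideanSpace ℝ (Fin d)) ℂ,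
        eLpNorm (fun x : EuclideanSpace ℝ (Fin d) =>
            (((2 * Real.pi) ^ (-(d : ℝ)) : ℝ) : ℂ) *
              ∫ ξ : EuclideanSpace ℝ (Fin d), ∫ y : EuclideanSpace ℝ (Fin d),
                Complex.exp (Complex.I * ((⟪ξ, x - y⟫ : ℝ) : ℂ)) *
                  a ((2 : ℝ)⁻¹ • (x + y), ε • ξ) * f y) 2 volume
          ≤ ENNReal.ofReal (C * S) * eLpNorm (fun x => f x) 2 volume := by
  let E := EuclideanSpace ℝ (Fin d)
  let v : E → ℝ := fun p => (1 + ‖p‖) ^ (-((d + 1 : ℕ) : ℝ))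
  have hvpos (p : E) : 0 < v p := by positivity
  have hv : Integrable v := integrable_one_add_norm (by simp [E])
  have hvm : Measurable fun p => ENNReal.ofReal (v p) := by fun_prop
  have hv0 : 0 ≤ ∫ p, v p := integral_nonneg fun p => (hvpos p).le
  set A : ℝ := 2 ^ (d + 1) * (1 + 2 ^ (d + 1) * ((d + 1 : ℕ) + 1))
  have hApos : 0 < A := by positivity
  refine ⟨(1 + ∫ p, v p) * A, by positivity, fun ε hε a ha has S hS f => ?_⟩
  have hS0 : 0 ≤ S := (integral_nonneg fun x => norm_nonneg _).trans (hS 0 (Nat.zero_le _) 0)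
  let c : ℝ := ε * (2 * Real.pi)
  have hc : c ≠ 0 := by positivity
  let b : E × E → ℂ := fun z => a (z.1, c • z.2)
  have hb : ContDiff ℝ (⊤ : ℕ∞) b := by fun_prop
  have hbs : HasCompactSupport b :=
    has.comp_homeomorph ((Homeomorph.refl E).prodCongr (Homeomorph.smulOfNeZero c hc))
  let w : E → ℝ := fun p => v p * (A * S)
  have hB (p η : E) : ‖𝓕 (fun x => b (x, η)) p‖ ≤ w p := by
    have h := Real.one_add_norm_pow_mul_norm_fourier_le (g := fun x => b (x, η)) (by fun_prop)
      (hbs.comp_prodMk_left η) (N := d + 1) (S := S) (fun n hn => hS n hn (c • η)) p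
    have h1 : 0 < (1 + ‖p‖) ^ (d + 1) := by positivity
    simp only [w, v]
    rw [Real.rpow_neg (by positivity), Real.rpow_natCast, ← div_eq_inv_mul, le_div_iff₀ h1,
      mul_comm]
    exact h
  have hfi : Integrable f := f.integrable
  have hf2 : MemLp f 2 := f.memLp 2
  have hT (x : E) : (((2 * Real.pi) ^ (-(d : ℝ)) : ℝ) : ℂ) * ∫ ξ : E, ∫ y : E,
      Complex.exp (Complex.I * ((⟪ξ, x - y⟫ : ℝ) : ℂ)) *
        a ((2 : ℝ)⁻¹ • (x + y), ε • ξ) * f y = ∫ p, weylComponent b f p x := by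
    rw [← integral_weyl_eq_integral_weylComponent hb.continuous hbs (hv.mul_const _) hB hfi
      f.continuous x]
    have h := Measure.integral_comp_smul (volume : Measure E) (fun ξ => ∫ y : E,
      Complex.exp (Complex.I * ((⟪ξ, x - y⟫ : ℝ) : ℂ)) *
        a ((2 : ℝ)⁻¹ • (x + y), ε • ξ) * f y) (2 * Real.pi)
    rw [Complex.real_smul, finrank_euclideanSpace_fin, abs_of_pos (by positivity),
      ← Real.rpow_natCast, ← Real.rpow_neg (by positivity)] at h
    rw [← h]
    simp only [b, c, inner_smul_left, smul_smul]
    rfl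
  refine (eLpNorm_congr_ae (.of_forall hT)).trans_le ?_
  refine (eLpNorm_integral_le_lintegral_mul
    (stronglyMeasurable_weylComponent hb.continuous hbs hfi) hvm
    (fun p => (ENNReal.ofReal_pos.2 (hvpos p)).ne') (fun p => ENNReal.ofReal_ne_top)
    (K := ENNReal.ofReal (A * S) * eLpNorm f 2) fun p => ?_).trans ?_
  · rw [← mul_assoc, ← ENNReal.ofReal_mul (hvpos p).le]
    exact eLpNorm_weylComponent_le hb.continuous hbs hB hfi hf2 p
  · rw [← ofReal_integral_eq_lintegral_ofReal hv (.of_forall fun p => (hvpos p).le), ← mul_assoc,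
      ← ENNReal.ofReal_mul hv0, mul_assoc _ A S]
    gcongr
    linarith

end
end

section
/- Let d, N ≥ 1. There exists a constant C > 0 depending only on d and N such that for every ε > 0 and all matrix-valued symbols a, b ∈ C_c^∞(ℝ^d × ℝ^d, ℂ^{N×N}), the semiclassical Weyl quantizations satisfy op_ε(a) ∘ op_ε(b) = op_ε(ab) + (ε/(2i)) op_ε({a, b}) + ε² R_ε, where {a, b} = ∇_ξ a · ∇ₓ b − ∇ₓ a · ∇_ξ b, and the remainder R_ε is a bounded operator on L²(ℝ^d, ℂ^N) with ‖R_ε‖ ≤ C · sup_{|α|+|β| = 2} sup_{|γ| ≤ d+1} sup_{ξ ∈ ℝ^d} ( ∫ |∂_ξ^α ∂ₓ^{β+γ} a(x, ξ)| dx ) · ( ∫ |∂_ξ^β ∂ₓ^{α+γ} b(x, ξ)| dx ). -/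
open MeasureTheory
open scoped RealInnerProductSpace

noncomputable section

/-- The semiclassical Weyl quantization of an operator- (matrix-) valued symbol, acting on
`ℂᴺ`-valued functions:
`op_ε(a)f(x) = (2π)^{−d} ∫∫ e^{iξ·(x−y)} a((x+y)/2, εξ)(f(y)) dy dξ`. -/
def weylQ (d N : ℕ) (ε : ℝ)
    (a : EuclideanSpace ℝ (Fin d) × EuclideanSpace ℝ (Fin d) →
      (EuclideanSpace ℂ (Fin N) →L[ℂ] EuclideanSpace ℂ (Fin N)))
    (f : EuclideanSpace ℝ (Fin d) → EuclideanSpace ℂ (Fin N)) :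
    EuclideanSpace ℝ (Fin d) → EuclideanSpace ℂ (Fin N) :=
  fun x => ((2 * Real.pi) ^ (-(d : ℝ)) : ℝ) •
    ∫ ξ : EuclideanSpace ℝ (Fin d), ∫ y : EuclideanSpace ℝ (Fin d),
      Complex.exp (Complex.I * ((⟪ξ, x - y⟫ : ℝ) : ℂ)) •
        (a ((2 : ℝ)⁻¹ • (x + y), ε • ξ)) (f y)

/-- The matrix-valued Poisson bracket `{a, b} = ∇_ξ a · ∇ₓ b − ∇ₓ a · ∇_ξ b`. -/
def pbracket (d N : ℕ)
    (a b : EuclideanSpace ℝ (Fin d) × EuclideanSpace ℝ (Fin d) →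
      (EuclideanSpace ℂ (Fin N) →L[ℂ] EuclideanSpace ℂ (Fin N))) :
    EuclideanSpace ℝ (Fin d) × EuclideanSpace ℝ (Fin d) →
      (EuclideanSpace ℂ (Fin N) →L[ℂ] EuclideanSpace ℂ (Fin N)) :=
  fun p => ∑ j : Fin d,
    ((fderiv ℝ a p (0, EuclideanSpace.single j 1)) ∘L
        (fderiv ℝ b p (EuclideanSpace.single j 1, 0)) -
      (fderiv ℝ a p (EuclideanSpace.single j 1, 0)) ∘L
        (fderiv ℝ b p (0, EuclideanSpace.single j 1)))

section SymbolClass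
open scoped FourierTransform ContDiff
open Module (finrank)

variable {E : Type*} [NormedAddCommGroup E] [InnerProductSpace ℝ E]

/-- Smooth compactly supported symbols on phase space. -/
structure IsSymbol {V : Type*} [NormedAddCommGroup V] [NormedSpace ℝ V] (a : E × E → V) :
    Prop where
  contDiff : ContDiff ℝ (⊤ : ℕ∞) a
  hasCompactSupport : HasCompactSupport a

/-- An integrable weight. -/
def decayWeight (x : E) : ℝ := ((1 + ‖x‖) ^ (finrank ℝ E + 1))⁻¹

lemma decayWeight_pos (x : E) : 0 < decayWeight x := by
  unfold decayWeight; positivity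

lemma decayWeight_le_one (x : E) : decayWeight x ≤ 1 := by
  unfold decayWeight
  exact inv_le_one_of_one_le₀ (one_le_pow₀ (by linarith [norm_nonneg x]))

lemma continuous_decayWeight : Continuous (decayWeight : E → ℝ) := by
  unfold decayWeight
  refine Continuous.inv₀ (by fun_prop) fun x => ?_
  positivity

lemma integrable_decayWeight [FiniteDimensional ℝ E] [MeasurableSpace E] [BorelSpace E] :
    Integrable (decayWeight : E → ℝ) := by
  have h := integrable_one_add_norm (E := E) (μ := volume) (r := (finrank ℝ E + 1 : ℕ))
    (by push_cast; linarith)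
  refine h.congr (Filter.Eventually.of_forall fun x => ?_)
  simp only [decayWeight]
  rw [Real.rpow_neg (by positivity), Real.rpow_natCast]

section Real
variable {V W : Type*} [NormedAddCommGroup V] [NormedSpace ℝ V]
  [NormedAddCommGroup W] [NormedSpace ℝ W] {a b : E × E → V}

lemma IsSymbol.exists_bound (ha : IsSymbol a) :
    ∃ M, 0 ≤ M ∧ ∀ x ξ, ‖a (x, ξ)‖ ≤ M * decayWeight x * decayWeight ξ := by
  have hc : Continuous fun p : E × E => (decayWeight p.1 * decayWeight p.2)⁻¹ * ‖a p‖ := by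
    refine Continuous.mul (Continuous.inv₀ ?_ fun p => ?_) ha.contDiff.continuous.norm
    · exact (continuous_decayWeight.comp continuous_fst).mul
        (continuous_decayWeight.comp continuous_snd)
    · exact (mul_pos (decayWeight_pos _) (decayWeight_pos _)).ne'
  obtain ⟨p, hp⟩ := hc.exists_forall_ge_of_hasCompactSupport ha.hasCompactSupport.norm.mul_left
  refine ⟨(decayWeight p.1 * decayWeight p.2)⁻¹ * ‖a p‖, ?_, fun x ξ => ?_⟩
  · exact mul_nonneg (inv_nonneg.2 (mul_pos (decayWeight_pos _) (decayWeight_pos _)).le)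
      (norm_nonneg _)
  · have := hp (x, ξ)
    simp only at this
    rw [inv_mul_le_iff₀ (mul_pos (decayWeight_pos _) (decayWeight_pos _))] at this
    linarith

lemma IsSymbol.clm_comp (ha : IsSymbol a) (L : V →L[ℝ] W) : IsSymbol fun p => L (a p) :=
  ⟨L.contDiff.comp ha.contDiff, ha.hasCompactSupport.comp_left (map_zero L)⟩

lemma IsSymbol.bilin (ha : IsSymbol a) {b : E × E → W} (hb : IsSymbol b) {X : Type*}
    [NormedAddCommGroup X] [NormedSpace ℝ X] (B : V →L[ℝ] W →L[ℝ] X) :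
    IsSymbol fun p => B (a p) (b p) := by
  refine ⟨B.isBoundedBilinearMap.contDiff.comp (ha.contDiff.prodMk hb.contDiff), ?_⟩
  refine ha.hasCompactSupport.mono fun x hx => ?_
  contrapose! hx
  simp only [Function.mem_support, not_not] at hx
  simp [hx]

lemma IsSymbol.add (ha : IsSymbol a) (hb : IsSymbol b) : IsSymbol fun p => a p + b p :=
  ⟨ha.contDiff.add hb.contDiff, ha.hasCompactSupport.add hb.hasCompactSupport⟩

lemma IsSymbol.sub (ha : IsSymbol a) (hb : IsSymbol b) : IsSymbol fun p => a p - b p := by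
  refine ⟨ha.contDiff.sub hb.contDiff, ?_⟩
  refine (ha.hasCompactSupport.union hb.hasCompactSupport).of_isClosed_subset
    (isClosed_tsupport _) (closure_minimal (fun x hx => ?_)
      ((isClosed_tsupport _).union (isClosed_tsupport _)))
  by_contra h
  simp only [Set.mem_union, not_or] at h
  simp [image_eq_zero_of_notMem_tsupport h.1, image_eq_zero_of_notMem_tsupport h.2] at hx

lemma IsSymbol.fderiv_apply (ha : IsSymbol a) (v : E × E) :
    IsSymbol fun p => fderiv ℝ a p v := by
  refine ⟨(ha.contDiff.fderiv_right (m := ∞) (by norm_cast)).clm_apply contDiff_const, ?_⟩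
  exact ha.hasCompactSupport.fderiv_apply (𝕜 := ℝ) v

lemma iteratedFDeriv_partial_snd (ha : ContDiff ℝ ∞ a) (n : ℕ) (p : E × E) :
    iteratedFDeriv ℝ n (fun ζ => a (p.1, ζ)) p.2 =
      (iteratedFDeriv ℝ n a p).compContinuousLinearMap
        fun _ => ContinuousLinearMap.inr ℝ E E := by
  have h1 : (fun ζ => a (p.1, ζ)) =
      (fun q => a (q + (p.1, 0))) ∘ (ContinuousLinearMap.inr ℝ E E) := by
    ext ζ; simp
  have h2 : ContDiff ℝ ∞ fun q => a (q + (p.1, 0)) := ha.comp (contDiff_id.add contDiff_const)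
  rw [h1, ContinuousLinearMap.iteratedFDeriv_comp_right _ h2 _ (by exact_mod_cast le_top),
    iteratedFDeriv_comp_add_right]
  simp

lemma iteratedFDeriv_partial_fst (ha : ContDiff ℝ ∞ a) (n : ℕ) (p : E × E) :
    iteratedFDeriv ℝ n (fun x => a (x, p.2)) p.1 =
      (iteratedFDeriv ℝ n a p).compContinuousLinearMap
        fun _ => ContinuousLinearMap.inl ℝ E E := by
  have h1 : (fun x => a (x, p.2)) =
      (fun q => a (q + (0, p.2))) ∘ (ContinuousLinearMap.inl ℝ E E) := by
    ext ζ; simp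
  have h2 : ContDiff ℝ ∞ fun q => a (q + (0, p.2)) := ha.comp (contDiff_id.add contDiff_const)
  rw [h1, ContinuousLinearMap.iteratedFDeriv_comp_right _ h2 _ (by exact_mod_cast le_top),
    iteratedFDeriv_comp_add_right]
  simp

lemma IsSymbol.iteratedFDeriv (ha : IsSymbol a) (n : ℕ) : IsSymbol (iteratedFDeriv ℝ n a) :=
  ⟨ha.contDiff.iteratedFDeriv_right (by norm_cast), ha.hasCompactSupport.iteratedFDeriv n⟩

lemma IsSymbol.iteratedFDeriv_snd (ha : IsSymbol a) (n : ℕ) :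
    IsSymbol fun p => _root_.iteratedFDeriv ℝ n (fun ζ => a (p.1, ζ)) p.2 := by
  simp_rw [iteratedFDeriv_partial_snd ha.contDiff]
  exact (ha.iteratedFDeriv n).clm_comp
    (ContinuousMultilinearMap.compContinuousLinearMapL fun _ => ContinuousLinearMap.inr ℝ E E)

lemma IsSymbol.iteratedFDeriv_fst (ha : IsSymbol a) (n : ℕ) :
    IsSymbol fun p => _root_.iteratedFDeriv ℝ n (fun x => a (x, p.2)) p.1 := by
  simp_rw [iteratedFDeriv_partial_fst ha.contDiff]
  exact (ha.iteratedFDeriv n).clm_comp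
    (ContinuousMultilinearMap.compContinuousLinearMapL fun _ => ContinuousLinearMap.inl ℝ E E)

lemma IsSymbol.contDiff_slice (ha : IsSymbol a) (ξ : E) : ContDiff ℝ ∞ fun x => a (x, ξ) :=
  ha.contDiff.comp (contDiff_id.prodMk contDiff_const)

lemma IsSymbol.hasCompactSupport_slice (ha : IsSymbol a) (ξ : E) :
    HasCompactSupport fun x => a (x, ξ) :=
  ha.hasCompactSupport.comp_isClosedEmbedding
    (Topology.IsClosedEmbedding.of_continuous_injective_isClosedMap (by fun_prop)
      (fun x y h => (Prod.mk.inj h).1) (isClosedMap_prodMk_right ξ))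

/-- The directional derivative of a symbol in its second variable. -/
def dirSnd (v : E) (a : E × E → V) : E × E → V := fun p => fderiv ℝ a p (0, v)

/-- The directional derivative of a symbol in its first variable. -/
def dirFst (v : E) (a : E × E → V) : E × E → V := fun p => fderiv ℝ a p (v, 0)

lemma IsSymbol.dirSnd (ha : IsSymbol a) (v : E) : IsSymbol (dirSnd v a) := ha.fderiv_apply _

lemma IsSymbol.dirFst (ha : IsSymbol a) (v : E) : IsSymbol (dirFst v a) := ha.fderiv_apply _

lemma IsSymbol.hasDerivAt_line (ha : IsSymbol a) (x ξ v : E) (s : ℝ) :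
    HasDerivAt (fun s : ℝ => a (x, ξ + s • v)) (_root_.dirSnd v a (x, ξ + s • v)) s := by
  have h1 : HasFDerivAt a (fderiv ℝ a (x, ξ + s • v)) (x, ξ + s • v) :=
    (ha.contDiff.differentiable (by simp) _).hasFDerivAt
  have h2 : HasDerivAt (fun s : ℝ => (x, ξ + s • v)) ((0 : E), v) s := by
    refine (hasDerivAt_const s x).prodMk ?_
    simpa using ((hasDerivAt_id s).smul_const v).const_add ξ
  exact h1.comp_hasDerivAt s h2

lemma IsSymbol.dirSnd_eq (ha : IsSymbol a) (v x ξ : E) :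
    _root_.dirSnd v a (x, ξ) = fderiv ℝ (fun ζ => a (x, ζ)) ξ v := by
  have h1 : HasFDerivAt a (fderiv ℝ a (x, ξ)) (x, ξ) :=
    (ha.contDiff.differentiable (by simp) _).hasFDerivAt
  have h2 : HasFDerivAt (fun ζ : E => (x, ζ)) (ContinuousLinearMap.inr ℝ E E) ξ :=
    hasFDerivAt_prodMk_right x ξ
  have h3 := (h1.comp ξ h2).fderiv
  simp only [Function.comp_def] at h3
  rw [h3]
  simp [_root_.dirSnd]

lemma IsSymbol.dirFst_eq (ha : IsSymbol a) (v x ξ : E) :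
    _root_.dirFst v a (x, ξ) = fderiv ℝ (fun y => a (y, ξ)) x v := by
  have h1 : HasFDerivAt a (fderiv ℝ a (x, ξ)) (x, ξ) :=
    (ha.contDiff.differentiable (by simp) _).hasFDerivAt
  have h2 : HasFDerivAt (fun ζ : E => (ζ, ξ)) (ContinuousLinearMap.inl ℝ E E) x :=
    hasFDerivAt_prodMk_left x ξ
  have h3 := (h1.comp x h2).fderiv
  simp only [Function.comp_def] at h3
  rw [h3]
  simp [_root_.dirFst]

lemma IsSymbol.iterate_dirSnd (ha : IsSymbol a) (v : E) (m : ℕ) :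
    IsSymbol ((_root_.dirSnd v)^[m] a) := by
  induction m with
  | zero => exact ha
  | succ m ih => rw [Function.iterate_succ_apply']; exact ih.dirSnd v

lemma IsSymbol.iterate_dirSnd_eq (ha : IsSymbol a) (v : E) (m : ℕ) (x ξ : E) :
    (_root_.dirSnd v)^[m] a (x, ξ) =
      _root_.iteratedFDeriv ℝ m (fun ζ => a (x, ζ)) ξ fun _ => v := by
  induction m generalizing ξ with
  | zero => simp
  | succ m ih =>
    rw [Function.iterate_succ_apply', (ha.iterate_dirSnd v m).dirSnd_eq]
    have hs : ContDiff ℝ ∞ fun ζ => a (x, ζ) :=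
      ha.contDiff.comp (contDiff_const.prodMk contDiff_id)
    simp_rw [ih]
    rw [iteratedFDeriv_succ_apply_left]
    have hd : HasFDerivAt (_root_.iteratedFDeriv ℝ m (fun ζ => a (x, ζ)))
        (fderiv ℝ (_root_.iteratedFDeriv ℝ m (fun ζ => a (x, ζ))) ξ) ξ :=
      (hs.differentiable_iteratedFDeriv (m := m) (by exact_mod_cast ENat.natCast_lt_top m)
        ξ).hasFDerivAt
    have := ((ContinuousMultilinearMap.apply ℝ (fun _ : Fin m => E) V
      (fun _ => v)).hasFDerivAt.comp ξ hd).fderiv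
    simp only [Function.comp_def, ContinuousMultilinearMap.apply_apply] at this
    rw [this]
    rfl

end Real

lemma mul_decayWeight_inv_le {t A B : ℝ} {x : E} (ht : 0 ≤ t) (h0 : t ≤ A)
    (h1 : ‖x‖ ^ (finrank ℝ E + 1) * t ≤ A) (hB : 2 ^ (finrank ℝ E + 1) * A ≤ B) :
    t ≤ B * decayWeight x := by
  rw [decayWeight, ← div_eq_mul_inv, le_div_iff₀ (by positivity)]
  refine le_trans ?_ hB
  have : (1 + ‖x‖) ^ (finrank ℝ E + 1) * t ≤ 2 ^ (finrank ℝ E + 1) * A := by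
    rcases le_total ‖x‖ 1 with h | h
    · refine mul_le_mul (pow_le_pow_left₀ (by positivity) (by linarith) _) h0 ht (by positivity)
    · calc _ ≤ (2 * ‖x‖) ^ (finrank ℝ E + 1) * t := by gcongr; linarith
        _ = 2 ^ (finrank ℝ E + 1) * (‖x‖ ^ (finrank ℝ E + 1) * t) := by rw [mul_pow]; ring
        _ ≤ _ := by gcongr
  linarith

end SymbolClass

section PartialFourier
open scoped FourierTransform ContDiff
open Module (finrank)

variable {E : Type*} [NormedAddCommGroup E] [InnerProductSpace ℝ E] [FiniteDimensional ℝ E]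
  [MeasurableSpace E] [BorelSpace E]

section Real
variable {V : Type*} [NormedAddCommGroup V] [NormedSpace ℝ V] {a : E × E → V}

lemma IsSymbol.integrable_slice (ha : IsSymbol a) (ξ : E) : Integrable fun x => a (x, ξ) :=
  (ha.contDiff_slice ξ).continuous.integrable_of_hasCompactSupport (ha.hasCompactSupport_slice ξ)

lemma IsSymbol.exists_integral_norm_le (ha : IsSymbol a) :
    ∃ M, 0 ≤ M ∧ ∀ ξ, ∫ x, ‖a (x, ξ)‖ ≤ M * decayWeight ξ := by
  obtain ⟨M, hM, h⟩ := ha.exists_bound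
  refine ⟨M * ∫ x : E, decayWeight x, mul_nonneg hM
    (integral_nonneg fun x => (decayWeight_pos x).le), fun ξ => ?_⟩
  calc ∫ x, ‖a (x, ξ)‖ ≤ ∫ x, M * decayWeight x * decayWeight ξ :=
        integral_mono (ha.integrable_slice ξ).norm
          ((integrable_decayWeight.const_mul M).mul_const _) fun x => h x ξ
    _ = _ := by rw [integral_mul_const, integral_const_mul]

end Real

variable {V : Type*} [NormedAddCommGroup V] [NormedSpace ℂ V] {a : E × E → V}

/-- The Fourier transform of a symbol in its first variable. -/
def symbolFourier (a : E × E → V) (η ξ : E) : V := 𝓕 (fun x => a (x, ξ)) η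

lemma norm_symbolFourier_le (a : E × E → V) (η ξ : E) :
    ‖symbolFourier a η ξ‖ ≤ ∫ x, ‖a (x, ξ)‖ :=
  VectorFourier.norm_fourierIntegral_le_integral_norm _ _ _ _ _

lemma IsSymbol.continuous_symbolFourier (ha : IsSymbol a) :
    Continuous fun p : E × E => symbolFourier a p.1 p.2 := by
  obtain ⟨M, hM, h⟩ := ha.exists_bound
  simp only [symbolFourier, Real.fourier_eq]
  refine continuous_of_dominated (bound := fun x => M * decayWeight x) (fun p => ?_) (fun p => ?_)
    (integrable_decayWeight.const_mul M) (Filter.Eventually.of_forall fun x => ?_)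
  · exact ((Real.continuous_fourierChar.comp (by fun_prop)).smul
      (ha.contDiff_slice p.2).continuous).aestronglyMeasurable
  · refine Filter.Eventually.of_forall fun x => ?_
    rw [Circle.norm_smul]
    refine (h _ _).trans ?_
    exact mul_le_of_le_one_right (mul_nonneg hM (decayWeight_pos _).le) (decayWeight_le_one _)
  · exact (Real.continuous_fourierChar.comp (by fun_prop)).smul
      (ha.contDiff.continuous.comp (by fun_prop))

lemma IsSymbol.pow_mul_norm_symbolFourier_le (ha : IsSymbol a) (n : ℕ) (η ξ : E) :
    ‖η‖ ^ n * ‖symbolFourier a η ξ‖ ≤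
      ∫ x, ‖_root_.iteratedFDeriv ℝ n (fun x' => a (x', ξ)) x‖ := by
  rcases eq_or_ne η 0 with rfl | hη
  · rcases Nat.eq_zero_or_pos n with rfl | hn
    · simpa using norm_symbolFourier_le a 0 ξ
    · rw [norm_zero, zero_pow hn.ne', zero_mul]
      exact integral_nonneg fun x => norm_nonneg _
  have hpos : 0 < ‖η‖ := norm_pos_iff.2 hη
  have hint : ∀ m : ℕ, (m : ℕ∞) ≤ (⊤ : ℕ∞) →
      Integrable (_root_.iteratedFDeriv ℝ m fun x' => a (x', ξ)) := fun m _ =>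
    (ha.iteratedFDeriv_fst m).integrable_slice ξ
  have key := congrArg (fun F => F η fun _ => η)
    (Real.fourier_iteratedFDeriv (ha.contDiff_slice ξ) hint (n := n) le_top)
  simp only [VectorFourier.fourierPowSMulRight_apply] at key
  have hi : ((-innerSL ℝ) η) η = -‖η‖ ^ 2 := by
    change -⟪η, η⟫ = _
    rw [real_inner_self_eq_norm_sq]
  rw [Finset.prod_congr rfl fun i _ => hi] at key
  have h1 := congrArg norm key
  have h2 : ‖𝓕 (_root_.iteratedFDeriv ℝ n fun x' => a (x', ξ)) η fun _ => η‖ ≤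
      (∫ x, ‖_root_.iteratedFDeriv ℝ n (fun x' => a (x', ξ)) x‖) * ‖η‖ ^ n := by
    refine (ContinuousMultilinearMap.le_opNorm _ _).trans ?_
    rw [Finset.prod_const, Finset.card_univ, Fintype.card_fin]
    exact mul_le_mul_of_nonneg_right
      (VectorFourier.norm_fourierIntegral_le_integral_norm _ _ _ _ _) (by positivity)
  rw [h1, norm_smul, norm_smul] at h2
  have h3 : (1 : ℝ) ≤ ‖(-(2 * (Real.pi : ℂ) * Complex.I)) ^ n‖ := by
    rw [norm_pow, norm_neg]
    refine one_le_pow₀ ?_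
    simp [abs_of_pos Real.pi_pos]
    linarith [Real.pi_gt_three]
  simp only [Finset.prod_const, Finset.card_univ, Fintype.card_fin, norm_pow,
    norm_neg, norm_norm] at h2
  change _ * (_ * ‖symbolFourier a η ξ‖) ≤ _ at h2
  have h5 : 0 < ‖η‖ ^ n := by positivity
  refine le_of_mul_le_mul_right ?_ h5
  refine le_trans ?_ h2
  have h4 : 0 ≤ ((‖η‖ ^ 2) ^ n) * ‖symbolFourier a η ξ‖ := by positivity
  calc _ = 1 * (((‖η‖ ^ 2) ^ n) * ‖symbolFourier a η ξ‖) := by ring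
    _ ≤ _ := mul_le_mul_of_nonneg_right (by simpa using h3) h4

lemma IsSymbol.pow_mul_norm_symbolFourier_iterate_dirSnd_le (ha : IsSymbol a) (m n : ℕ)
    (v η ξ : E) :
    ‖η‖ ^ n * ‖symbolFourier ((_root_.dirSnd v)^[m] a) η ξ‖ ≤
      ‖v‖ ^ m * ∫ x, ‖_root_.iteratedFDeriv ℝ n
        (fun x' => _root_.iteratedFDeriv ℝ m (fun ζ => a (x', ζ)) ξ) x‖ := by
  refine ((ha.iterate_dirSnd v m).pow_mul_norm_symbolFourier_le n η ξ).trans ?_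
  rw [← integral_const_mul]
  have hG := ha.iteratedFDeriv_snd m
  refine integral_mono (((ha.iterate_dirSnd v m).iteratedFDeriv_fst n).integrable_slice ξ).norm
    (((hG.iteratedFDeriv_fst n).integrable_slice ξ).norm.const_mul _) fun x => ?_
  have h1 : (fun x' => (_root_.dirSnd v)^[m] a (x', ξ)) =
      (ContinuousMultilinearMap.apply ℝ (fun _ : Fin m => E) V fun _ => v) ∘
        fun x' => _root_.iteratedFDeriv ℝ m (fun ζ => a (x', ζ)) ξ := by
    ext x'
    simp [ha.iterate_dirSnd_eq]
  simp only [h1]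
  refine (ContinuousLinearMap.norm_iteratedFDeriv_comp_left _ (N := ∞)
    (hG.contDiff_slice ξ).contDiffAt (by exact_mod_cast le_top)).trans ?_
  refine mul_le_mul_of_nonneg_right ?_ (norm_nonneg _)
  refine ContinuousLinearMap.opNorm_le_bound _ (by positivity) fun f => ?_
  simpa [mul_comm] using f.le_opNorm fun _ => v

lemma IsSymbol.exists_symbolFourier_bound (ha : IsSymbol a) :
    ∃ M, 0 ≤ M ∧ ∀ η ξ, ‖symbolFourier a η ξ‖ ≤ M * decayWeight η * decayWeight ξ := by
  obtain ⟨M0, hM0, h0⟩ := ha.exists_integral_norm_le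
  obtain ⟨M1, hM1, h1⟩ := (ha.iteratedFDeriv_fst (finrank ℝ E + 1)).exists_integral_norm_le
  refine ⟨2 ^ (finrank ℝ E + 1) * (M0 + M1), by positivity, fun η ξ => ?_⟩
  have hw := (decayWeight_pos ξ).le
  have := mul_decayWeight_inv_le (x := η) (A := (M0 + M1) * decayWeight ξ)
    (norm_nonneg (symbolFourier a η ξ)) ?_ ?_ le_rfl
  · linarith
  · refine (norm_symbolFourier_le a η ξ).trans ((h0 ξ).trans ?_)
    gcongr; linarith
  · refine (ha.pow_mul_norm_symbolFourier_le _ η ξ).trans ((h1 ξ).trans ?_)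
    gcongr; linarith

lemma IsSymbol.exists_symbolFourier_le (ha : IsSymbol a) :
    ∃ M, 0 ≤ M ∧ ∀ η ξ, ‖symbolFourier a η ξ‖ ≤ M * decayWeight η := by
  obtain ⟨M, hM, h⟩ := ha.exists_symbolFourier_bound
  exact ⟨M, hM, fun η ξ => (h η ξ).trans
    (mul_le_of_le_one_right (mul_nonneg hM (decayWeight_pos _).le) (decayWeight_le_one _))⟩

lemma IsSymbol.hasDerivAt_symbolFourier (ha : IsSymbol a) (η ξ v : E) (s : ℝ) :
    HasDerivAt (fun s : ℝ => symbolFourier a η (ξ + s • v))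
      (symbolFourier (_root_.dirSnd v a) η (ξ + s • v)) s := by
  obtain ⟨M, hM, h⟩ := (ha.dirSnd v).exists_bound
  simp only [symbolFourier, Real.fourier_eq]
  have hm : ∀ {b : E × E → V}, IsSymbol b → ∀ s : ℝ,
      AEStronglyMeasurable (fun x => Real.fourierChar (-⟪x, η⟫) • b (x, ξ + s • v)) := by
    intro b hb s
    exact ((Real.continuous_fourierChar.comp (by fun_prop)).smul
      (hb.contDiff_slice (ξ + s • v)).continuous).aestronglyMeasurable
  refine (hasDerivAt_integral_of_dominated_loc_of_deriv_le (bound := fun x => M * decayWeight x)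
    (F' := fun s x => Real.fourierChar (-⟪x, η⟫) • _root_.dirSnd v a (x, ξ + s • v))
    (s := Set.univ) Filter.univ_mem (Filter.Eventually.of_forall fun s => hm ha s) ?_
    (hm (ha.dirSnd v) s) ?_ (integrable_decayWeight.const_mul M) ?_).2
  · exact (ha.integrable_slice _).norm.mono' (hm ha s)
      (Filter.Eventually.of_forall fun x => by rw [Circle.norm_smul])
  · refine Filter.Eventually.of_forall fun x s _ => ?_
    rw [Circle.norm_smul]
    exact (h _ _).trans
      (mul_le_of_le_one_right (mul_nonneg hM (decayWeight_pos _).le) (decayWeight_le_one _))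
  · exact Filter.Eventually.of_forall fun x s _ => (ha.hasDerivAt_line x ξ v s).const_smul _

lemma IsSymbol.symbolFourier_dirFst (ha : IsSymbol a) (v η ξ : E) :
    symbolFourier (_root_.dirFst v a) η ξ =
      (2 * Real.pi * Complex.I * (⟪v, η⟫ : ℝ) : ℂ) • symbolFourier a η ξ := by
  have hint : Integrable (fderiv ℝ fun x => a (x, ξ)) :=
    ((ha.contDiff_slice ξ).continuous_fderiv (by simp)).integrable_of_hasCompactSupport
      ((ha.hasCompactSupport_slice ξ).fderiv ℝ)
  have h := Real.fourier_fderiv (ha.integrable_slice ξ)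
    ((ha.contDiff_slice ξ).differentiable (by simp)) hint
  have h2 := congrArg (fun F => F η v) h
  simp only [Real.fourier_continuousLinearMap_apply hint] at h2
  simp only [symbolFourier, ha.dirFst_eq]
  have hi : ((-innerSL ℝ) η) v = -⟪η, v⟫ := rfl
  rw [h2, VectorFourier.fourierSMulRight_apply, hi, ← Complex.coe_smul, ← mul_smul, real_inner_comm]
  congr 1
  push_cast
  ring

end PartialFourier

section FourierKernel
open scoped FourierTransform ContDiff
open Module (finrank)

variable {E : Type*} [NormedAddCommGroup E] [InnerProductSpace ℝ E] [FiniteDimensional ℝ E]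
  [MeasurableSpace E] [BorelSpace E]

lemma integral_eq_smul_integral_comp_affine {V : Type*} [NormedAddCommGroup V] [NormedSpace ℝ V]
    (g : E → V) {c : ℝ} (hc : 0 < c) (w : E) :
    ∫ x, g x = c ^ finrank ℝ E • ∫ k, g (c • k + w) := by
  rw [Measure.integral_comp_smul volume (fun y => g (y + w)) c, integral_add_right_eq_self g w,
    abs_of_pos (by positivity), smul_smul, mul_inv_cancel₀ (by positivity), one_smul]

/-- The symbol `c` has Fourier transform `∫ Q (η - ζ) ζ ξ dζ` in its first variable. -/
structure HasConvKernel {V : Type*} [NormedAddCommGroup V] [NormedSpace ℂ V] (c : E × E → V)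
    (Q : E → E → E → V) : Prop where
  isSymbol : IsSymbol c
  continuous : Continuous fun p : E × E × E => Q p.1 p.2.1 p.2.2
  bound : ∃ M, 0 ≤ M ∧ ∀ η ζ ξ, ‖Q η ζ ξ‖ ≤ M * decayWeight η * decayWeight ζ
  eq_integral : ∀ η ξ, symbolFourier c η ξ = ∫ ζ, Q (η - ζ) ζ ξ

section Algebra
variable {V : Type*} [NormedAddCommGroup V] [NormedSpace ℂ V] {c c' : E × E → V}
  {Q Q' : E → E → E → V}

lemma HasConvKernel.integrable (h : HasConvKernel c Q) (η ξ : E) :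
    Integrable fun ζ => Q (η - ζ) ζ ξ := by
  obtain ⟨M, hM, hb⟩ := h.bound
  refine (integrable_decayWeight.const_mul M).mono' ?_ (Filter.Eventually.of_forall fun ζ => ?_)
  · exact (h.continuous.comp (by fun_prop : Continuous fun ζ : E => (η - ζ, ζ, ξ))
      ).aestronglyMeasurable
  · refine (hb _ _ _).trans ?_
    exact mul_le_mul_of_nonneg_right (mul_le_of_le_one_right hM (decayWeight_le_one _))
      (decayWeight_pos _).le

lemma symbolFourier_sub (h : IsSymbol c) (h' : IsSymbol c') (η ξ : E) :
    symbolFourier (fun p => c p - c' p) η ξ = symbolFourier c η ξ - symbolFourier c' η ξ := by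
  simp only [symbolFourier, Real.fourier_eq, smul_sub]
  exact integral_sub ((Real.fourierIntegral_convergent_iff η).2 (h.integrable_slice ξ))
    ((Real.fourierIntegral_convergent_iff η).2 (h'.integrable_slice ξ))

lemma symbolFourier_add (h : IsSymbol c) (h' : IsSymbol c') (η ξ : E) :
    symbolFourier (fun p => c p + c' p) η ξ = symbolFourier c η ξ + symbolFourier c' η ξ := by
  simp only [symbolFourier, Real.fourier_eq, smul_add]
  exact integral_add ((Real.fourierIntegral_convergent_iff η).2 (h.integrable_slice ξ))
    ((Real.fourierIntegral_convergent_iff η).2 (h'.integrable_slice ξ))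

lemma HasConvKernel.sub (h : HasConvKernel c Q) (h' : HasConvKernel c' Q') :
    HasConvKernel (fun p => c p - c' p) fun η ζ ξ => Q η ζ ξ - Q' η ζ ξ := by
  refine ⟨h.isSymbol.sub h'.isSymbol, h.continuous.sub h'.continuous, ?_, fun η ξ => ?_⟩
  · obtain ⟨M, hM, hb⟩ := h.bound
    obtain ⟨M', hM', hb'⟩ := h'.bound
    refine ⟨M + M', by positivity, fun η ζ ξ => (norm_sub_le _ _).trans ?_⟩
    linarith [hb η ζ ξ, hb' η ζ ξ]
  · rw [symbolFourier_sub h.isSymbol h'.isSymbol, h.eq_integral, h'.eq_integral,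
      integral_sub (h.integrable _ _) (h'.integrable _ _)]

lemma HasConvKernel.add (h : HasConvKernel c Q) (h' : HasConvKernel c' Q') :
    HasConvKernel (fun p => c p + c' p) fun η ζ ξ => Q η ζ ξ + Q' η ζ ξ := by
  refine ⟨h.isSymbol.add h'.isSymbol, h.continuous.add h'.continuous, ?_, fun η ξ => ?_⟩
  · obtain ⟨M, hM, hb⟩ := h.bound
    obtain ⟨M', hM', hb'⟩ := h'.bound
    refine ⟨M + M', by positivity, fun η ζ ξ => (norm_add_le _ _).trans ?_⟩
    linarith [hb η ζ ξ, hb' η ζ ξ]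
  · rw [symbolFourier_add h.isSymbol h'.isSymbol, h.eq_integral, h'.eq_integral,
      integral_add (h.integrable _ _) (h'.integrable _ _)]

lemma HasConvKernel.sum {ι : Type*} (s : Finset ι) {c : ι → E × E → V}
    {Q : ι → E → E → E → V} (h : ∀ i, HasConvKernel (c i) (Q i)) :
    HasConvKernel (fun p => ∑ i ∈ s, c i p) fun η ζ ξ => ∑ i ∈ s, Q i η ζ ξ := by
  classical
  induction s using Finset.induction_on with
  | empty =>
    simp only [Finset.sum_empty]
    refine ⟨⟨contDiff_const, HasCompactSupport.zero⟩, continuous_const, ⟨0, le_rfl, by simp⟩, ?_⟩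
    simp [symbolFourier, Real.fourier_eq]
  | insert i s hi ih =>
    simp only [Finset.sum_insert hi]
    exact (h i).add ih

end Algebra

lemma IsSymbol.integrable_symbolFourier {V : Type*} [NormedAddCommGroup V] [NormedSpace ℂ V]
    {a : E × E → V} (ha : IsSymbol a) (ξ : E) : Integrable fun η => symbolFourier a η ξ := by
  obtain ⟨M, hM, h⟩ := ha.exists_symbolFourier_le
  exact (integrable_decayWeight.const_mul M).mono'
    (ha.continuous_symbolFourier.comp (by fun_prop : Continuous fun η : E => (η, ξ))
      ).aestronglyMeasurable (Filter.Eventually.of_forall fun η => h η ξ)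

lemma IsSymbol.eq_integral_symbolFourier {V : Type*} [NormedAddCommGroup V] [NormedSpace ℂ V]
    [CompleteSpace V] {a : E × E → V} (ha : IsSymbol a) (x ξ : E) :
    a (x, ξ) = ∫ ζ, Real.fourierChar ⟪ζ, x⟫ • symbolFourier a ζ ξ := by
  have h := (ha.contDiff_slice ξ).continuous.fourierInv_fourier_eq (ha.integrable_slice ξ)
    (ha.integrable_symbolFourier ξ)
  conv_lhs => rw [show a (x, ξ) = (fun x => a (x, ξ)) x from rfl, ← h]
  rw [Real.fourierInv_eq]
  rfl

lemma HasConvKernel.bilin {V W X : Type*} [NormedAddCommGroup V] [NormedSpace ℂ V]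
    [NormedAddCommGroup W] [NormedSpace ℂ W] [CompleteSpace W] [CompleteSpace V]
    [NormedAddCommGroup X] [NormedSpace ℂ X] [CompleteSpace X] {a : E × E → V} {b : E × E → W}
    (ha : IsSymbol a) (hb : IsSymbol b) (B : V →L[ℂ] W →L[ℂ] X) :
    HasConvKernel (fun p => B (a p) (b p))
      fun η ζ ξ => B (symbolFourier a η ξ) (symbolFourier b ζ ξ) := by
  refine ⟨ha.bilin hb (B.bilinearRestrictScalars ℝ), ?_, ?_, fun η ξ => ?_⟩
  · have h1 := ha.continuous_symbolFourier.comp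
      (by fun_prop : Continuous fun p : E × E × E => (p.1, p.2.2))
    have h2 := hb.continuous_symbolFourier.comp
      (by fun_prop : Continuous fun p : E × E × E => (p.2.1, p.2.2))
    exact (B.continuous.comp h1).clm_apply h2
  · obtain ⟨M, hM, h⟩ := ha.exists_symbolFourier_le
    obtain ⟨M', hM', h'⟩ := hb.exists_symbolFourier_le
    refine ⟨‖B‖ * M * M', by positivity, fun η ζ ξ => (B.le_opNorm₂ _ _).trans ?_⟩
    calc _ ≤ ‖B‖ * (M * decayWeight η) * (M' * decayWeight ζ) := by
          have := h η ξ
          have := h' ζ ξ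
          have := (decayWeight_pos η).le
          gcongr
      _ = _ := by ring
  · have hbi := hb.integrable_symbolFourier ξ
    have h1 : ∀ x, Real.fourierChar (-⟪x, η⟫) • B (a (x, ξ)) (b (x, ξ)) =
        ∫ ζ, Real.fourierChar (-⟪x, η - ζ⟫) • B (a (x, ξ)) (symbolFourier b ζ ξ) := by
      intro x
      rw [hb.eq_integral_symbolFourier x ξ,
        ← ContinuousLinearMap.integral_comp_comm _
          ((Real.fourierIntegral_convergent_iff (-x)).2 hbi |>.congr
            (Filter.Eventually.of_forall fun ζ => by simp)), Circle.smul_def, ← integral_smul]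
      refine integral_congr_ae (Filter.Eventually.of_forall fun ζ => ?_)
      simp only
      rw [Circle.smul_def, map_smul, ← Circle.smul_def, ← Circle.smul_def, smul_smul,
        ← AddChar.map_add_eq_mul,
        inner_sub_right, real_inner_comm x ζ]
      congr 2
      ring
    have h2 : ∀ ζ, B (symbolFourier a (η - ζ) ξ) (symbolFourier b ζ ξ) =
        ∫ x, Real.fourierChar (-⟪x, η - ζ⟫) • B (a (x, ξ)) (symbolFourier b ζ ξ) := by
      intro ζ
      have := (B.flip (symbolFourier b ζ ξ)).integral_comp_comm
        ((Real.fourierIntegral_convergent_iff (η - ζ)).2 (ha.integrable_slice ξ))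
      rw [symbolFourier, Real.fourier_eq, ← ContinuousLinearMap.flip_apply, ← this]
      refine integral_congr_ae (Filter.Eventually.of_forall fun x => ?_)
      simp only
      rw [Circle.smul_def, map_smul, ← Circle.smul_def, ContinuousLinearMap.flip_apply]
    rw [symbolFourier, Real.fourier_eq]
    simp only [h1, h2]
    refine integral_integral_swap ?_
    refine (((ha.integrable_slice ξ).norm.mul_prod hbi.norm).const_mul ‖B‖).mono' ?_ ?_
    · have h3 : Continuous fun p : E × E => symbolFourier b p.2 ξ :=
        hb.continuous_symbolFourier.comp (by fun_prop : Continuous fun p : E × E => (p.2, ξ))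
      have h4 : Continuous fun p : E × E => a (p.1, ξ) :=
        ha.contDiff.continuous.comp (by fun_prop)
      exact ((Real.continuous_fourierChar.comp (by fun_prop)).smul
        ((B.continuous.comp h4).clm_apply h3)).aestronglyMeasurable
    · refine Filter.Eventually.of_forall fun p => ?_
      simp only [Function.uncurry]
      rw [Circle.norm_smul, ← mul_assoc]
      exact B.le_opNorm₂ _ _

variable {F : Type*} [NormedAddCommGroup F] [NormedSpace ℂ F]

lemma HasConvKernel.comp [CompleteSpace F] {a b : E × E → F →L[ℂ] F} (ha : IsSymbol a)
    (hb : IsSymbol b) :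
    HasConvKernel (fun p => a p ∘L b p)
      fun η ζ ξ => symbolFourier a η ξ ∘L symbolFourier b ζ ξ :=
  HasConvKernel.bilin ha hb (ContinuousLinearMap.compL ℂ F F F)

/-- The Weyl quantization of `a`, conjugated by the Fourier transform. -/
def kernelOp (δ : ℝ) (a : E × E → F →L[ℂ] F) (φ : E → F) (k : E) : F :=
  ∫ l, symbolFourier a (k - l) (δ • (k + l)) (φ l)

lemma IsSymbol.integrable_kernel {a : E × E → F →L[ℂ] F} (ha : IsSymbol a) (δ : ℝ) {φ : E → F}
    (hφ : Integrable φ) :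
    Integrable fun p : E × E => symbolFourier a (p.1 - p.2) (δ • (p.1 + p.2)) (φ p.2) := by
  obtain ⟨M, hM, h⟩ := ha.exists_symbolFourier_le
  have hi := (hφ.norm.convolution_integrand (ContinuousLinearMap.mul ℝ ℝ)
    (integrable_decayWeight (E := E))).const_mul M
  refine hi.mono' ?_ (Filter.Eventually.of_forall fun p => ?_)
  · have h1 : Continuous fun p : E × E => symbolFourier a (p.1 - p.2) (δ • (p.1 + p.2)) :=
      ha.continuous_symbolFourier.comp
        (by fun_prop : Continuous fun p : E × E => (p.1 - p.2, δ • (p.1 + p.2)))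
    exact (ContinuousLinearMap.id ℂ (F →L[ℂ] F)).aestronglyMeasurable_comp₂
      h1.aestronglyMeasurable hφ.aestronglyMeasurable.comp_snd
  · refine (ContinuousLinearMap.le_opNorm _ _).trans ?_
    simp only [ContinuousLinearMap.mul_apply']
    rw [mul_comm ‖φ p.2‖, ← mul_assoc]
    exact mul_le_mul_of_nonneg_right (h _ _) (norm_nonneg _)

lemma IsSymbol.integrable_kernelOp {a : E × E → F →L[ℂ] F} (ha : IsSymbol a) (δ : ℝ) {φ : E → F}
    (hφ : Integrable φ) : Integrable (kernelOp δ a φ) :=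
  (ha.integrable_kernel δ hφ).integral_prod_left

lemma integrable_clm_apply_snd {Q : E × E → F →L[ℂ] F} (hQ : Continuous Q) {k : E} {M : ℝ}
    (hb : ∀ p, ‖Q p‖ ≤ M * decayWeight (k - p.1)) {φ : E → F} (hφ : Integrable φ) :
    Integrable fun p : E × E => Q p (φ p.2) := by
  have hw : Integrable fun l : E => M * decayWeight (k - l) :=
    (integrable_decayWeight.comp_sub_left k).const_mul M
  refine (hw.mul_prod hφ.norm).mono' ?_ (Filter.Eventually.of_forall fun p => ?_)
  · exact (ContinuousLinearMap.id ℂ (F →L[ℂ] F)).aestronglyMeasurable_comp₂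
      hQ.aestronglyMeasurable hφ.aestronglyMeasurable.comp_snd
  · exact (ContinuousLinearMap.le_opNorm _ _).trans
      (mul_le_mul_of_nonneg_right (hb p) (norm_nonneg _))

lemma HasConvKernel.integrable_prod {c : E × E → F →L[ℂ] F} {Q : E → E → E → F →L[ℂ] F}
    (h : HasConvKernel c Q) (δ : ℝ) {φ : E → F} (hφ : Integrable φ) (k : E) :
    Integrable fun p : E × E => Q (k - p.1) (p.1 - p.2) (δ • (k + p.2)) (φ p.2) := by
  obtain ⟨M, hM, hb⟩ := h.bound
  refine integrable_clm_apply_snd (h.continuous.comp (by fun_prop :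
    Continuous fun p : E × E => (k - p.1, p.1 - p.2, δ • (k + p.2)))) (M := M) (k := k)
    (fun p => ?_) hφ
  exact (hb _ _ _).trans (mul_le_of_le_one_right (mul_nonneg hM (decayWeight_pos _).le)
    (decayWeight_le_one _))

lemma HasConvKernel.kernelOp_eq [CompleteSpace F] {c : E × E → F →L[ℂ] F}
    {Q : E → E → E → F →L[ℂ] F}
    (h : HasConvKernel c Q) (δ : ℝ) {φ : E → F} (hφ : Integrable φ) (k : E) :
    kernelOp δ c φ k =
      ∫ p : E × E, Q (k - p.1) (p.1 - p.2) (δ • (k + p.2)) (φ p.2) := by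
  rw [Measure.volume_eq_prod, integral_prod_symm _ (h.integrable_prod δ hφ k), kernelOp]
  refine integral_congr_ae (Filter.Eventually.of_forall fun m => ?_)
  simp only
  rw [h.eq_integral, ContinuousLinearMap.integral_apply (h.integrable _ _),
    ← integral_sub_right_eq_self _ m]
  simp

lemma IsSymbol.integrable_kernelOp_kernel {a b : E × E → F →L[ℂ] F} (ha : IsSymbol a)
    (hb : IsSymbol b) (δ : ℝ) {φ : E → F} (hφ : Integrable φ) (k : E) :
    Integrable fun p : E × E => (symbolFourier a (k - p.1) (δ • (k + p.1)) ∘L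
      symbolFourier b (p.1 - p.2) (δ • (p.1 + p.2))) (φ p.2) := by
  obtain ⟨M, hM, h⟩ := ha.exists_symbolFourier_le
  obtain ⟨M', hM', h'⟩ := hb.exists_symbolFourier_le
  refine integrable_clm_apply_snd (M := M * M') (k := k) ?_ (fun p => ?_) hφ
  · exact (ha.continuous_symbolFourier.comp (by fun_prop :
      Continuous fun p : E × E => (k - p.1, δ • (k + p.1)))).clm_comp
      (hb.continuous_symbolFourier.comp (by fun_prop :
      Continuous fun p : E × E => (p.1 - p.2, δ • (p.1 + p.2))))
  · refine (ContinuousLinearMap.opNorm_comp_le _ _).trans ?_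
    calc _ ≤ (M * decayWeight (k - p.1)) * (M' * 1) := by
          have := (decayWeight_pos (k - p.1)).le
          refine mul_le_mul (h _ _) ((h' _ _).trans ?_) (norm_nonneg _) (by positivity)
          exact mul_le_mul_of_nonneg_left (decayWeight_le_one _) hM'
      _ = _ := by ring

lemma kernelOp_kernelOp_eq [CompleteSpace F] {a b : E × E → F →L[ℂ] F} (ha : IsSymbol a)
    (hb : IsSymbol b) (δ : ℝ) {φ : E → F} (hφ : Integrable φ) (k : E) :
    kernelOp δ a (kernelOp δ b φ) k =
      ∫ p : E × E, (symbolFourier a (k - p.1) (δ • (k + p.1)) ∘L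
        symbolFourier b (p.1 - p.2) (δ • (p.1 + p.2))) (φ p.2) := by
  rw [Measure.volume_eq_prod, integral_prod _ (ha.integrable_kernelOp_kernel hb δ hφ k), kernelOp]
  refine integral_congr_ae ?_
  filter_upwards [(hb.integrable_kernel δ hφ).prod_right_ae] with l hl
  simp only [ContinuousLinearMap.comp_apply]
  rw [kernelOp, ← ContinuousLinearMap.integral_comp_comm _ hl]

end FourierKernel

section Quantization
open scoped FourierTransform ContDiff
open Module (finrank)

variable {E : Type*} [NormedAddCommGroup E] [InnerProductSpace ℝ E] [FiniteDimensional ℝ E]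
  [MeasurableSpace E] [BorelSpace E]
  {F : Type*} [NormedAddCommGroup F] [NormedSpace ℂ F]

lemma aestronglyMeasurable_fourierChar_smul {g : E × E → ℝ} (hg : Continuous g)
    {f : E × E → F} {μ : Measure (E × E)}
    (hf : AEStronglyMeasurable f μ) :
    AEStronglyMeasurable (fun p => Real.fourierChar (g p) • f p) μ := by
  have h : Continuous fun p => (Real.fourierChar (g p) : ℂ) :=
    continuous_subtype_val.comp (Real.continuous_fourierChar.comp hg)
  exact h.aestronglyMeasurable.smul hf

variable [CompleteSpace F]

lemma integral_midpoint_fourierInv {a : E × E → F →L[ℂ] F} (ha : IsSymbol a) {φ : E → F}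
    (hφ : Integrable φ) (x κ ζ : E) :
    ∫ y, Complex.exp (Complex.I * ((⟪Real.pi • κ, x - y⟫ : ℝ) : ℂ)) •
        (a ((2 : ℝ)⁻¹ • (x + y), ζ)) (𝓕⁻ φ y) =
      (2 : ℝ) ^ finrank ℝ E •
        ∫ l, Real.fourierChar ⟪κ - l, x⟫ • symbolFourier a (κ - (2 : ℝ) • l) ζ (φ l) := by
  rw [integral_eq_smul_integral_comp_affine _ (two_pos) (-x)]
  congr 1
  have h1 : ∀ z : E, Complex.exp (Complex.I *
      ((⟪Real.pi • κ, x - ((2 : ℝ) • z + -x)⟫ : ℝ) : ℂ)) •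
        (a ((2 : ℝ)⁻¹ • (x + ((2 : ℝ) • z + -x)), ζ)) (𝓕⁻ φ ((2 : ℝ) • z + -x)) =
      ∫ l, Real.fourierChar ⟪κ - l, x⟫ •
        Real.fourierChar (-⟪z, κ - (2 : ℝ) • l⟫) • (a (z, ζ)) (φ l) := by
    intro z
    have hz : (2 : ℝ)⁻¹ • (x + ((2 : ℝ) • z + -x)) = z := by
      rw [add_comm ((2 : ℝ) • z), add_neg_cancel_left, smul_smul]; norm_num
    have hi : Integrable fun l => Real.fourierChar ⟪l, (2 : ℝ) • z + -x⟫ • φ l :=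
      ((Real.fourierIntegral_convergent_iff (-((2 : ℝ) • z + -x))).2 hφ).congr
        (Filter.Eventually.of_forall fun ζ => by simp only [inner_neg_right, neg_neg])
    rw [hz, Real.fourierInv_eq, ← ContinuousLinearMap.integral_comp_comm _ hi, ← integral_smul]
    refine integral_congr_ae (Filter.Eventually.of_forall fun l => ?_)
    simp only [Circle.smul_def, map_smul, smul_smul, Real.fourierChar_apply, ← Complex.exp_add]
    congr 2
    simp only [inner_sub_left, inner_sub_right, inner_add_right, inner_neg_right,
      real_inner_smul_left, real_inner_smul_right, real_inner_comm z]
    push_cast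
    ring
  simp only [h1]
  rw [integral_integral_swap]
  · refine integral_congr_ae (Filter.Eventually.of_forall fun l => ?_)
    simp only
    have h2 := ContinuousLinearMap.integral_apply
      ((Real.fourierIntegral_convergent_iff (κ - (2 : ℝ) • l)).2 (ha.integrable_slice ζ)) (φ l)
    rw [symbolFourier, Real.fourier_eq, h2]
    simp only [Circle.smul_def]
    rw [integral_smul]
    rfl
  · refine ((ha.integrable_slice ζ).norm.mul_prod hφ.norm).mono' ?_ ?_
    · have h3 : Continuous fun p : E × E => a (p.1, ζ) :=
        ha.contDiff.continuous.comp (by fun_prop)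
      have h4 := (ContinuousLinearMap.id ℂ (F →L[ℂ] F)).aestronglyMeasurable_comp₂
        (μ := (volume : Measure E).prod volume)
        h3.aestronglyMeasurable hφ.aestronglyMeasurable.comp_snd
      exact aestronglyMeasurable_fourierChar_smul (by fun_prop)
        (aestronglyMeasurable_fourierChar_smul (by fun_prop) h4)
    · refine Filter.Eventually.of_forall fun p => ?_
      simp only [Function.uncurry]
      rw [Circle.norm_smul, Circle.norm_smul]
      exact ContinuousLinearMap.le_opNorm _ _

lemma IsSymbol.integral_fourierInv {a : E × E → F →L[ℂ] F} (ha : IsSymbol a) {φ : E → F}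
    (hφ : Integrable φ) {ε : ℝ} (hε : 0 < ε) (x : E) :
    ∫ ξ : E, ∫ y, Complex.exp (Complex.I * ((⟪ξ, x - y⟫ : ℝ) : ℂ)) •
        (a ((2 : ℝ)⁻¹ • (x + y), ε • ξ)) (𝓕⁻ φ y) =
      ((2 * Real.pi) ^ finrank ℝ E) • 𝓕⁻ (kernelOp (ε * Real.pi) a φ) x := by
  have hδ : 0 < ε * Real.pi := by positivity
  rw [integral_eq_smul_integral_comp_affine _ Real.pi_pos 0]
  simp only [add_zero, integral_midpoint_fourierInv ha hφ]
  rw [integral_smul, smul_smul, mul_comm, ← mul_pow]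
  congr 1
  obtain ⟨M, hM, hb⟩ := ha.exists_symbolFourier_bound
  rw [integral_integral_swap]
  · have h1 : ∀ l : E, ∫ κ : E, Real.fourierChar ⟪κ - l, x⟫ •
        symbolFourier a (κ - (2 : ℝ) • l) (ε • Real.pi • κ) (φ l) =
      ∫ k : E, Real.fourierChar ⟪k, x⟫ •
        symbolFourier a (k - l) ((ε * Real.pi) • (k + l)) (φ l) := by
      intro l
      rw [← integral_add_right_eq_self _ l]
      refine integral_congr_ae (Filter.Eventually.of_forall fun k => ?_)
      simp only [add_sub_cancel_right, smul_smul]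
      rw [two_smul, add_sub_add_right_eq_sub]
    simp only [h1]
    rw [integral_integral_swap, Real.fourierInv_eq]
    · refine integral_congr_ae (Filter.Eventually.of_forall fun k => ?_)
      simp only [Circle.smul_def]
      rw [integral_smul]
      rfl
    · have h2 := (ha.integrable_kernel (ε * Real.pi) hφ).swap
      refine h2.norm.mono' ?_ (Filter.Eventually.of_forall fun p => ?_)
      · exact aestronglyMeasurable_fourierChar_smul (by fun_prop) h2.aestronglyMeasurable
      · simp only [Function.uncurry]
        rw [Circle.norm_smul]
        rfl
  · have hw : Integrable fun κ : E => M * decayWeight ((ε * Real.pi) • κ) :=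
      ((integrable_comp_smul_iff volume _ hδ.ne').2 integrable_decayWeight).const_mul M
    refine (hw.mul_prod hφ.norm).mono' ?_ (Filter.Eventually.of_forall fun p => ?_)
    · have h3 : Continuous fun p : E × E =>
          symbolFourier a (p.1 - (2 : ℝ) • p.2) (ε • Real.pi • p.1) :=
        ha.continuous_symbolFourier.comp
          (by fun_prop : Continuous fun p : E × E => (p.1 - (2 : ℝ) • p.2, ε • Real.pi • p.1))
      exact aestronglyMeasurable_fourierChar_smul (by fun_prop)
        ((ContinuousLinearMap.id ℂ (F →L[ℂ] F)).aestronglyMeasurable_comp₂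
          h3.aestronglyMeasurable hφ.aestronglyMeasurable.comp_snd)
    · simp only [Function.uncurry]
      rw [Circle.norm_smul, smul_smul]
      refine (ContinuousLinearMap.le_opNorm _ _).trans
        (mul_le_mul_of_nonneg_right ((hb _ _).trans ?_) (norm_nonneg _))
      exact mul_le_mul_of_nonneg_right (mul_le_of_le_one_right hM (decayWeight_le_one _))
        (decayWeight_pos _).le

end Quantization

lemma weylQ_fourierInv {d N : ℕ} {ε : ℝ} (hε : 0 < ε)
    {a : EuclideanSpace ℝ (Fin d) × EuclideanSpace ℝ (Fin d) →
      (EuclideanSpace ℂ (Fin N) →L[ℂ] EuclideanSpace ℂ (Fin N))} (ha : IsSymbol a)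
    {φ : EuclideanSpace ℝ (Fin d) → EuclideanSpace ℂ (Fin N)} (hφ : Integrable φ) :
    weylQ d N ε a (FourierTransformInv.fourierInv φ) =
      FourierTransformInv.fourierInv (kernelOp (ε * Real.pi) a φ) := by
  funext x
  rw [weylQ, ha.integral_fourierInv hφ hε, finrank_euclideanSpace_fin, smul_smul,
    Real.rpow_neg (by positivity), Real.rpow_natCast, inv_mul_cancel₀ (by positivity), one_smul]

section Majorant
open scoped FourierTransform ContDiff
open Module (finrank)

/-- Second order Taylor estimate at `0`. -/
lemma norm_sub_sub_deriv_le {V : Type*} [NormedAddCommGroup V] [NormedSpace ℝ V]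
    {f f' f'' : ℝ → V} (hf : ∀ s, HasDerivAt f (f' s) s) (hf' : ∀ s, HasDerivAt f' (f'' s) s)
    {M : ℝ} (hM : ∀ s, ‖f'' s‖ ≤ M) : ‖f 1 - f 0 - f' 0‖ ≤ M := by
  have hM0 : 0 ≤ M := (norm_nonneg _).trans (hM 0)
  have h1 : ∀ s ∈ Set.Icc (0 : ℝ) 1, ‖f' s - f' 0‖ ≤ M * (s - 0) :=
    norm_image_sub_le_of_norm_deriv_le_segment' (fun s _ => (hf' s).hasDerivWithinAt)
      fun s _ => hM s
  have h2 : ∀ s ∈ Set.Icc (0 : ℝ) 1, HasDerivWithinAt (fun s => f s - s • f' 0) (f' s - f' 0)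
      (Set.Icc 0 1) s := fun s _ =>
    ((hf s).sub (by simpa using (hasDerivAt_id s).smul_const (f' 0))).hasDerivWithinAt
  have h3 := norm_image_sub_le_of_norm_deriv_le_segment_01' h2 fun s hs =>
    (h1 s ⟨hs.1, hs.2.le⟩).trans (mul_le_of_le_one_right hM0 (by linarith [hs.2]))
  simpa [sub_right_comm] using h3

lemma exists_pos_bounds_mul_le {ι : Type*} [Nonempty ι] {f g : ι → ℝ} (hf : ∀ i, 0 ≤ f i)
    (hg : ∀ i, 0 ≤ g i) (hfb : BddAbove (Set.range f)) (hgb : BddAbove (Set.range g)) {K τ : ℝ}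
    (hτ : 0 < τ) (h : ∀ i j, f i * g j ≤ K) :
    ∃ α β, 0 < α ∧ 0 < β ∧ (∀ i, f i ≤ α) ∧ (∀ i, g i ≤ β) ∧ α * β ≤ K + τ := by
  have hF : 0 ≤ ⨆ i, f i := Real.iSup_nonneg hf
  have hG : 0 ≤ ⨆ i, g i := Real.iSup_nonneg hg
  have hFG : (⨆ i, f i) * (⨆ i, g i) ≤ K := by
    rw [Real.iSup_mul_of_nonneg hG]
    refine ciSup_le fun i => ?_
    rw [Real.mul_iSup_of_nonneg (hf i)]
    exact ciSup_le fun j => h i j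
  set s := min 1 (τ / ((⨆ i, f i) + (⨆ i, g i) + 1)) with hs
  have hs0 : 0 < s := lt_min one_pos (by positivity)
  refine ⟨(⨆ i, f i) + s, (⨆ i, g i) + s, by positivity, by positivity,
    fun i => (le_ciSup hfb i).trans (by linarith),
    fun i => (le_ciSup hgb i).trans (by linarith), ?_⟩
  have h1 : s * ((⨆ i, f i) + (⨆ i, g i) + 1) ≤ τ := by
    rw [← le_div_iff₀ (by positivity)]
    exact min_le_right _ _
  nlinarith [min_le_left 1 (τ / ((⨆ i, f i) + (⨆ i, g i) + 1))]

lemma mul_pow_le_of_mul_pow_succ_le {X r K : ℝ} (hX : 0 ≤ X) (hr : 0 ≤ r) {n : ℕ} (h0 : X ≤ K)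
    (h1 : X * r ^ (n + 1) ≤ K) : X * r ^ n ≤ K := by
  rcases le_total r 1 with h | h
  · exact (mul_le_of_le_one_right hX (pow_le_one₀ hr h)).trans h0
  · exact (mul_le_mul_of_nonneg_left (pow_le_pow_right₀ h n.le_succ) hX).trans h1

variable {E : Type*} [NormedAddCommGroup E] [InnerProductSpace ℝ E] [FiniteDimensional ℝ E]
  [MeasurableSpace E] [BorelSpace E]

lemma exists_integrable_majorant {α β : ℝ} (hα : 0 < α) (hβ : 0 < β) :
    ∃ (R : ℝ) (u : E → ℝ), 0 < R ∧ α * R ^ (finrank ℝ E + 1) = β ∧ Continuous u ∧ Integrable u ∧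
      (∀ x, 0 ≤ u x) ∧
      ∫ x, u x = 2 ^ (finrank ℝ E + 1) * (α * R ^ finrank ℝ E) * ∫ x : E, decayWeight x ∧
      ∀ x t, 0 ≤ t → t ≤ α → ‖x‖ ^ (finrank ℝ E + 1) * t ≤ β → t ≤ u x := by
  set n := finrank ℝ E
  obtain ⟨R, hR, hRn⟩ : ∃ R : ℝ, 0 < R ∧ R ^ (n + 1) = β / α :=
    ⟨(β / α) ^ (((n + 1 : ℕ) : ℝ)⁻¹), by positivity,
      Real.rpow_inv_natCast_pow (by positivity) (by omega)⟩
  refine ⟨R, fun x => 2 ^ (n + 1) * α * decayWeight (R⁻¹ • x), hR, ?_, ?_, ?_, ?_, ?_, ?_⟩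
  · rw [hRn, mul_div_cancel₀ _ hα.ne']
  · exact continuous_const.mul (continuous_decayWeight.comp (by fun_prop))
  · exact ((integrable_comp_smul_iff volume _ (inv_ne_zero hR.ne')).2
      integrable_decayWeight).const_mul _
  · intro x
    have := (decayWeight_pos (R⁻¹ • x)).le
    positivity
  · rw [integral_const_mul, Measure.integral_comp_smul volume (fun x : E => decayWeight x),
      abs_of_pos (by positivity), inv_pow, inv_inv, smul_eq_mul]
    ring
  · intro x t ht h0 h1
    refine mul_decayWeight_inv_le ht h0 ?_ le_rfl
    rw [norm_smul, norm_inv, Real.norm_of_nonneg hR.le, mul_pow, inv_pow, hRn, mul_assoc,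
      inv_div, div_mul_eq_mul_div, div_le_iff₀ hβ]
    exact mul_le_mul_of_nonneg_left h1 hα.le

lemma bddAbove_integral_norm_iteratedFDeriv {V : Type*} [NormedAddCommGroup V]
    [NormedSpace ℝ V] {a : E × E → V} (ha : IsSymbol a) (m n : ℕ) :
    BddAbove (Set.range fun ξ => ∫ x, ‖iteratedFDeriv ℝ n
      (fun x' => iteratedFDeriv ℝ m (fun ζ => a (x', ζ)) ξ) x‖) := by
  obtain ⟨M, hM, h⟩ := ((ha.iteratedFDeriv_snd m).iteratedFDeriv_fst n).exists_integral_norm_le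
  refine ⟨M, ?_⟩
  rintro _ ⟨ξ, rfl⟩
  exact (h ξ).trans (mul_le_of_le_one_right hM (decayWeight_le_one _))

variable {V W : Type*} [NormedAddCommGroup V] [NormedSpace ℂ V] [NormedAddCommGroup W]
  [NormedSpace ℂ W]

/-- The derivatives of the partial Fourier transforms of two symbols are dominated by a product of
integrable functions, whose integrals are controlled by `L¹` norms of mixed derivatives. -/
lemma exists_majorants {a : E × E → V} {b : E × E → W} (ha : IsSymbol a)
    (hb : IsSymbol b) {m m' : ℕ} {K τ : ℝ} (hτ : 0 < τ)
    (hK : ∀ g ≤ finrank ℝ E + 1, ∀ ξ ξ' : E,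
      (∫ x, ‖iteratedFDeriv ℝ (m' + g)
        (fun x' => iteratedFDeriv ℝ m (fun ζ => a (x', ζ)) ξ) x‖) *
      (∫ x, ‖iteratedFDeriv ℝ (m + g)
        (fun x' => iteratedFDeriv ℝ m' (fun ζ => b (x', ζ)) ξ') x‖) ≤ K) :
    ∃ u v : E → ℝ, Continuous u ∧ Continuous v ∧ Integrable u ∧ Integrable v ∧
      (∀ x, 0 ≤ u x) ∧ (∀ x, 0 ≤ v x) ∧
      (∫ x, u x) * (∫ x, v x) ≤
        (2 ^ (finrank ℝ E + 1) * ∫ x : E, decayWeight x) ^ 2 * (K + τ) ∧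
      ∀ δ, 0 < δ → ∀ η ζ ξ ξ', ‖symbolFourier ((dirSnd (δ • ζ))^[m] a) η ξ‖ *
        ‖symbolFourier ((dirSnd (-(δ • η)))^[m'] b) ζ ξ'‖ ≤ δ ^ (m + m') * (u η * v ζ) := by
  set n := finrank ℝ E
  have hex : ∀ g ≤ n + 1, _ := fun g hg => exists_pos_bounds_mul_le
    (fun ξ => integral_nonneg fun x => norm_nonneg _)
    (fun ξ => integral_nonneg fun x => norm_nonneg _)
    (bddAbove_integral_norm_iteratedFDeriv ha m (m' + g))
    (bddAbove_integral_norm_iteratedFDeriv hb m' (m + g)) hτ (hK g hg)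
  obtain ⟨α, β, hα, hβ, hαa, hβb, hαβ⟩ := hex 0 (Nat.zero_le _)
  obtain ⟨α', β', hα', hβ', hαa', hβb', hαβ'⟩ := hex (n + 1) le_rfl
  obtain ⟨R, u, hR, hαR, hu, hui, hu0, hus, hu1⟩ := exists_integrable_majorant (E := E) hα hα'
  obtain ⟨S, v, hS, hβS, hv, hvi, hv0, hvs, hv1⟩ := exists_integrable_majorant (E := E) hβ hβ'
  refine ⟨u, v, hu, hv, hui, hvi, hu0, hv0, ?_, fun δ hδ η ζ ξ ξ' => ?_⟩
  · have h1 : (α * β) * (R * S) ^ n ≤ K + τ := by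
      refine mul_pow_le_of_mul_pow_succ_le (by positivity) (by positivity) hαβ ?_
      rw [← hαR, ← hβS] at hαβ'
      calc _ = _ := by rw [mul_pow]; ring
        _ ≤ _ := hαβ'
    rw [hus, hvs]
    calc _ = (2 ^ (n + 1) * ∫ x : E, decayWeight x) ^ 2 * ((α * β) * (R * S) ^ n) := by
          rw [mul_pow R]; ring
      _ ≤ _ := mul_le_mul_of_nonneg_left h1 (sq_nonneg _)
  · set X := ‖symbolFourier ((dirSnd (δ • ζ))^[m] a) η ξ‖
    set Y := ‖symbolFourier ((dirSnd (-(δ • η)))^[m'] b) ζ ξ'‖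
    have hX : ∀ k, ‖η‖ ^ k * X ≤ δ ^ m * ‖ζ‖ ^ m * ∫ x, ‖iteratedFDeriv ℝ k
        (fun x' => iteratedFDeriv ℝ m (fun ζ => a (x', ζ)) ξ) x‖ := fun k => by
      refine (ha.pow_mul_norm_symbolFourier_iterate_dirSnd_le m k (δ • ζ) η ξ).trans_eq ?_
      rw [norm_smul, Real.norm_of_nonneg hδ.le, mul_pow]
    have hY : ∀ k, ‖ζ‖ ^ k * Y ≤ δ ^ m' * ‖η‖ ^ m' * ∫ x, ‖iteratedFDeriv ℝ k
        (fun x' => iteratedFDeriv ℝ m' (fun ζ => b (x', ζ)) ξ') x‖ := fun k => by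
      refine (hb.pow_mul_norm_symbolFourier_iterate_dirSnd_le m' k (-(δ • η)) ζ ξ').trans_eq ?_
      rw [norm_neg, norm_smul, Real.norm_of_nonneg hδ.le, mul_pow]
    have hX0 : 0 ≤ X := norm_nonneg _
    have hY0 : 0 ≤ Y := norm_nonneg _
    have huv : 0 ≤ δ ^ (m + m') * (u η * v ζ) :=
      mul_nonneg (by positivity) (mul_nonneg (hu0 _) (hv0 _))
    rcases (pow_nonneg (norm_nonneg ζ) m).eq_or_lt with hp | hp
    · have : X = 0 := le_antisymm (by simpa [← hp] using hX 0) hX0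
      rwa [this, zero_mul]
    rcases (pow_nonneg (norm_nonneg η) m').eq_or_lt with hq | hq
    · have : Y = 0 := le_antisymm (by simpa [← hq] using hY 0) hY0
      rwa [this, mul_zero]
    have hXu : ‖η‖ ^ m' * X / (δ ^ m * ‖ζ‖ ^ m) ≤ u η := by
      refine hu1 _ _ (by positivity) ?_ ?_
      · rw [div_le_iff₀ (by positivity), mul_comm α]
        exact (hX m').trans (mul_le_mul_of_nonneg_left (hαa ξ) (by positivity))
      · rw [← mul_div_assoc, div_le_iff₀ (by positivity), mul_comm α', ← mul_assoc, ← pow_add,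
          add_comm]
        exact (hX _).trans (mul_le_mul_of_nonneg_left (hαa' ξ) (by positivity))
    have hYv : ‖ζ‖ ^ m * Y / (δ ^ m' * ‖η‖ ^ m') ≤ v ζ := by
      refine hv1 _ _ (by positivity) ?_ ?_
      · rw [div_le_iff₀ (by positivity), mul_comm β]
        exact (hY m).trans (mul_le_mul_of_nonneg_left (hβb ξ') (by positivity))
      · rw [← mul_div_assoc, div_le_iff₀ (by positivity), mul_comm β', ← mul_assoc, ← pow_add,
          add_comm]
        exact (hY _).trans (mul_le_mul_of_nonneg_left (hβb' ξ') (by positivity))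
    calc X * Y = δ ^ (m + m') * ((‖η‖ ^ m' * X / (δ ^ m * ‖ζ‖ ^ m)) *
          (‖ζ‖ ^ m * Y / (δ ^ m' * ‖η‖ ^ m'))) := by
          field_simp
          ring
      _ ≤ _ := by
          refine mul_le_mul_of_nonneg_left ?_ (by positivity)
          exact mul_le_mul hXu hYv (by positivity) (hu0 _)

end Majorant

section Remainder
open scoped FourierTransform ContDiff
open Module (finrank)

variable {E : Type*} [NormedAddCommGroup E] [InnerProductSpace ℝ E] [FiniteDimensional ℝ E]
  [MeasurableSpace E] [BorelSpace E]
  {F : Type*} [NormedAddCommGroup F] [NormedSpace ℂ F]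

/-- The second order Taylor remainder of the composition of partial Fourier transforms of two
symbols, when their second arguments are moved by `v` and `w`. -/
def compRemainder (a b : E × E → F →L[ℂ] F) (v w η ζ ξ : E) : F →L[ℂ] F :=
  symbolFourier a η (ξ + v) ∘L symbolFourier b ζ (ξ + w) -
    symbolFourier a η ξ ∘L symbolFourier b ζ ξ -
    (symbolFourier a η ξ ∘L symbolFourier (dirSnd w b) ζ ξ +
      symbolFourier (dirSnd v a) η ξ ∘L symbolFourier b ζ ξ)

lemma norm_compRemainder_le {a b : E × E → F →L[ℂ] F} (ha : IsSymbol a) (hb : IsSymbol b)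
    {v w η ζ : E} {M₀ M₁ M₂ : ℝ}
    (h₀ : ∀ ξ ξ', ‖symbolFourier a η ξ‖ * ‖symbolFourier ((dirSnd w)^[2] b) ζ ξ'‖ ≤ M₀)
    (h₁ : ∀ ξ ξ', ‖symbolFourier (dirSnd v a) η ξ‖ * ‖symbolFourier (dirSnd w b) ζ ξ'‖ ≤ M₁)
    (h₂ : ∀ ξ ξ', ‖symbolFourier ((dirSnd v)^[2] a) η ξ‖ * ‖symbolFourier b ζ ξ'‖ ≤ M₂)
    (ξ : E) : ‖compRemainder a b v w η ζ ξ‖ ≤ (M₀ + M₁) + (M₁ + M₂) := by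
  set B := (ContinuousLinearMap.compL ℂ F F F).bilinearRestrictScalars ℝ
  have hd : ∀ {a b : E × E → F →L[ℂ] F}, IsSymbol a → IsSymbol b → ∀ s : ℝ,
      HasDerivAt (fun s : ℝ => B (symbolFourier a η (ξ + s • v)) (symbolFourier b ζ (ξ + s • w)))
        (B (symbolFourier a η (ξ + s • v)) (symbolFourier (dirSnd w b) ζ (ξ + s • w)) +
          B (symbolFourier (dirSnd v a) η (ξ + s • v)) (symbolFourier b ζ (ξ + s • w))) s :=
    fun ha hb s => B.hasDerivAt_of_bilinear (fun _ => ha.hasDerivAt_symbolFourier η ξ v s)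
      fun _ => hb.hasDerivAt_symbolFourier ζ ξ w s
  have h := norm_sub_sub_deriv_le (hd ha hb)
    (fun s => (hd ha (hb.dirSnd w) s).add (hd (ha.dirSnd v) hb s)) (M := (M₀ + M₁) + (M₁ + M₂)) ?_
  · simpa [B, compRemainder] using h
  · intro s
    have hB : ∀ {a b : E × E → F →L[ℂ] F} {ξ ξ' : E} {M : ℝ},
        ‖symbolFourier a η ξ‖ * ‖symbolFourier b ζ ξ'‖ ≤ M →
        ‖B (symbolFourier a η ξ) (symbolFourier b ζ ξ')‖ ≤ M := fun h =>
      (ContinuousLinearMap.opNorm_comp_le _ _).trans h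
    exact norm_add_le_of_le (norm_add_le_of_le (hB (h₀ _ _)) (hB (h₁ _ _)))
      (norm_add_le_of_le (hB (h₁ _ _)) (hB (h₂ _ _)))

section Basis
variable {V ι : Type*} [NormedAddCommGroup V] [NormedSpace ℂ V] [Fintype ι]

lemma symbolFourier_dirSnd_eq_sum {a : E × E → V} (ha : IsSymbol a)
    (e : OrthonormalBasis ι ℝ E) (v η ξ : E) :
    symbolFourier (dirSnd v a) η ξ =
      ∑ j, (⟪e j, v⟫ : ℂ) • symbolFourier (dirSnd (e j) a) η ξ := by
  have h : ∀ p, dirSnd v a p = ∑ j, (⟪e j, v⟫ : ℂ) • dirSnd (e j) a p := fun p => by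
    conv_lhs => rw [← e.sum_repr' v]
    simp only [dirSnd, Complex.coe_smul, ← map_smul, ← map_sum]
    congr 1
    simp [Prod.ext_iff, Prod.fst_sum, Prod.snd_sum]
  simp only [symbolFourier, Real.fourier_eq, h, Finset.smul_sum]
  rw [integral_finsetSum]
  · refine Finset.sum_congr rfl fun j _ => ?_
    rw [← integral_smul]
    simp only [smul_comm (_ : Circle)]
  · intro j _
    exact (Real.fourierIntegral_convergent_iff η).2
      (((ha.dirSnd (e j)).integrable_slice ξ).smul _)

end Basis

variable {ι : Type*} [Fintype ι]

/-- The Poisson bracket, in an orthonormal basis. -/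
def bracket (e : OrthonormalBasis ι ℝ E) (a b : E × E → F →L[ℂ] F) (p : E × E) : F →L[ℂ] F :=
  ∑ j, (dirSnd (e j) a p ∘L dirFst (e j) b p - dirFst (e j) a p ∘L dirSnd (e j) b p)

lemma hasConvKernel_bracket [CompleteSpace F] {a b : E × E → F →L[ℂ] F}
    (ha : IsSymbol a) (hb : IsSymbol b)
    (e : OrthonormalBasis ι ℝ E) :
    HasConvKernel (bracket e a b) fun η ζ ξ => ∑ j,
      (symbolFourier (dirSnd (e j) a) η ξ ∘L symbolFourier (dirFst (e j) b) ζ ξ -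
        symbolFourier (dirFst (e j) a) η ξ ∘L symbolFourier (dirSnd (e j) b) ζ ξ) :=
  HasConvKernel.sum _ fun _ => (HasConvKernel.comp (ha.dirSnd _) (hb.dirFst _)).sub
    (HasConvKernel.comp (ha.dirFst _) (hb.dirSnd _))

lemma smul_bracket_kernel {a b : E × E → F →L[ℂ] F} (ha : IsSymbol a) (hb : IsSymbol b)
    (e : OrthonormalBasis ι ℝ E) (ε : ℝ) (η ζ ξ : E) :
    ((ε : ℂ) / (2 * Complex.I)) • ∑ j,
      (symbolFourier (dirSnd (e j) a) η ξ ∘L symbolFourier (dirFst (e j) b) ζ ξ -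
        symbolFourier (dirFst (e j) a) η ξ ∘L symbolFourier (dirSnd (e j) b) ζ ξ) =
    symbolFourier a η ξ ∘L symbolFourier (dirSnd (-((ε * Real.pi) • η)) b) ζ ξ +
      symbolFourier (dirSnd ((ε * Real.pi) • ζ) a) η ξ ∘L symbolFourier b ζ ξ := by
  rw [symbolFourier_dirSnd_eq_sum ha e, symbolFourier_dirSnd_eq_sum hb e,
    ContinuousLinearMap.comp_finsetSum, ContinuousLinearMap.finsetSum_comp,
    ← Finset.sum_add_distrib, Finset.smul_sum]
  refine Finset.sum_congr rfl fun j _ => ?_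
  rw [ha.symbolFourier_dirFst, hb.symbolFourier_dirFst]
  simp only [ContinuousLinearMap.comp_smul, ContinuousLinearMap.smul_comp, smul_sub, smul_smul,
    inner_neg_right, real_inner_smul_right]
  rw [sub_eq_neg_add, ← neg_smul]
  congr 2
  · push_cast
    field_simp
  · push_cast
    field_simp

lemma integral_sub_sub_smul {X : Type*} [MeasurableSpace X] {μ : Measure X} {f g h : X → F}
    (hf : Integrable f μ) (hg : Integrable g μ) (hh : Integrable h μ) (c : ℂ) :
    ∫ x, f x ∂μ - ∫ x, g x ∂μ - c • ∫ x, h x ∂μ = ∫ x, (f x - g x - c • h x) ∂μ := by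
  rw [← integral_smul, ← integral_sub hf hg]
  exact (integral_sub (hf.sub hg) (hh.smul c)).symm

lemma kernelOp_composition [CompleteSpace F] {a b : E × E → F →L[ℂ] F}
    (ha : IsSymbol a) (hb : IsSymbol b)
    (e : OrthonormalBasis ι ℝ E) (ε : ℝ) {φ : E → F} (hφ : Integrable φ) (k : E) :
    kernelOp (ε * Real.pi) a (kernelOp (ε * Real.pi) b φ) k -
      kernelOp (ε * Real.pi) (fun p => a p ∘L b p) φ k -
      ((ε : ℂ) / (2 * Complex.I)) • kernelOp (ε * Real.pi) (bracket e a b) φ k =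
    ∫ p : E × E, compRemainder a b ((ε * Real.pi) • (p.1 - p.2)) (-((ε * Real.pi) • (k - p.1)))
      (k - p.1) (p.1 - p.2) ((ε * Real.pi) • (k + p.2)) (φ p.2) := by
  have hc := HasConvKernel.comp ha hb
  have hp := hasConvKernel_bracket ha hb e
  rw [kernelOp_kernelOp_eq ha hb _ hφ, hc.kernelOp_eq _ hφ, hp.kernelOp_eq _ hφ,
    integral_sub_sub_smul (ha.integrable_kernelOp_kernel hb _ hφ k) (hc.integrable_prod _ hφ k)
      (hp.integrable_prod _ hφ k)]
  refine integral_congr_ae (Filter.Eventually.of_forall fun p => ?_)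
  simp only
  rw [← _root_.smul_apply, smul_bracket_kernel ha hb e,
    ← _root_.sub_apply, ← _root_.sub_apply, compRemainder]
  have h1 : (ε * Real.pi) • (k + p.1) =
      (ε * Real.pi) • (k + p.2) + (ε * Real.pi) • (p.1 - p.2) := by
    rw [← smul_add]; congr 1; abel
  have h2 : (ε * Real.pi) • (p.1 + p.2) =
      (ε * Real.pi) • (k + p.2) + -((ε * Real.pi) • (k - p.1)) := by
    rw [← sub_eq_add_neg, ← smul_sub]; congr 1; abel
  rw [h1, h2]

end Remainder

section Young
open scoped FourierTransform ContDiff ENNReal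
open Module (finrank)

lemma sq_lintegral_mul_le {X : Type*} [MeasurableSpace X] {μ : Measure X} {u g : X → ℝ≥0∞}
    (hu : Measurable u) (hg : Measurable g) :
    (∫⁻ x, u x * g x ∂μ) ^ 2 ≤ (∫⁻ x, u x ∂μ) * ∫⁻ x, u x * g x ^ 2 ∂μ := by
  have h := ENNReal.lintegral_mul_le_Lp_mul_Lq μ Real.HolderConjugate.two_two
    (f := fun x => u x ^ (1 / 2 : ℝ)) (g := fun x => u x ^ (1 / 2 : ℝ) * g x)
    (hu.pow_const _).aemeasurable ((hu.pow_const _).mul hg).aemeasurable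
  have h2 : ∀ x, u x ^ (1 / 2 : ℝ) * u x ^ (1 / 2 : ℝ) = u x := fun x => by
    rw [← ENNReal.rpow_add_of_nonneg _ _ (by norm_num) (by norm_num)]
    norm_num
  have h3 : ∀ x : ℝ≥0∞, (x ^ (1 / 2 : ℝ)) ^ 2 = x := fun x => by
    rw [← ENNReal.rpow_natCast, ← ENNReal.rpow_mul]
    norm_num
  simp only [Pi.mul_apply, ← mul_assoc, h2, ENNReal.rpow_two, mul_pow, h3] at h
  calc _ ≤ _ := pow_le_pow_left' h 2
    _ = _ := by rw [mul_pow, h3, h3]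

variable {E : Type*} [NormedAddCommGroup E] [InnerProductSpace ℝ E] [FiniteDimensional ℝ E]
  [MeasurableSpace E] [BorelSpace E]

/-- Young's inequality `L¹ * L² → L²`. -/
lemma eLpNorm_two_lintegral_conv_le {u g : E → ℝ≥0∞} (hu : Measurable u) (hg : Measurable g) :
    eLpNorm (fun k => ∫⁻ l, u (k - l) * g l) 2 volume ≤ (∫⁻ x, u x) * eLpNorm g 2 volume := by
  have hm : Measurable fun p : E × E => u (p.1 - p.2) * g p.2 ^ 2 :=
    (hu.comp (measurable_fst.sub measurable_snd)).mul ((hg.comp measurable_snd).pow_const 2)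
  have h : ∫⁻ k, (∫⁻ l, u (k - l) * g l) ^ 2 ≤ (∫⁻ x, u x) ^ 2 * ∫⁻ l, g l ^ 2 := by
    calc ∫⁻ k, (∫⁻ l, u (k - l) * g l) ^ 2
        ≤ ∫⁻ k, (∫⁻ x, u x) * ∫⁻ l, u (k - l) * g l ^ 2 := by
          refine lintegral_mono fun k => ?_
          refine (sq_lintegral_mul_le (hu.comp (measurable_const.sub measurable_id)) hg).trans_eq ?_
          congr 1
          exact lintegral_sub_left_eq_self u k
      _ = (∫⁻ x, u x) * ∫⁻ l, ∫⁻ k, u (k - l) * g l ^ 2 := by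
          rw [lintegral_const_mul _ hm.lintegral_prod_right',
            lintegral_lintegral_swap hm.aemeasurable]
      _ = _ := by
          have : ∀ l, ∫⁻ k, u (k - l) * g l ^ 2 = (∫⁻ x, u x) * g l ^ 2 := fun l => by
            rw [lintegral_mul_const (f := fun k => u (k - l)) _ (hu.comp (measurable_sub_const l)),
              lintegral_sub_right_eq_self u l]
          simp only [this]
          rw [lintegral_const_mul _ (hg.pow_const 2), ← mul_assoc, sq]
  rw [eLpNorm_eq_lintegral_rpow_enorm_toReal (by norm_num) (by norm_num),
    eLpNorm_eq_lintegral_rpow_enorm_toReal (by norm_num) (by norm_num)]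
  simp only [ENNReal.toReal_ofNat, ENNReal.rpow_two, enorm_eq_self]
  refine (ENNReal.rpow_le_rpow h (by norm_num)).trans_eq ?_
  rw [ENNReal.mul_rpow_of_nonneg _ _ (by norm_num), ← ENNReal.rpow_natCast, ← ENNReal.rpow_mul]
  norm_num

lemma eLpNorm_two_lintegral_conv_conv_le {u v g : E → ℝ≥0∞} (hu : Measurable u) (hv : Measurable v)
    (hg : Measurable g) :
    eLpNorm (fun k => ∫⁻ p : E × E, u (k - p.1) * v (p.1 - p.2) * g p.2) 2 volume ≤
      (∫⁻ x, u x) * (∫⁻ x, v x) * eLpNorm g 2 volume := by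
  have hm : Measurable fun p : E × E => v (p.1 - p.2) * g p.2 :=
    (hv.comp (measurable_fst.sub measurable_snd)).mul (hg.comp measurable_snd)
  have h : ∀ k, ∫⁻ p : E × E, u (k - p.1) * v (p.1 - p.2) * g p.2 =
      ∫⁻ l, u (k - l) * ∫⁻ m, v (l - m) * g m := fun k => by
    simp only [mul_assoc]
    rw [Measure.volume_eq_prod, lintegral_prod]
    · refine lintegral_congr fun l => ?_
      exact lintegral_const_mul (u (k - l)) (f := fun m => v (l - m) * g m)
        (hm.comp measurable_prodMk_left)
    · exact ((hu.comp (measurable_const.sub measurable_fst)).mul hm).aemeasurable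
  simp only [h]
  refine (eLpNorm_two_lintegral_conv_le hu hm.lintegral_prod_right').trans ?_
  rw [mul_assoc]
  gcongr
  exact eLpNorm_two_lintegral_conv_le hv hg

variable {F : Type*} [NormedAddCommGroup F] [NormedSpace ℂ F] [CompleteSpace F]
  {ι : Type*} [Fintype ι]

lemma eLpNorm_majorant_le {u v : E → ℝ} (hu : Continuous u) (hv : Continuous v)
    (hui : Integrable u) (hvi : Integrable v) (hu0 : ∀ x, 0 ≤ u x) (hv0 : ∀ x, 0 ≤ v x) {L c : ℝ}
    (hc : 0 ≤ c)
    (h : (∫ x, u x) * (∫ x, v x) ≤ L) {g : E → ℝ≥0∞} (hg : Measurable g) :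
    eLpNorm (fun k => ∫⁻ p : E × E,
        ENNReal.ofReal (c * (u (k - p.1) * v (p.1 - p.2))) * g p.2) 2 volume ≤
      ENNReal.ofReal (c * L) * eLpNorm g 2 volume := by
  have h1 := eLpNorm_two_lintegral_conv_conv_le (u := fun x => ENNReal.ofReal (c * u x))
    (v := fun x => ENNReal.ofReal (v x))
    (hu.measurable.const_mul c).ennreal_ofReal hv.measurable.ennreal_ofReal hg
  have h2 : ∀ η ζ, ENNReal.ofReal (c * (u η * v ζ)) =
      ENNReal.ofReal (c * u η) * ENNReal.ofReal (v ζ) := fun η ζ => by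
    rw [← mul_assoc, ENNReal.ofReal_mul (mul_nonneg hc (hu0 _))]
  simp only [h2]
  refine h1.trans (mul_le_mul_left ?_ _)
  rw [← ofReal_integral_eq_lintegral_ofReal (hui.const_mul c)
      (Filter.Eventually.of_forall fun x => mul_nonneg hc (hu0 x)),
    ← ofReal_integral_eq_lintegral_ofReal hvi (Filter.Eventually.of_forall hv0),
    ← ENNReal.ofReal_mul (integral_nonneg fun x => mul_nonneg hc (hu0 x)), integral_const_mul,
    mul_assoc]
  exact ENNReal.ofReal_le_ofReal (mul_le_mul_of_nonneg_left h hc)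

/-- The constant of the remainder estimate. -/
def remainderConst (E : Type*) [NormedAddCommGroup E] [InnerProductSpace ℝ E]
    [FiniteDimensional ℝ E] [MeasurableSpace E] [BorelSpace E] : ℝ :=
  4 * Real.pi ^ 2 * (2 ^ (finrank ℝ E + 1) * ∫ x : E, decayWeight x) ^ 2

lemma eLpNorm_kernelOp_composition_le {a b : E × E → F →L[ℂ] F} (ha : IsSymbol a)
    (hb : IsSymbol b) (e : OrthonormalBasis ι ℝ E) {ε : ℝ} (hε : 0 < ε) {K : ℝ}
    (hK : ∀ m ≤ 2, ∀ g ≤ finrank ℝ E + 1, ∀ ξ ξ' : E,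
      (∫ x, ‖iteratedFDeriv ℝ ((2 - m) + g)
        (fun x' => iteratedFDeriv ℝ m (fun ζ => a (x', ζ)) ξ) x‖) *
      (∫ x, ‖iteratedFDeriv ℝ (m + g)
        (fun x' => iteratedFDeriv ℝ (2 - m) (fun ζ => b (x', ζ)) ξ') x‖) ≤ K)
    {φ : E → F} (hφ : Integrable φ) (hφc : Continuous φ) (hφ2 : MemLp φ 2 volume) :
    eLpNorm (fun k => kernelOp (ε * Real.pi) a (kernelOp (ε * Real.pi) b φ) k -
      kernelOp (ε * Real.pi) (fun p => a p ∘L b p) φ k -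
      ((ε : ℂ) / (2 * Complex.I)) • kernelOp (ε * Real.pi) (bracket e a b) φ k) 2 volume ≤
    ENNReal.ofReal (remainderConst E * ε ^ 2 * K) * eLpNorm φ 2 volume := by
  set c := (2 ^ (finrank ℝ E + 1) * ∫ x : E, decayWeight x) ^ 2 with hc
  have hδ : 0 < ε * Real.pi := by positivity
  set δ := ε * Real.pi with hδe
  suffices H : ∀ τ > 0, eLpNorm (fun k => kernelOp δ a (kernelOp δ b φ) k -
      kernelOp δ (fun p => a p ∘L b p) φ k -
      ((ε : ℂ) / (2 * Complex.I)) • kernelOp δ (bracket e a b) φ k) 2 volume ≤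
      ENNReal.ofReal (remainderConst E * ε ^ 2 * (K + τ)) * eLpNorm φ 2 volume by
    have ht : Filter.Tendsto (fun τ => ENNReal.ofReal (remainderConst E * ε ^ 2 * (K + τ)) *
        eLpNorm φ 2 volume) (nhdsWithin 0 (Set.Ioi 0))
        (nhds (ENNReal.ofReal (remainderConst E * ε ^ 2 * (K + 0)) * eLpNorm φ 2 volume)) := by
      refine ENNReal.Tendsto.mul_const (ENNReal.tendsto_ofReal ?_) (Or.inr hφ2.2.ne)
      exact ((by fun_prop : Continuous fun τ : ℝ => remainderConst E * ε ^ 2 * (K + τ)).tendsto 0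
        ).mono_left nhdsWithin_le_nhds
    rw [add_zero] at ht
    exact ge_of_tendsto ht (eventually_nhdsWithin_of_forall H)
  intro τ hτ
  obtain ⟨u₀, v₀, hu₀, hv₀, hui₀, hvi₀, hu0₀, hv0₀, hL₀, h₀⟩ :=
    exists_majorants ha hb (m := 0) (m' := 2) hτ (hK 0 (by norm_num))
  obtain ⟨u₁, v₁, hu₁, hv₁, hui₁, hvi₁, hu0₁, hv0₁, hL₁, h₁⟩ :=
    exists_majorants ha hb (m := 1) (m' := 1) hτ (hK 1 (by norm_num))
  obtain ⟨u₂, v₂, hu₂, hv₂, hui₂, hvi₂, hu0₂, hv0₂, hL₂, h₂⟩ :=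
    exists_majorants ha hb (m := 2) (m' := 0) hτ (hK 2 le_rfl)
  have hg : Measurable fun m => ‖φ m‖ₑ := hφc.enorm.measurable
  set G : (E → ℝ) → (E → ℝ) → E → ℝ≥0∞ := fun u v k => ∫⁻ p : E × E,
        ENNReal.ofReal (δ ^ 2 * (u (k - p.1) * v (p.1 - p.2))) * ‖φ p.2‖ₑ with hG
  have hGm : ∀ {u v : E → ℝ}, Continuous u → Continuous v → Measurable (Function.uncurry fun
      (k : E) (p : E × E) =>
        ENNReal.ofReal (δ ^ 2 * (u (k - p.1) * v (p.1 - p.2))) * ‖φ p.2‖ₑ) := fun hu hv => by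
    refine Measurable.mul ?_ (hg.comp (measurable_snd.comp measurable_snd))
    exact (Continuous.measurable (by fun_prop)).ennreal_ofReal
  have hGs : ∀ {u v : E → ℝ}, Continuous u → Continuous v →
      AEStronglyMeasurable (G u v) volume := fun hu hv =>
    (hGm hu hv).lintegral_prod_right'.aestronglyMeasurable
  have hpt : ∀ k, ‖kernelOp δ a (kernelOp δ b φ) k - kernelOp δ (fun p => a p ∘L b p) φ k -
      ((ε : ℂ) / (2 * Complex.I)) • kernelOp δ (bracket e a b) φ k‖ₑ ≤
      (G u₀ v₀ k + G u₁ v₁ k) + (G u₁ v₁ k + G u₂ v₂ k) := fun k => by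
    rw [kernelOp_composition ha hb e ε hφ k]
    refine (enorm_integral_le_lintegral_enorm _).trans ?_
    have hk : ∀ {u v : E → ℝ}, Continuous u → Continuous v → Measurable fun p : E × E =>
        ENNReal.ofReal (δ ^ 2 * (u (k - p.1) * v (p.1 - p.2))) * ‖φ p.2‖ₑ := fun hu hv =>
      (hGm hu hv).comp measurable_prodMk_left
    simp only [hG]
    rw [← lintegral_add_left (hk hu₀ hv₀), ← lintegral_add_left (hk hu₁ hv₁)]
    refine (lintegral_mono fun p => ?_).trans_eq
      (lintegral_add_left ((hk hu₀ hv₀).add (hk hu₁ hv₁)) _)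
    simp only [Pi.add_apply]
    have hp₀ := mul_nonneg (sq_nonneg δ) (mul_nonneg (hu0₀ (k - p.1)) (hv0₀ (p.1 - p.2)))
    have hp₁ := mul_nonneg (sq_nonneg δ) (mul_nonneg (hu0₁ (k - p.1)) (hv0₁ (p.1 - p.2)))
    have hp₂ := mul_nonneg (sq_nonneg δ) (mul_nonneg (hu0₂ (k - p.1)) (hv0₂ (p.1 - p.2)))
    rw [← add_mul, ← add_mul, ← add_mul, ← ENNReal.ofReal_add hp₀ hp₁,
      ← ENNReal.ofReal_add hp₁ hp₂, ← ENNReal.ofReal_add (add_nonneg hp₀ hp₁) (add_nonneg hp₁ hp₂)]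
    refine (ContinuousLinearMap.le_opENorm _ _).trans (mul_le_mul_left ?_ _)
    rw [← ofReal_norm]
    exact ENNReal.ofReal_le_ofReal (norm_compRemainder_le ha hb
      (fun ξ ξ' => h₀ δ hδ (k - p.1) (p.1 - p.2) ξ ξ')
      (fun ξ ξ' => h₁ δ hδ (k - p.1) (p.1 - p.2) ξ ξ')
      (fun ξ ξ' => h₂ δ hδ (k - p.1) (p.1 - p.2) ξ ξ') _)
  have hbd : ∀ {u v : E → ℝ}, Continuous u → Continuous v → Integrable u → Integrable v →
      (∀ x, 0 ≤ u x) → (∀ x, 0 ≤ v x) → (∫ x, u x) * (∫ x, v x) ≤ c * (K + τ) →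
      eLpNorm (G u v) 2 volume ≤ ENNReal.ofReal (δ ^ 2 * (c * (K + τ))) * eLpNorm φ 2 volume :=
    fun hu hv hui hvi hu0 hv0 hL => by
      have := eLpNorm_majorant_le hu hv hui hvi hu0 hv0 (sq_nonneg δ) hL hg
      rwa [eLpNorm_enorm] at this
  have hb₀ := hbd hu₀ hv₀ hui₀ hvi₀ hu0₀ hv0₀ hL₀
  have hb₁ := hbd hu₁ hv₁ hui₁ hvi₁ hu0₁ hv0₁ hL₁
  have hb₂ := hbd hu₂ hv₂ hui₂ hvi₂ hu0₂ hv0₂ hL₂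
  calc _ ≤ eLpNorm ((G u₀ v₀ + G u₁ v₁) + (G u₁ v₁ + G u₂ v₂)) 2 volume :=
        eLpNorm_mono_enorm fun k => (hpt k).trans_eq (by simp)
    _ ≤ (eLpNorm (G u₀ v₀) 2 volume + eLpNorm (G u₁ v₁) 2 volume) +
        (eLpNorm (G u₁ v₁) 2 volume + eLpNorm (G u₂ v₂) 2 volume) :=
        (eLpNorm_add_le ((hGs hu₀ hv₀).add (hGs hu₁ hv₁)) ((hGs hu₁ hv₁).add (hGs hu₂ hv₂))
          (by norm_num)).trans (add_le_add (eLpNorm_add_le (hGs hu₀ hv₀) (hGs hu₁ hv₁)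
            (by norm_num)) (eLpNorm_add_le (hGs hu₁ hv₁) (hGs hu₂ hv₂) (by norm_num)))
    _ ≤ 4 * (ENNReal.ofReal (δ ^ 2 * (c * (K + τ))) * eLpNorm φ 2 volume) := by
        refine (add_le_add (add_le_add hb₀ hb₁) (add_le_add hb₁ hb₂)).trans_eq ?_
        ring
    _ = _ := by
        rw [← mul_assoc, ← ENNReal.ofReal_ofNat, ← ENNReal.ofReal_mul (by norm_num),
          remainderConst, ← hc, hδe]
        congr 2
        ring

end Young

section Plancherel
open scoped FourierTransform ContDiff SchwartzMap

variable {E : Type*} [NormedAddCommGroup E] [InnerProductSpace ℝ E] [FiniteDimensional ℝ E]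
  [MeasurableSpace E] [BorelSpace E]

lemma integral_fourierInv_smul_eq {V : Type*} [NormedAddCommGroup V] [NormedSpace ℂ V]
    [CompleteSpace V] {f : E → ℂ} {g : E → V} (hf : Integrable f) (hg : Integrable g) :
    ∫ ξ, 𝓕⁻ f ξ • g ξ = ∫ x, f x • 𝓕⁻ g x := by
  have h := VectorFourier.integral_fourierIntegral_smul_eq_flip (μ := (volume : Measure E))
    (ν := (volume : Measure E)) (L := -innerₗ E) Real.continuous_fourierChar
    (by simp only [LinearMap.neg_apply, innerₗ_apply_apply]; fun_prop) hf hg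
  have hflip : (-innerₗ E).flip = -innerₗ E := by
    ext x y
    simp [real_inner_comm]
  rw [hflip] at h
  exact h

lemma continuous_fourierInv {V : Type*} [NormedAddCommGroup V] [NormedSpace ℂ V]
    {g : E → V} (hg : Integrable g) : Continuous (𝓕⁻ g) :=
  VectorFourier.fourierIntegral_continuous Real.continuous_fourierChar
    (by simp only [LinearMap.neg_apply, innerₗ_apply_apply]; fun_prop) hg

variable {F : Type*} [NormedAddCommGroup F] [InnerProductSpace ℂ F] [CompleteSpace F]

lemma fourierInv_ae_eq_toLp {h : E → F} (h1 : Integrable h) (h2 : MemLp h 2 volume) :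
    𝓕⁻ h =ᵐ[volume] (𝓕⁻ (h2.toLp h) : Lp F 2 (volume : Measure E)) := by
  refine ae_eq_of_integral_contDiff_smul_eq (continuous_fourierInv h1).locallyIntegrable
    ((Lp.memLp _).locallyIntegrable (by norm_num)) fun g hg hgs => ?_
  have hgc : HasCompactSupport fun x => (g x : ℂ) := hgs.comp_left Complex.ofReal_zero
  set ψ : 𝓢(E, ℂ) := hgc.toSchwartzMap (Complex.ofRealCLM.contDiff.comp hg) with hψ
  have hψg : ∀ x, ψ x = (g x : ℂ) := fun x => rfl
  have key := congrArg (fun T : 𝓢'(E, F) => T ψ)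
    (Lp.fourierInv_toTemperedDistribution_eq (h2.toLp h))
  simp only [TemperedDistribution.fourierInv_apply, Lp.toTemperedDistribution_apply] at key
  calc ∫ x, g x • 𝓕⁻ h x = ∫ x, ψ x • 𝓕⁻ h x := by simp [hψg]
    _ = ∫ x, (𝓕⁻ ψ) x • h x := by
        rw [← integral_fourierInv_smul_eq ψ.integrable h1, SchwartzMap.fourierInv_coe]
    _ = ∫ x, (𝓕⁻ ψ) x • (h2.toLp h) x := by
        refine integral_congr_ae ?_
        filter_upwards [h2.coeFn_toLp] with x hx
        rw [hx]
    _ = _ := key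
    _ = _ := by simp [hψg]

/-- Plancherel's theorem for integrable and square integrable functions. -/
lemma eLpNorm_fourierInv_eq {h : E → F} (h1 : Integrable h) (h2 : MemLp h 2 volume) :
    eLpNorm (𝓕⁻ h) 2 volume = eLpNorm h 2 volume := by
  have h3 : ‖(𝓕⁻ (h2.toLp h) : Lp F 2 (volume : Measure E))‖ = ‖h2.toLp h‖ :=
    (Lp.fourierTransformₗᵢ E F).symm.norm_map _
  rw [eLpNorm_congr_ae (fourierInv_ae_eq_toLp h1 h2),
    ← ENNReal.ofReal_toReal (Lp.eLpNorm_ne_top _), ← Lp.norm_def, h3, Lp.norm_toLp,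
    ENNReal.ofReal_toReal h2.2.ne]

lemma eLpNorm_fourier_schwartzMap (f : 𝓢(E, F)) :
    eLpNorm (𝓕 f : 𝓢(E, F)) 2 volume = eLpNorm f 2 volume := by
  have h := (eLpNorm_fourierInv_eq (𝓕 f).integrable ((𝓕 f).memLp 2 volume)).symm
  rwa [← SchwartzMap.fourierInv_coe, FourierTransform.fourierInv_fourier_eq] at h

end Plancherel

section Composition
open scoped FourierTransform ContDiff SchwartzMap
open Module

lemma remainderConst_pos {E : Type*} [NormedAddCommGroup E] [InnerProductSpace ℝ E]
    [FiniteDimensional ℝ E] [MeasurableSpace E] [BorelSpace E] : 0 < remainderConst E := by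
  have h : 0 < ∫ x : E, decayWeight x := by
    rw [integral_pos_iff_support_of_nonneg (fun x => (decayWeight_pos x).le) integrable_decayWeight,
      Function.support_eq_univ fun x => (decayWeight_pos x).ne']
    exact isOpen_univ.measure_pos _ Set.univ_nonempty
  unfold remainderConst
  positivity

lemma fourierInv_sub_sub_smul {E F : Type*} [NormedAddCommGroup E] [InnerProductSpace ℝ E]
    [FiniteDimensional ℝ E] [MeasurableSpace E] [BorelSpace E] [NormedAddCommGroup F]
    [InnerProductSpace ℂ F] [CompleteSpace F] {f g h : E → F} (hf : Integrable f)
    (hg : Integrable g) (hh : Integrable h) (c : ℂ) (x : E) :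
    𝓕⁻ f x - 𝓕⁻ g x - c • 𝓕⁻ h x = 𝓕⁻ (fun k => f k - g k - c • h k) x := by
  have key {u : E → F} (hu : Integrable u) :
      Integrable fun k => Real.fourierChar ⟪k, x⟫ • u k := by
    simpa using (Real.fourierIntegral_convergent_iff (-x)).2 hu
  simp only [Real.fourierInv_eq]
  rw [integral_sub_sub_smul (key hf) (key hg) (key hh)]
  simp only [smul_sub, smul_comm c]

lemma pbracket_eq_bracket (d N : ℕ)
    (a b : EuclideanSpace ℝ (Fin d) × EuclideanSpace ℝ (Fin d) →
      (EuclideanSpace ℂ (Fin N) →L[ℂ] EuclideanSpace ℂ (Fin N))) :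
    pbracket d N a b = bracket (EuclideanSpace.basisFun (Fin d) ℝ) a b := by
  funext p
  simp only [pbracket, bracket, dirSnd, dirFst, EuclideanSpace.basisFun_apply]

lemma eLpNorm_weylQ_composition_le {d N : ℕ} {ε : ℝ} (hε : 0 < ε)
    {a b : EuclideanSpace ℝ (Fin d) × EuclideanSpace ℝ (Fin d) →
      (EuclideanSpace ℂ (Fin N) →L[ℂ] EuclideanSpace ℂ (Fin N))}
    (ha : IsSymbol a) (hb : IsSymbol b) {K : ℝ}
    (hK : ∀ m ≤ 2, ∀ g ≤ d + 1, ∀ ξ ξ' : EuclideanSpace ℝ (Fin d),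
      (∫ x, ‖iteratedFDeriv ℝ ((2 - m) + g)
        (fun x' => iteratedFDeriv ℝ m (fun ζ => a (x', ζ)) ξ) x‖) *
      (∫ x, ‖iteratedFDeriv ℝ (m + g)
        (fun x' => iteratedFDeriv ℝ (2 - m) (fun ζ => b (x', ζ)) ξ') x‖) ≤ K)
    (f : 𝓢(EuclideanSpace ℝ (Fin d), EuclideanSpace ℂ (Fin N))) :
    eLpNorm (fun x => weylQ d N ε a (weylQ d N ε b f) x - weylQ d N ε (fun p => a p ∘L b p) f x -
      ((ε : ℂ) / (2 * Complex.I)) • weylQ d N ε (pbracket d N a b) f x) 2 volume ≤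
    ENNReal.ofReal (remainderConst (EuclideanSpace ℝ (Fin d)) * ε ^ 2 * K) *
      eLpNorm f 2 volume := by
  rw [pbracket_eq_bracket, ← eLpNorm_fourier_schwartzMap f]
  set e := EuclideanSpace.basisFun (Fin d) ℝ
  obtain ⟨g, hg⟩ : ∃ g : 𝓢(EuclideanSpace ℝ (Fin d), EuclideanSpace ℂ (Fin N)), 𝓕 f = g := ⟨_, rfl⟩
  rw [hg]
  have hfg : (f : EuclideanSpace ℝ (Fin d) → EuclideanSpace ℂ (Fin N)) =
      𝓕⁻ (g : EuclideanSpace ℝ (Fin d) → EuclideanSpace ℂ (Fin N)) := by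
    rw [← hg, ← SchwartzMap.fourierInv_coe, FourierTransform.fourierInv_fourier_eq]
  have hg1 : Integrable g volume := g.integrable
  have hg2 : MemLp g 2 volume := g.memLp 2 volume
  have hab : IsSymbol fun p => a p ∘L b p := (HasConvKernel.comp ha hb).isSymbol
  have hbr : IsSymbol (bracket e a b) := (hasConvKernel_bracket ha hb e).isSymbol
  have hb1 := hb.integrable_kernelOp (ε * Real.pi) hg1
  have h1 := ha.integrable_kernelOp (ε * Real.pi) hb1
  have h2 := hab.integrable_kernelOp (ε * Real.pi) hg1
  have h3 := hbr.integrable_kernelOp (ε * Real.pi) hg1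
  have hbound := eLpNorm_kernelOp_composition_le ha hb e hε (K := K)
    (by rwa [finrank_euclideanSpace_fin]) hg1 g.continuous hg2
  have hH1 := (h1.sub h2).sub (h3.smul ((ε : ℂ) / (2 * Complex.I)))
  have hH2 : MemLp _ 2 volume := ⟨hH1.aestronglyMeasurable,
    hbound.trans_lt (ENNReal.mul_lt_top ENNReal.ofReal_lt_top hg2.2)⟩
  rw [hfg]
  simp only [weylQ_fourierInv hε hb hg1, weylQ_fourierInv hε ha hb1, weylQ_fourierInv hε hab hg1,
    weylQ_fourierInv hε hbr hg1, fourierInv_sub_sub_smul h1 h2 h3]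
  exact (eLpNorm_fourierInv_eq hH1 hH2).trans_le hbound

end Composition

/-- Semiclassical symbolic calculus with remainder estimate:
`op_ε(a) ∘ op_ε(b) = op_ε(ab) + (ε/2i) op_ε({a,b}) + ε² R_ε`, where the remainder is
`L²`-bounded by a constant (depending only on `d`, `N`) times a product of `L¹`-in-`x`
norms of mixed derivatives of the symbols of total order `2` in `(x,ξ)` beyond `x`-order
`≤ d+1`. -/
theorem weyl_composition_formula (d N : ℕ) (hd : 1 ≤ d) (hN : 1 ≤ N) :
    ∃ C > (0:ℝ), ∀ ε : ℝ, 0 < ε →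
      ∀ a b : EuclideanSpace ℝ (Fin d) × EuclideanSpace ℝ (Fin d) →
        (EuclideanSpace ℂ (Fin N) →L[ℂ] EuclideanSpace ℂ (Fin N)),
      ContDiff ℝ (⊤ : ℕ∞) a → HasCompactSupport a →
      ContDiff ℝ (⊤ : ℕ∞) b → HasCompactSupport b →
      ∀ K : ℝ,
      (∀ m : ℕ, m ≤ 2 → ∀ g : ℕ, g ≤ d + 1 →
        ∀ ξ ξ' : EuclideanSpace ℝ (Fin d),
        (∫ x : EuclideanSpace ℝ (Fin d),
            ‖iteratedFDeriv ℝ ((2 - m) + g)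
              (fun x' => iteratedFDeriv ℝ m (fun ζ => a (x', ζ)) ξ) x‖) *
          (∫ x : EuclideanSpace ℝ (Fin d),
            ‖iteratedFDeriv ℝ (m + g)
              (fun x' => iteratedFDeriv ℝ (2 - m) (fun ζ => b (x', ζ)) ξ') x‖) ≤ K) →
      ∀ f : SchwartzMap (EuclideanSpace ℝ (Fin d)) (EuclideanSpace ℂ (Fin N)),
        eLpNorm (fun x =>
            weylQ d N ε a (weylQ d N ε b (fun y => f y)) x
              - weylQ d N ε (fun p => a p ∘L b p) (fun y => f y) x
              - ((ε : ℂ) / (2 * Complex.I)) •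
                  weylQ d N ε (pbracket d N a b) (fun y => f y) x) 2 volume
          ≤ ENNReal.ofReal (C * ε ^ 2 * K) * eLpNorm (fun x => f x) 2 volume := by
  refine ⟨remainderConst (EuclideanSpace ℝ (Fin d)), remainderConst_pos, ?_⟩
  intro ε hε a b ha ha' hb hb' K hK f
  exact eLpNorm_weylQ_composition_le hε ⟨ha, ha'⟩ ⟨hb, hb'⟩ hK f

end
end
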